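/- arXiv:math/0204213 — 3 statements merged into one kernel-verified Lean document; each statement's English description precedes it below -/
import Mathlib

section
/- Let K be a field of characteristic zero and let d > 2 be an integer. There exists an integer ρ(d) such that for every r ≥ ρ(d) the following holds: let g = Σ_{|I|=2d} b_I X^I be a homogeneous polynomial of degree 2d in X_0,…,X_r whose coefficients b_I lie in an extension field of K and are algebraically independent over K, and let K_1 be the field generated over K by the b_I. Then there is a finite field extension K^# of K_1 such that ĝ := g(1,x_1,…,x_r) is not a square in K^#(x_1,…,x_r) and the quadratic extension K^#(x_1,…,x_r)[w]/(w² − ĝ) — the function field of the double cover W of P^r branched over the hypersurface B = {g = 0} — admits a K^#-algebra embedding into a rational function field K^#(t_1,…,t_N) for some N; that is, the double cover W of P^r branched over the generic hypersurface B of degree 2d is unirational over a finite extension K^# of K_1 = K(θ(B)). -/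
universe u


open MvPolynomial

namespace DC

theorem aeval_mul_hom {F B ι : Type*} [CommRing F] [CommRing B] [Algebra F B]
    {q : MvPolynomial ι F} {k : ℕ} (hq : q.IsHomogeneous k) (c : B) (y : ι → B) :
    aeval (fun i => c * y i) q = c ^ k * aeval y q := by
  classical
  rw [aeval_def, aeval_def, eval₂_eq, eval₂_eq, Finset.mul_sum]
  refine Finset.sum_congr rfl fun m hm => ?_
  have h1 : m.degree = k := by
    have := hq (mem_support_iff.mp hm)
    rwa [Finsupp.degree_eq_weight_one]
  simp only [mul_pow, Finset.prod_mul_distrib]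
  rw [Finset.prod_pow_eq_pow_sum]
  have h2 : ∑ i ∈ m.support, m i = k := by
    rw [← h1]; rfl
  rw [h2]; ring

theorem zero_of_curves {F : Type*} [Field F] [Infinite F] {ι : Type*} (q : MvPolynomial ι F)
    (hq : ∀ v : ι → F, ∃ y : ι → PowerSeries F,
      (∀ i, PowerSeries.constantCoeff (y i) = v i) ∧
        aeval (fun i => PowerSeries.X * y i) q = 0) : q = 0 := by
  have key : ∀ k, homogeneousComponent k q = 0 := by
    intro k
    induction k using Nat.strong_induction_on with
    | _ k ih =>
      by_cases hk : k ∈ Finset.range (q.totalDegree + 1)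
      swap
      · refine homogeneousComponent_eq_zero _ _ ?_
        simpa using hk
      apply MvPolynomial.funext
      intro v
      obtain ⟨y, hy, h0⟩ := hq v
      rw [← sum_homogeneousComponent q, map_sum] at h0
      have h1 : ∀ i ∈ Finset.range (q.totalDegree + 1),
          aeval (fun i => PowerSeries.X * y i) (homogeneousComponent i q) =
          PowerSeries.X ^ i * aeval y (homogeneousComponent i q) := fun i _ =>
        aeval_mul_hom (homogeneousComponent_isHomogeneous i q) _ _
      rw [Finset.sum_congr rfl h1] at h0
      have h2 := congrArg (PowerSeries.coeff k) h0
      rw [map_sum, Finset.sum_eq_single k] at h2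
      · rw [PowerSeries.coeff_X_pow_mul', if_pos le_rfl, Nat.sub_self,
          PowerSeries.coeff_zero_eq_constantCoeff_apply, map_zero] at h2
        rw [map_zero, ← h2, map_aeval]
        simp only [hy]
        rw [eval, coe_eval₂Hom, coe_eval₂Hom]
        congr 1
      · intro j _ hj
        rcases lt_or_gt_of_ne hj with h | h
        · simp [ih j h]
        · rw [PowerSeries.coeff_X_pow_mul', if_neg (by omega)]
      · intro h; exact absurd hk h
  rw [← sum_homogeneousComponent q]
  exact Finset.sum_eq_zero fun i _ => key i

theorem algInd {F : Type*} [Field F] [Infinite F] {R : Type*} [CommRing R] [Algebra F R]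
    {ι : Type*} (x : ι → R) (a : ι → F)
    (hx : ∀ v : ι → F, ∃ (Θ : R →ₐ[F] PowerSeries F) (y : ι → PowerSeries F),
      (∀ i, Θ (x i) = PowerSeries.C (a i) + PowerSeries.X * y i) ∧
      ∀ i, PowerSeries.constantCoeff (y i) = v i) : AlgebraicIndependent F x := by
  rw [algebraicIndependent_iff]
  intro p hp
  have hq : aeval (fun i => X i + C (a i)) p = (0 : MvPolynomial ι F) := by
    apply zero_of_curves
    intro v
    obtain ⟨Θ, y, h1, h2⟩ := hx v
    refine ⟨y, h2, ?_⟩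
    have h3 := congrArg Θ hp
    rw [map_zero] at h3
    rw [← h3, ← AlgHom.comp_apply, ← AlgHom.comp_apply]
    congr 1
    ext i
    simp [h1, add_comm, PowerSeries.algebraMap_apply]
  have h4 : aeval (fun i => X i - C (a i)) (aeval (fun i => X i + C (a i)) p :
      MvPolynomial ι F) = p := by
    rw [← AlgHom.comp_apply]
    conv_rhs => rw [← AlgHom.id_apply (R := F) p]
    congr 1
    ext i
    simp [algebraMap_eq]
  rw [← h4, hq, map_zero]

/-- truncation of a power series to first order -/
noncomputable def tr (F : Type*) [Field F] : PowerSeries F →ₐ[F] DualNumber F where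
  toFun f := TrivSqZeroExt.inl (PowerSeries.constantCoeff f) +
    TrivSqZeroExt.inr (PowerSeries.coeff 1 f)
  map_one' := by ext <;> simp [PowerSeries.coeff_one]
  map_zero' := by ext <;> simp
  map_mul' f g := by
    ext
    · simp
    · simp [PowerSeries.coeff_one_mul]; ring
  map_add' f g := by ext <;> simp
  commutes' a := by
    ext <;> simp [PowerSeries.algebraMap_apply, PowerSeries.coeff_C, TrivSqZeroExt.algebraMap_eq_inl']

@[simp] theorem tr_fst {F : Type*} [Field F] (f : PowerSeries F) :
    (tr F f).fst = PowerSeries.constantCoeff f := by simp [tr]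
@[simp] theorem tr_snd {F : Type*} [Field F] (f : PowerSeries F) :
    (tr F f).snd = PowerSeries.coeff 1 f := by simp [tr]

/-- the first order point `ε δ` -/
noncomputable def ep {F : Type*} [Field F] (a : F) : DualNumber F := TrivSqZeroExt.inr a

/-- degree in the `U`-variables is `< D` -/
def DegLT {F : Type*} [CommRing F] {T U : Type*} [Fintype U] (D : ℕ)
    (r : MvPolynomial (T ⊕ U) F) : Prop :=
  ∀ m, coeff m r ≠ 0 → ∑ u, m (Sum.inr u) < D

theorem aeval_zero_left {F B : Type*} [CommRing F] [CommRing B] [Algebra F B] {T U : Type*}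
    {r : MvPolynomial (T ⊕ U) F}
    (hr : aeval (Sum.elim (fun _ => 0) X) r = (0 : MvPolynomial U F)) {s : T ⊕ U → B}
    (hs : ∀ t, s (Sum.inl t) = 0) : aeval s r = 0 := by
  have h := congrArg (aeval (fun u => s (Sum.inr u))) hr
  rw [map_zero, ← AlgHom.comp_apply] at h
  rw [← h]
  congr 1
  ext i
  rcases i with t | u <;> simp [hs]

/-- first order independence -/
theorem aeval_eps {F B : Type*} [CommRing F] [CommRing B] [Algebra F B] {T U : Type*}
    {r : MvPolynomial (T ⊕ U) F}
    (hr : aeval (Sum.elim (fun _ => 0) X) r = (0 : MvPolynomial U F)) (e : B) (he : e * e = 0)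
    {s s' : T ⊕ U → B}
    (hs : ∀ t, e ∣ s (Sum.inl t)) (hs' : ∀ t, s (Sum.inl t) = s' (Sum.inl t))
    (hu : ∀ u, e ∣ s (Sum.inr u) - s' (Sum.inr u)) : aeval s r = aeval s' r := by
  let z : T ⊕ U → B := Sum.elim (fun _ => 0) (s ∘ Sum.inr)
  let z' : T ⊕ U → B := Sum.elim (fun _ => 0) (s' ∘ Sum.inr)
  have key : ∀ p : MvPolynomial (T ⊕ U) F,
      aeval s p - aeval s' p = aeval z p - aeval z' p ∧ e ∣ aeval s p - aeval z p ∧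
      e ∣ aeval s p - aeval s' p ∧ e ∣ aeval s' p - aeval z' p := by
    intro p
    induction p using MvPolynomial.induction_on with
    | C a => simp
    | add p q hp hq =>
      obtain ⟨h1, ⟨a, h2⟩, ⟨b, h3⟩, ⟨c, h4⟩⟩ := hp
      obtain ⟨h1', ⟨a', h2'⟩, ⟨b', h3'⟩, ⟨c', h4'⟩⟩ := hq
      simp only [map_add]
      refine ⟨by linear_combination h1 + h1', ⟨a + a', by linear_combination h2 + h2'⟩,
        ⟨b + b', by linear_combination h3 + h3'⟩, ⟨c + c', by linear_combination h4 + h4'⟩⟩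
    | mul_X p i hp =>
      obtain ⟨h1, ⟨a, h2⟩, ⟨b, h3⟩, ⟨c, h4⟩⟩ := hp
      have hX : s i - s' i = z i - z' i ∧ e ∣ s i - z i ∧ e ∣ s i - s' i ∧ e ∣ s' i - z' i := by
        rcases i with t | u
        · refine ⟨by simp [z, z', hs'], by simpa [z] using hs t, by simp [hs'], ?_⟩
          simpa [z', ← hs'] using hs t
        · exact ⟨by simp [z, z'], by simp [z], hu u, by simp [z']⟩
      obtain ⟨h1', ⟨a', h2'⟩, ⟨b', h3'⟩, ⟨c', h4'⟩⟩ := hX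
      simp only [map_mul, aeval_X]
      set P := aeval s p
      set P' := aeval s' p
      set Q := aeval z p
      set Q' := aeval z' p
      refine ⟨?_, ⟨a * s i + Q * a', by linear_combination s i * h2 + Q * h2'⟩,
        ⟨b * s i + P' * b', by linear_combination s i * h3 + P' * h3'⟩,
        ⟨c * s' i + Q' * c', by linear_combination s' i * h4 + Q' * h4'⟩⟩
      have e1 : (P - P') * (s i - z i) = 0 := by
        rw [h3, h2']; linear_combination (b * a') * he
      have e2 : (P' - Q') * (s i - s' i) = 0 := by
        rw [h4, h3']; linear_combination (c * b') * he
      linear_combination e1 + e2 + z i * h1 + Q' * h1'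
  have := (key r).1
  rw [aeval_zero_left hr (s := z) (by simp [z]), aeval_zero_left hr (s := z') (by simp [z'])] at this
  rw [sub_self] at this
  exact sub_eq_zero.mp this

theorem eval_affine {R I : Type*} [CommRing R] [Fintype I] [DecidableEq I] (p : MvPolynomial I R)
    (hp : ∀ μ : I →₀ ℕ, 2 ≤ μ.degree → coeff μ p = 0) (l : I → R) :
    eval l p = coeff 0 p + ∑ b, coeff (Finsupp.single b 1) p * l b := by
  have h : p = C (coeff 0 p) + ∑ b, C (coeff (Finsupp.single b 1) p) * X b := by
    ext μ
    rw [coeff_add, coeff_sum]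
    simp only [coeff_C_mul, coeff_C, coeff_X]
    rcases Nat.lt_or_ge μ.degree 2 with h | h
    · interval_cases hh : μ.degree
      · have : μ = 0 := (Finsupp.degree_eq_zero_iff μ).mp hh
        subst this
        simp
      · obtain ⟨b, rfl⟩ : ∃ b, μ = Finsupp.single b 1 := by
          have : μ ≠ 0 := by rintro rfl; simp at hh
          obtain ⟨b, hb⟩ := Finsupp.support_nonempty_iff.mpr this
          refine ⟨b, ?_⟩
          have hle : Finsupp.single b 1 ≤ μ := by
            rw [Finsupp.single_le_iff]
            exact Nat.one_le_iff_ne_zero.mpr (Finsupp.mem_support_iff.mp hb)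
          obtain ⟨ν, rfl⟩ := exists_add_of_le hle
          rw [map_add, Finsupp.degree_single] at hh
          have : ν = 0 := (Finsupp.degree_eq_zero_iff ν).mp (by omega)
          rw [this, add_zero]
        rw [Finset.sum_eq_single b]
        · have h0 : (0 : I →₀ ℕ) ≠ Finsupp.single b 1 := by
            intro h0
            rw [← h0] at hh
            simp at hh
          simp [h0]
        · intro c _ hc
          rw [if_neg, mul_zero]
          intro h'
          exact hc ((Finsupp.single_left_inj one_ne_zero).mp h')
        · simp
    · rw [hp μ h, if_neg, Finset.sum_eq_zero, add_zero]
      · intro b _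
        rw [if_neg, mul_zero]
        rintro rfl
        simp at h
      · rintro rfl
        simp at h
  conv_lhs => rw [h]
  simp

end DC



open MvPolynomial

namespace DC

/-- the conclusion of the key proposition -/
def Concl (F : Type u) [Field F] (T U I : Type) (h : I → MvPolynomial U ℤ)
    (r : I → MvPolynomial (T ⊕ U) F) : Prop :=
  ∃ (N : ℕ) (R : Type u) (_ : CommRing R) (_ : Algebra F R) (aug : R →ₐ[F] F)
    (j : R →ₐ[F] FractionRing (MvPolynomial (Fin N) F)),
    Function.Injective j ∧ (∀ x, aug x ≠ 0 → IsUnit x) ∧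
    ∃ (τ : T → R) (v : U → R), (∀ t, aug (τ t) = 0) ∧ (∀ t, aug (v t) = 0) ∧
      (∀ i, aeval v (h i) + aeval (Sum.elim τ v) (r i) = 0) ∧
      ∀ δ : T → F, (∀ i, aeval (Sum.elim (fun t => ep (δ t)) (fun _ => 0)) (r i) =
        (0 : DualNumber F)) →
        ∃ Θ : R →ₐ[F] PowerSeries F, (∀ t, tr F (Θ (τ t)) = ep (δ t)) ∧
          ∀ t, tr F (Θ (v t)) = 0

theorem concl_empty (F : Type u) [Field F] (T U I : Type) [Fintype T] [IsEmpty U] [IsEmpty I]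
    (h : I → MvPolynomial U ℤ)
    (r : I → MvPolynomial (T ⊕ U) F) : Concl F T U I h r := by
  classical
  let N := Fintype.card T
  let e : T ≃ Fin N := Fintype.equivFin T
  let ev : MvPolynomial (Fin N) F →ₐ[F] F := aeval (fun _ => 0)
  let P : Ideal (MvPolynomial (Fin N) F) := RingHom.ker ev
  have : P.IsPrime := RingHom.ker_isPrime _
  have hP : ∀ x : P.primeCompl, ev x ≠ 0 := fun x hx => x.2 hx
  let aug : Localization.AtPrime P →ₐ[F] F :=
    IsLocalization.liftAlgHom (M := P.primeCompl) (f := ev)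
      (fun x => isUnit_iff_ne_zero.mpr (hP x))
  have hle : P.primeCompl ≤ nonZeroDivisors (MvPolynomial (Fin N) F) :=
    P.primeCompl_le_nonZeroDivisors
  let j : Localization.AtPrime P →ₐ[F] FractionRing (MvPolynomial (Fin N) F) :=
    IsLocalization.liftAlgHom (M := P.primeCompl)
      (f := IsScalarTower.toAlgHom F (MvPolynomial (Fin N) F) (FractionRing (MvPolynomial (Fin N) F)))
      (fun x => IsLocalization.map_units (M := nonZeroDivisors (MvPolynomial (Fin N) F)) _
        ⟨x.1, hle x.2⟩)
  have aug_alg : ∀ x, aug (algebraMap _ _ x) = ev x := fun x => by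
    simp [aug]
  have j_alg : ∀ x : MvPolynomial (Fin N) F, j (algebraMap _ _ x) = algebraMap _ _ x := fun x =>
    IsLocalization.lift_eq _ x
  refine ⟨N, Localization.AtPrime P, inferInstance, inferInstance, aug, j, ?_, ?_,
    fun t => algebraMap (MvPolynomial (Fin N) F) _ (X (e t)), isEmptyElim, ?_, isEmptyElim, isEmptyElim, ?_⟩
  · rw [injective_iff_map_eq_zero]
    intro x hx
    obtain ⟨a, s, rfl⟩ := IsLocalization.exists_mk'_eq P.primeCompl x
    rw [IsLocalization.mk'_eq_zero_iff]
    refine ⟨1, ?_⟩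
    have h1 := congrArg j (IsLocalization.mk'_spec (Localization.AtPrime P) a s)
    rw [map_mul, hx, zero_mul, j_alg] at h1
    have := (IsFractionRing.injective (MvPolynomial (Fin N) F)
      (FractionRing (MvPolynomial (Fin N) F))) (h1.symm.trans (map_zero _).symm)
    simp [this]
  · intro x hx
    obtain ⟨a, s, rfl⟩ := IsLocalization.exists_mk'_eq P.primeCompl x
    have h1 := congrArg aug (IsLocalization.mk'_spec (Localization.AtPrime P) a s)
    rw [map_mul, aug_alg, aug_alg] at h1
    have ha : ev a ≠ 0 := by
      rw [← h1]; exact mul_ne_zero hx (hP s)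
    have h2 := IsLocalization.mk'_spec (Localization.AtPrime P) a s
    have h3 : IsUnit (algebraMap _ (Localization.AtPrime P) a) :=
      IsLocalization.map_units (M := P.primeCompl) _ ⟨a, fun hh => ha hh⟩
    rw [← h2] at h3
    exact isUnit_of_mul_isUnit_left h3
  · intro t
    rw [aug_alg]
    simp [ev]
  · intro δ _
    let f : MvPolynomial (Fin N) F →ₐ[F] PowerSeries F :=
      aeval (fun i => PowerSeries.C (δ (e.symm i)) * PowerSeries.X)
    have hf : ∀ p, PowerSeries.constantCoeff (f p) = ev p := by
      intro p
      have : (PowerSeries.constantCoeff (R := F)).comp (f : MvPolynomial (Fin N) F →+* _) =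
        (ev : MvPolynomial (Fin N) F →+* F) := by
        ext i <;> simp [f, ev]
      exact congrArg (fun g : MvPolynomial (Fin N) F →+* F => g p) this
    let Θ : Localization.AtPrime P →ₐ[F] PowerSeries F :=
      IsLocalization.liftAlgHom (M := P.primeCompl) (f := f)
        (fun x => by
          rw [PowerSeries.isUnit_iff_constantCoeff, hf]
          exact isUnit_iff_ne_zero.mpr (hP x))
    refine ⟨Θ, fun t => ?_, isEmptyElim⟩
    have : Θ (algebraMap (MvPolynomial (Fin N) F) _ (X (e t))) = f (X (e t)) :=
      IsLocalization.lift_eq _ _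
    rw [this]
    ext <;> simp [f, ep]

/-- joint filtration -/
def Fil {F : Type*} [CommRing F] {T U I : Type*} [Fintype U] (k : ℕ)
    (G : MvPolynomial I (MvPolynomial (T ⊕ U) F)) : Prop :=
  ∀ μ m, coeff m (coeff μ G) ≠ 0 → μ.degree + ∑ u, m (Sum.inr u) ≤ k

section fil
variable {F : Type*} [CommRing F] {T U I : Type*} [Fintype U]

theorem Fil.mono {k l : ℕ} (h : k ≤ l) {G : MvPolynomial I (MvPolynomial (T ⊕ U) F)}
    (hG : Fil k G) : Fil l G := fun μ m hm => (hG μ m hm).trans h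

theorem Fil.zero {k : ℕ} : Fil k (0 : MvPolynomial I (MvPolynomial (T ⊕ U) F)) := by
  intro μ m hm; simp at hm

theorem Fil.add {k : ℕ} {G H : MvPolynomial I (MvPolynomial (T ⊕ U) F)}
    (hG : Fil k G) (hH : Fil k H) : Fil k (G + H) := by
  intro μ m hm
  rw [coeff_add, coeff_add] at hm
  by_cases h : coeff m (coeff μ G) = 0
  · rw [h, zero_add] at hm
    exact hH μ m hm
  · exact hG μ m h

theorem Fil.mul {k l : ℕ} {G H : MvPolynomial I (MvPolynomial (T ⊕ U) F)}
    (hG : Fil k G) (hH : Fil l H) : Fil (k + l) (G * H) := by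
  classical
  intro μ m hm
  rw [coeff_mul, coeff_sum] at hm
  obtain ⟨⟨a, b⟩, hab, h1⟩ := Finset.exists_ne_zero_of_sum_ne_zero hm
  rw [coeff_mul] at h1
  obtain ⟨⟨c, e⟩, hce, h2⟩ := Finset.exists_ne_zero_of_sum_ne_zero h1
  have ha := hG a c (left_ne_zero_of_mul h2)
  have hb := hH b e (right_ne_zero_of_mul h2)
  rw [Finset.HasAntidiagonal.mem_antidiagonal] at hab hce
  simp only at hab hce
  subst hab hce
  simp only [map_add, Finsupp.add_apply, Finset.sum_add_distrib]
  omega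

theorem Fil.CC (a : F) : Fil 0 (C (C a) : MvPolynomial I (MvPolynomial (T ⊕ U) F)) := by
  classical
  intro μ m hm
  rw [coeff_C] at hm
  split_ifs at hm with h
  · rw [coeff_C] at hm
    split_ifs at hm with h'
    · subst h h'; simp
    · simp at hm
  · simp at hm

theorem Fil.X (i : I) : Fil 1 (X i : MvPolynomial I (MvPolynomial (T ⊕ U) F)) := by
  classical
  intro μ m hm
  rw [coeff_X] at hm
  split_ifs at hm with h
  · rw [MvPolynomial.coeff_one] at hm
    split_ifs at hm with h'
    · subst h h'; simp
    · simp at hm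
  · simp at hm

theorem Fil.CXl (t : T) : Fil 0 (C (MvPolynomial.X (Sum.inl t)) :
    MvPolynomial I (MvPolynomial (T ⊕ U) F)) := by
  classical
  intro μ m hm
  rw [coeff_C] at hm
  split_ifs at hm with h
  · rw [coeff_X] at hm
    split_ifs at hm with h'
    · subst h h'; simp
    · simp at hm
  · simp at hm

theorem Fil.CXr (t : U) : Fil 1 (C (MvPolynomial.X (Sum.inr t)) :
    MvPolynomial I (MvPolynomial (T ⊕ U) F)) := by
  classical
  intro μ m hm
  rw [coeff_C] at hm
  split_ifs at hm with h
  · rw [coeff_X] at hm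
    split_ifs at hm with h'
    · subst h h'; simp [Finsupp.single_apply]
    · simp at hm
  · simp at hm

theorem Fil.one : Fil 0 (1 : MvPolynomial I (MvPolynomial (T ⊕ U) F)) := by
  have := Fil.CC (T := T) (U := U) (I := I) (1 : F)
  simpa using this

theorem Fil.pow {k : ℕ} {G : MvPolynomial I (MvPolynomial (T ⊕ U) F)}
    (hG : Fil k G) (n : ℕ) : Fil (n * k) (G ^ n) := by
  induction n with
  | zero => simpa using Fil.one
  | succ n ih =>
    rw [pow_succ, add_mul, one_mul]
    exact ih.mul hG

theorem Fil.sum {ι : Type*} {k : ℕ} (s : Finset ι) {G : ι → MvPolynomial I (MvPolynomial (T ⊕ U) F)}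
    (hG : ∀ i ∈ s, Fil k (G i)) : Fil k (∑ i ∈ s, G i) := by
  classical
  induction s using Finset.induction_on with
  | empty => simpa using Fil.zero
  | insert a s ha ih =>
    rw [Finset.sum_insert ha]
    exact (hG a (by simp)).add (ih fun i hi => hG i (by simp [hi]))

theorem Fil.prod {ι : Type*} {k : ι → ℕ} (s : Finset ι)
    {G : ι → MvPolynomial I (MvPolynomial (T ⊕ U) F)}
    (hG : ∀ i ∈ s, Fil (k i) (G i)) : Fil (∑ i ∈ s, k i) (∏ i ∈ s, G i) := by
  classical
  induction s using Finset.induction_on with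
  | empty => simpa using Fil.one
  | insert a s ha ih =>
    rw [Finset.prod_insert ha, Finset.sum_insert ha]
    exact (hG a (by simp)).mul (ih fun i hi => hG i (by simp [hi]))

/-- substitution in a polynomial whose degree in the right variables is `< D` -/
theorem Fil.aeval {T' U' : Type*} [Fintype U'] {D : ℕ}
    {r : MvPolynomial (T' ⊕ U') F} (hr : DegLT (D + 1) r)
    (s : T' ⊕ U' → MvPolynomial I (MvPolynomial (T ⊕ U) F))
    (hl : ∀ t, Fil 0 (s (Sum.inl t))) (hu : ∀ t, Fil 1 (s (Sum.inr t))) :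
    Fil D (MvPolynomial.aeval s r) := by
  classical
  rw [aeval_def, eval₂_eq]
  refine Fil.sum _ fun m hm => ?_
  have h1 := hr m (mem_support_iff.mp hm)
  have h2 : Fil (∑ i ∈ m.support, m i * (Sum.elim (fun _ => 0) (fun _ => 1) i : ℕ))
      (∏ i ∈ m.support, s i ^ m i) := by
    refine Fil.prod _ fun i _ => Fil.pow ?_ _
    rcases i with t | t
    · exact hl t
    · exact hu t
  have h3 : ∑ i ∈ m.support, m i * (Sum.elim (fun _ => 0) (fun _ => 1) i : ℕ) ≤
      ∑ u, m (Sum.inr u) := by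
    have hss : m.support.filter (fun i => (Sum.elim (fun _ => 0) (fun _ => 1) i : ℕ) ≠ 0) ⊆
        Finset.univ.map (⟨Sum.inr, Sum.inr_injective⟩ : U' ↪ T' ⊕ U') := by
      intro i hi
      rcases i with t | t
      · simp at hi
      · simp
    calc _ = ∑ i ∈ m.support.filter
          (fun i => (Sum.elim (fun _ => 0) (fun _ => 1) i : ℕ) ≠ 0),
          m i * (Sum.elim (fun _ => 0) (fun _ => 1) i : ℕ) := by
          symm
          refine Finset.sum_filter_of_ne fun i _ hi => right_ne_zero_of_mul hi
      _ ≤ ∑ i ∈ Finset.univ.map (⟨Sum.inr, Sum.inr_injective⟩ : U' ↪ T' ⊕ U'),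
          m i * (Sum.elim (fun _ => 0) (fun _ => 1) i : ℕ) :=
          Finset.sum_le_sum_of_subset hss
      _ = _ := by simp
  have h4 := (Fil.CC (T := T) (U := U) (I := I) (coeff m r)).mul h2
  rw [zero_add] at h4
  exact h4.mono (by omega)

end fil

end DC



open MvPolynomial

namespace DC

section step
variable {I J U' : Type} [Fintype I] [DecidableEq I] [Fintype J] [Fintype U']
  (p : J → I) (mu : J → I →₀ ℕ) (b : J → I)

/-- the polynomials `h` of the next stage -/
noncomputable def newh (h' : J → MvPolynomial U' ℤ) (i : I) : MvPolynomial (I ⊕ J ⊕ U') ℤ :=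
  X (Sum.inl i) + ∑ x, if p x = i then
    X (Sum.inr (Sum.inl x)) * rename Sum.inl (monomial (mu x - Finsupp.single (b x) 1) 1) +
    rename Sum.inl (monomial (mu x) 1) * rename (fun v => Sum.inr (Sum.inr v)) (h' x) else 0

variable {F : Type u} [Field F] {T : Type} [Fintype T]

/-- the substitution -/
noncomputable def sub : T ⊕ (I ⊕ J ⊕ U') → MvPolynomial I (MvPolynomial ((T ⊕ J) ⊕ U') F) :=
  Sum.elim (fun t => C (X (Sum.inl (Sum.inl t))))
    (Sum.elim X (Sum.elim (fun x => C (X (Sum.inl (Sum.inr x))) * X (b x))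
      (fun v => C (X (Sum.inr v)))))

/-- substituted polynomials -/
noncomputable def GG (r : MvPolynomial (T ⊕ (I ⊕ J ⊕ U')) F) :
    MvPolynomial I (MvPolynomial ((T ⊕ J) ⊕ U') F) := aeval (sub b) r

theorem map_GG {R : Type*} [CommRing R] [Algebra F R] (r : MvPolynomial (T ⊕ (I ⊕ J ⊕ U')) F)
    (τ : T → R) (π : J → R) (v : U' → R) :
    map (aeval (Sum.elim (Sum.elim τ π) v) : MvPolynomial ((T ⊕ J) ⊕ U') F →ₐ[F] R).toRingHom
      (GG b r) =
    aeval (Sum.elim (fun t => C (τ t)) (Sum.elim X (Sum.elim (fun x => C (π x) * X (b x))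
      (fun w => C (v w)))) : _ → MvPolynomial I R) r := by
  have : ((mapAlgHom (aeval (Sum.elim (Sum.elim τ π) v) :
      MvPolynomial ((T ⊕ J) ⊕ U') F →ₐ[F] R) : MvPolynomial I _ →ₐ[F] _).comp
      (aeval (sub b))) = aeval (Sum.elim (fun t => C (τ t)) (Sum.elim X
        (Sum.elim (fun x => C (π x) * X (b x)) (fun w => C (v w)))) : _ → MvPolynomial I R) := by
    apply MvPolynomial.algHom_ext
    intro i
    rcases i with t | i | x | w <;> simp [sub]
  exact congrArg (fun g : MvPolynomial (T ⊕ (I ⊕ J ⊕ U')) F →ₐ[F] MvPolynomial I R => g r) this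

theorem eval_map_GG {R : Type*} [CommRing R] [Algebra F R]
    (r : MvPolynomial (T ⊕ (I ⊕ J ⊕ U')) F)
    (τ : T → R) (π : J → R) (v : U' → R) (l : I → R) :
    eval l (map (aeval (Sum.elim (Sum.elim τ π) v) :
      MvPolynomial ((T ⊕ J) ⊕ U') F →ₐ[F] R).toRingHom (GG b r)) =
    aeval (Sum.elim τ (Sum.elim l (Sum.elim (fun x => π x * l (b x)) v))) r := by
  rw [map_GG]
  have : (((aeval l : MvPolynomial I R →ₐ[R] R).restrictScalars F).comp
      (aeval (Sum.elim (fun t => C (τ t)) (Sum.elim X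
        (Sum.elim (fun x => C (π x) * X (b x)) (fun w => C (v w)))) : _ → MvPolynomial I R))) =
      aeval (Sum.elim τ (Sum.elim l (Sum.elim (fun x => π x * l (b x)) v))) := by
    apply MvPolynomial.algHom_ext
    intro i
    rcases i with t | i | x | w <;> simp
  exact congrArg (fun g : MvPolynomial (T ⊕ (I ⊕ J ⊕ U')) F →ₐ[F] R => g r) this

theorem Zc {r : MvPolynomial (T ⊕ (I ⊕ J ⊕ U')) F}
    (hr : aeval (Sum.elim (fun _ => 0) X) r = (0 : MvPolynomial (I ⊕ J ⊕ U') F)) (μ : I →₀ ℕ) :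
    aeval (Sum.elim (fun _ => 0) X) (coeff μ (GG b r)) = (0 : MvPolynomial U' F) := by
  have h := map_GG b r (fun _ => (0 : MvPolynomial U' F)) (fun _ => 0) X
  rw [aeval_zero_left hr (by simp)] at h
  have h2 := congrArg (coeff μ) h
  rw [coeff_map, coeff_zero] at h2
  have hh : (Sum.elim (Sum.elim (fun _ => 0) (fun _ => 0)) X : (T ⊕ J) ⊕ U' → MvPolynomial U' F) =
      Sum.elim (fun _ => 0) X := by
    funext i
    rcases i with (t | t) | t <;> simp
  rw [hh] at h2
  exact h2

theorem Fil_GG {D : ℕ} {r : MvPolynomial (T ⊕ (I ⊕ J ⊕ U')) F} (hr : DegLT (D + 1) r) :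
    Fil D (GG b r) := by
  refine Fil.aeval hr _ ?_ ?_
  · intro t
    exact Fil.CXl (Sum.inl t)
  · rintro (i | x | v)
    · exact Fil.X i
    · have := (Fil.CXl (F := F) (U := U') (I := I) (Sum.inr x : T ⊕ J)).mul (Fil.X (b x))
      rwa [zero_add] at this
    · exact Fil.CXr v

/-- the new equations -/
noncomputable def newr (r : I → MvPolynomial (T ⊕ (I ⊕ J ⊕ U')) F) (x : J) :
    MvPolynomial ((T ⊕ J) ⊕ U') F :=
  X (Sum.inl (Sum.inr x)) + coeff (mu x) (GG b (r (p x)))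

theorem newr_deg (D : I → ℕ) (r : I → MvPolynomial (T ⊕ (I ⊕ J ⊕ U')) F)
    (hr : ∀ i, DegLT (D i) (r i)) (x : J) (hx : (mu x).degree < D (p x)) :
    DegLT (D (p x) - (mu x).degree) (newr p mu b r x) := by
  classical
  intro m hm
  rw [newr, coeff_add] at hm
  by_cases h : coeff m (coeff (mu x) (GG b (r (p x)))) = 0
  · rw [h, add_zero, coeff_X] at hm
    split_ifs at hm with h'
    · subst h'
      simpa using hx
    · simp at hm
  · have : DegLT ((D (p x) - 1) + 1) (r (p x)) := by
      rw [Nat.sub_add_cancel (by omega)]; exact hr _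
    have := Fil_GG b this _ _ h
    omega

theorem newr_Z (r : I → MvPolynomial (T ⊕ (I ⊕ J ⊕ U')) F)
    (hr : ∀ i, aeval (Sum.elim (fun _ => 0) X) (r i) = (0 : MvPolynomial (I ⊕ J ⊕ U') F)) (x : J) :
    aeval (Sum.elim (fun _ => 0) X) (newr p mu b r x) = (0 : MvPolynomial U' F) := by
  rw [newr, map_add, Zc b (hr _)]
  simp

theorem aeval_newh {R : Type*} [CommRing R] (h' : J → MvPolynomial U' ℤ) (i : I)
    (hb : ∀ x, b x ∈ (mu x).support)
    (l : I → R) (π : J → R) (v : U' → R) :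
    aeval (Sum.elim l (Sum.elim (fun x => π x * l (b x)) v)) (newh p mu b h' i) =
      eval l (X i + ∑ x, if p x = i then monomial (mu x) (π x + aeval v (h' x)) else 0) := by
  rw [newh, map_add, map_add, map_sum, map_sum, aeval_X, eval_X]
  congr 1
  refine Finset.sum_congr rfl fun x _ => ?_
  split_ifs with h
  · have e1 : monomial (mu x) (1 : ℤ) = monomial (mu x - Finsupp.single (b x) 1) 1 * X (b x) := by
      rw [X, monomial_mul, tsub_add_cancel_of_le, one_mul]
      rw [Finsupp.single_le_iff]
      exact Nat.one_le_iff_ne_zero.mpr (Finsupp.mem_support_iff.mp (hb x))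
    have e2 : eval l (monomial (mu x) (π x + aeval v (h' x))) =
        (π x + aeval v (h' x)) * aeval l (monomial (mu x) (1 : ℤ)) := by
      rw [eval_monomial, aeval_monomial]; simp
    rw [e2]
    simp only [map_add, map_mul, aeval_rename, aeval_X, Sum.elim_inr, Sum.elim_inl]
    have e3 : (Sum.elim l (Sum.elim (fun x => π x * l (b x)) v)) ∘ Sum.inl = l := by
      ext; simp
    have e4 : (Sum.elim l (Sum.elim (fun x => π x * l (b x)) v)) ∘
        (fun v => Sum.inr (Sum.inr v)) = v := by
      ext; simp
    rw [e3, e4, e1, map_mul, aeval_X]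
    ring
  · simp

/-- the affine polynomials in `λ` -/
noncomputable def CL {R : Type*} [CommRing R] [Algebra F R] (h' : J → MvPolynomial U' ℤ)
    (r : I → MvPolynomial (T ⊕ (I ⊕ J ⊕ U')) F)
    (τ : T → R) (π : J → R) (v : U' → R) (i : I) : MvPolynomial I R :=
  X i + (∑ x, if p x = i then monomial (mu x) (π x + aeval v (h' x)) else 0) +
    map (aeval (Sum.elim (Sum.elim τ π) v) :
      MvPolynomial ((T ⊕ J) ⊕ U') F →ₐ[F] R).toRingHom (GG b (r i))

theorem eval_CL {R : Type*} [CommRing R] [Algebra F R] (h' : J → MvPolynomial U' ℤ)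
    (r : I → MvPolynomial (T ⊕ (I ⊕ J ⊕ U')) F) (hb : ∀ x, b x ∈ (mu x).support)
    (τ : T → R) (π : J → R) (v : U' → R) (l : I → R) (i : I) :
    eval l (CL p mu b h' r τ π v i) =
      aeval (Sum.elim l (Sum.elim (fun x => π x * l (b x)) v)) (newh p mu b h' i) +
      aeval (Sum.elim τ (Sum.elim l (Sum.elim (fun x => π x * l (b x)) v))) (r i) := by
  rw [CL, map_add, eval_map_GG, aeval_newh _ _ _ _ _ hb]

theorem coeff_CL_low {R : Type*} [CommRing R] [Algebra F R] (h' : J → MvPolynomial U' ℤ)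
    (r : I → MvPolynomial (T ⊕ (I ⊕ J ⊕ U')) F) (hmu : ∀ x, 2 ≤ (mu x).degree)
    (τ : T → R) (π : J → R) (v : U' → R) (i : I) (μ : I →₀ ℕ) (hμ : μ.degree < 2) :
    coeff μ (CL p mu b h' r τ π v i) = coeff μ (X i) +
      aeval (Sum.elim (Sum.elim τ π) v) (coeff μ (GG b (r i))) := by
  rw [CL, coeff_add, coeff_add, coeff_sum, Finset.sum_eq_zero, add_zero, coeff_map]
  · rfl
  · intro x _
    split_ifs
    · rw [coeff_monomial, if_neg]
      rintro rfl
      have := hmu x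
      omega
    · simp

theorem coeff_CL_high {R : Type*} [CommRing R] [Algebra F R] (h' : J → MvPolynomial U' ℤ)
    (D : I → ℕ)
    (r : I → MvPolynomial (T ⊕ (I ⊕ J ⊕ U')) F) (hr : ∀ i, DegLT (D i) (r i))
    (hD : ∀ i, 1 ≤ D i)
    (hp : ∀ x, (mu x).degree < D (p x))
    (hinj : ∀ x y, p x = p y → mu x = mu y → x = y)
    (hsurj : ∀ i μ, 2 ≤ μ.degree → μ.degree < D i → ∃ x, p x = i ∧ mu x = μ)
    (τ : T → R) (π : J → R) (v : U' → R)
    (heq : ∀ x, aeval v (h' x) + aeval (Sum.elim (Sum.elim τ π) v) (newr p mu b r x) = 0)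
    (i : I) (μ : I →₀ ℕ) (hμ : 2 ≤ μ.degree) :
    coeff μ (CL p mu b h' r τ π v i) = 0 := by
  classical
  have hX : coeff μ (X i : MvPolynomial I R) = 0 := by
    rw [coeff_X, if_neg]
    rintro rfl
    simp at hμ
  rw [CL, coeff_add, coeff_add, coeff_sum, coeff_map, hX, zero_add]
  rcases Nat.lt_or_ge μ.degree (D i) with h | h
  · obtain ⟨x, rfl, rfl⟩ := hsurj i μ hμ h
    rw [Finset.sum_eq_single x]
    · rw [if_pos rfl, coeff_monomial, if_pos rfl]
      have := heq x
      rw [newr, map_add, aeval_X] at this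
      simp only [Sum.elim_inl, Sum.elim_inr] at this
      simp only [AlgHom.toRingHom_eq_coe, RingHom.coe_coe]
      linear_combination this
    · intro y _ hy
      split_ifs with hh
      · rw [coeff_monomial, if_neg]
        intro hh'
        exact hy (hinj _ _ hh hh')
      · simp
    · simp
  · rw [Finset.sum_eq_zero, zero_add]
    · have : coeff μ (GG b (r i)) = 0 := by
        by_contra hne
        obtain ⟨m, hm⟩ := MvPolynomial.ne_zero_iff.mp hne
        have h1 : DegLT ((D i - 1) + 1) (r i) := by
          rw [Nat.sub_add_cancel (hD i)]; exact hr _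
        have := Fil_GG b h1 _ _ hm
        have := hD i
        omega
      rw [this, map_zero]
    · intro x _
      split_ifs with hh
      · rw [coeff_monomial, if_neg]
        rintro rfl
        have := hp x
        rw [hh] at this
        omega
      · simp

end step

/-- solving an affine linear system -/
theorem solve {R I F : Type*} [CommRing R] [Fintype I] [DecidableEq I] [Field F]
    (aug : R →+* F) (haug : ∀ x, aug x ≠ 0 → IsUnit x) (A : Matrix I I R) (c : I → R)
    (hA : ∀ i k, aug (A i k) = (1 : Matrix I I F) i k) :
    ∃ l : I → R, (∀ i, c i + ∑ k, A i k * l k = 0) ∧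
      ∀ (S : Type u) [CommRing S] (f : R →+* S), (∀ i, f (c i) = 0) → ∀ i, f (l i) = 0 := by
  have hdet : IsUnit A.det := by
    apply haug
    rw [RingHom.map_det]
    have : aug.mapMatrix A = 1 := by
      ext i k; simp [hA]
    rw [this]; simp
  refine ⟨-(A⁻¹.mulVec c), ?_, ?_⟩
  · intro i
    have h : A.mulVec (-(A⁻¹.mulVec c)) = -c := by
      rw [Matrix.mulVec_neg, Matrix.mulVec_mulVec, Matrix.mul_nonsing_inv _ hdet, Matrix.one_mulVec]
    have := congrFun h i
    rw [Matrix.mulVec, dotProduct] at this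
    rw [this]; simp
  · intro S _ f hf i
    simp [Matrix.mulVec, dotProduct, hf]

end DC



open MvPolynomial

namespace DC

section step
variable {I J U' : Type} [Fintype I] [DecidableEq I] [Fintype J] [Fintype U']
  (p : J → I) (mu : J → I →₀ ℕ) (b : J → I)
variable {F : Type u} [Field F] {T : Type} [Fintype T]

/-- first order expansion -/
noncomputable def Gh (r : MvPolynomial (T ⊕ (I ⊕ J ⊕ U')) F) (δ : T → F) :
    MvPolynomial I (DualNumber F) :=
  aeval (Sum.elim (fun t => C (ep (δ t))) (Sum.elim X (fun _ => 0))) r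

theorem ep_eq (a : F) : ep a = ep 1 * TrivSqZeroExt.inl a := by
  ext <;> simp [ep]

theorem map_eps (r : MvPolynomial (T ⊕ (I ⊕ J ⊕ U')) F)
    (hr : aeval (Sum.elim (fun _ => 0) X) r = (0 : MvPolynomial (I ⊕ J ⊕ U') F))
    (δ : T → F) (π : J → F) :
    map (aeval (Sum.elim (Sum.elim (fun t => ep (δ t)) (fun x => ep (π x))) (fun _ => 0)) :
      MvPolynomial ((T ⊕ J) ⊕ U') F →ₐ[F] DualNumber F).toRingHom (GG b r) = Gh r δ := by
  rw [map_GG, Gh]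
  refine aeval_eps hr (C (ep 1)) ?_ ?_ ?_ ?_
  · rw [← C_mul]
    have : (ep 1 * ep 1 : DualNumber F) = 0 := by ext <;> simp [ep]
    rw [this, C_0]
  · intro t
    simp only [Sum.elim_inl]
    rw [ep_eq (δ t), C_mul]
    exact dvd_mul_right _ _
  · intro t; simp
  · rintro (i | x | v)
    · simp
    · simp only [Sum.elim_inr, Sum.elim_inl, sub_zero]
      rw [ep_eq (π x), C_mul, mul_assoc]
      exact dvd_mul_right _ _
    · simp

theorem coeff_Gh (r : MvPolynomial (T ⊕ (I ⊕ J ⊕ U')) F)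
    (hr : aeval (Sum.elim (fun _ => 0) X) r = (0 : MvPolynomial (I ⊕ J ⊕ U') F))
    (δ : T → F) (μ : I →₀ ℕ) : coeff μ (Gh r δ) = ep (coeff μ (Gh r δ)).snd := by
  have h1 : mapAlgHom (σ := I) (TrivSqZeroExt.fstHom F F F) (Gh r δ) = 0 := by
    rw [Gh, ← AlgHom.comp_apply, comp_aeval]
    apply aeval_zero_left hr
    intro t
    simp [ep]
  have h2 := congrArg (coeff μ) h1
  rw [mapAlgHom_apply] at h2
  have h3 : (coeff μ (Gh r δ)).fst = 0 := by
    have : coeff μ (map (TrivSqZeroExt.fstHom F F F : DualNumber F →+* F) (Gh r δ)) = 0 := h2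
    rw [coeff_map] at this
    exact this
  ext
  · simp [ep, h3]
  · simp [ep]

theorem coeff0_Gh (r : MvPolynomial (T ⊕ (I ⊕ J ⊕ U')) F) (δ : T → F) :
    coeff 0 (Gh r δ) = aeval (Sum.elim (fun t => ep (δ t)) (fun _ => 0)) r := by
  have : (((aeval (fun _ => 0) : MvPolynomial I (DualNumber F) →ₐ[DualNumber F]
      DualNumber F).restrictScalars F).comp
      (aeval (Sum.elim (fun t => C (ep (δ t))) (Sum.elim X (fun _ => 0))))) =
      (aeval (Sum.elim (fun t => ep (δ t)) (fun _ => 0)) :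
        MvPolynomial (T ⊕ (I ⊕ J ⊕ U')) F →ₐ[F] DualNumber F) := by
    apply MvPolynomial.algHom_ext
    intro i
    rcases i with t | i | x | w <;> simp
  rw [← this, AlgHom.comp_apply]
  change coeff 0 (Gh r δ) = aeval (fun _ => 0) (Gh r δ)
  rw [← constantCoeff_eq, aeval_zero']
  simp

theorem step (D : I → ℕ) (hD : ∀ i, 1 ≤ D i) (hp2 : ∀ x, 2 ≤ (mu x).degree)
    (hp : ∀ x, (mu x).degree < D (p x))
    (hinj : ∀ x y, p x = p y → mu x = mu y → x = y)
    (hsurj : ∀ i μ, 2 ≤ μ.degree → μ.degree < D i → ∃ x, p x = i ∧ mu x = μ)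
    (hb : ∀ x, b x ∈ (mu x).support) (h' : J → MvPolynomial U' ℤ)
    (r : I → MvPolynomial (T ⊕ (I ⊕ J ⊕ U')) F)
    (hr : ∀ i, DegLT (D i) (r i))
    (hZ : ∀ i, aeval (Sum.elim (fun _ => 0) X) (r i) = (0 : MvPolynomial (I ⊕ J ⊕ U') F))
    (H : Concl F (T ⊕ J) U' J h' (newr p mu b r)) :
    Concl F T (I ⊕ J ⊕ U') I (newh p mu b h') r := by
  obtain ⟨N, R, _, _, aug, j, hj, haug, τ', v', haτ, hav, heq, hlift⟩ := H
  obtain ⟨τ, π, rfl⟩ : ∃ (τ : T → R) (π : J → R), τ' = Sum.elim τ π :=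
    ⟨τ' ∘ Sum.inl, τ' ∘ Sum.inr, by ext x; rcases x with x | x <;> rfl⟩
  have hcomp : ∀ q : MvPolynomial ((T ⊕ J) ⊕ U') F,
      aeval (Sum.elim (fun _ => 0) X) q = (0 : MvPolynomial U' F) →
      aug (aeval (Sum.elim (Sum.elim τ π) v') q) = 0 := by
    intro q hq
    rw [← AlgHom.comp_apply, comp_aeval]
    apply aeval_zero_left hq
    intro t
    exact haτ t
  obtain ⟨l, hl, hl0⟩ := solve.{u} (aug : R →+* F) haug
    (Matrix.of fun i k => coeff (Finsupp.single k 1) (CL p mu b h' r τ π v' i))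
    (fun i => coeff 0 (CL p mu b h' r τ π v' i)) (by
      intro i k
      rw [Matrix.of_apply, coeff_CL_low _ _ _ _ _ hp2 _ _ _ _ _ (by simp)]
      rw [map_add, RingHom.coe_coe, hcomp _ (Zc b (hZ i) _), add_zero, coeff_X, Matrix.one_apply]
      by_cases hik : i = k
      · subst hik; simp
      · rw [if_neg hik, if_neg, map_zero]
        intro hh
        exact hik ((Finsupp.single_left_inj one_ne_zero).mp hh))
  have hc0 : ∀ i, coeff 0 (CL p mu b h' r τ π v' i) =
      aeval (Sum.elim (Sum.elim τ π) v') (coeff 0 (GG b (r i))) := by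
    intro i
    rw [coeff_CL_low _ _ _ _ _ hp2 _ _ _ _ _ (by simp)]
    simp
  have hal : ∀ i, aug (l i) = 0 := by
    intro i
    refine hl0 F (aug : R →+* F) ?_ i
    intro i
    rw [hc0, RingHom.coe_coe]
    exact hcomp _ (Zc b (hZ i) _)
  refine ⟨N, R, inferInstance, inferInstance, aug, j, hj, haug, τ,
    Sum.elim l (Sum.elim (fun x => π x * l (b x)) v'), fun t => haτ (Sum.inl t), ?_, ?_, ?_⟩
  · rintro (i | x | w)
    · exact hal i
    · simp [hal]
    · exact hav w
  · intro i
    rw [← eval_CL _ _ _ _ _ hb, eval_affine]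
    · exact hl i
    · intro μ hμ
      exact coeff_CL_high p mu b h' D r hr hD hp hinj hsurj τ π v' heq i μ hμ
  · intro δ hδ
    obtain ⟨Θ, h1, h2⟩ := hlift
      (Sum.elim δ fun x => -(coeff (mu x) (Gh (r (p x)) δ)).snd) (by
        intro x
        have e1 : (fun t => ep ((Sum.elim δ fun x => -(coeff (mu x) (Gh (r (p x)) δ)).snd :
            T ⊕ J → F) t)) = Sum.elim (fun t => ep (δ t))
            (fun x => ep (-(coeff (mu x) (Gh (r (p x)) δ)).snd)) := by
          funext t; rcases t with t | t <;> rfl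
        rw [e1, newr, map_add, aeval_X]
        have e2 := congrArg (coeff (mu x)) (map_eps b (r (p x)) (hZ _) δ
          (fun x => -(coeff (mu x) (Gh (r (p x)) δ)).snd))
        rw [coeff_map, AlgHom.toRingHom_eq_coe, RingHom.coe_coe] at e2
        rw [e2, coeff_Gh _ (hZ _)]
        ext <;> simp [ep])
    have hθl : ∀ i, tr F (Θ (l i)) = 0 := by
      intro i
      refine hl0 _ (((tr F).comp Θ : R →ₐ[F] DualNumber F) : R →+* DualNumber F) ?_ i
      intro i
      rw [hc0, RingHom.coe_coe, ← AlgHom.comp_apply, comp_aeval]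
      have e1 : (fun i => ((tr F).comp Θ) (Sum.elim (Sum.elim τ π) v' i)) =
          Sum.elim (Sum.elim (fun t => ep (δ t))
            (fun x => ep (-(coeff (mu x) (Gh (r (p x)) δ)).snd))) (fun _ => 0) := by
        funext t
        rcases t with (t | x) | w
        · exact h1 (Sum.inl t)
        · exact h1 (Sum.inr x)
        · exact h2 w
      rw [e1]
      have e2 := congrArg (coeff 0) (map_eps b (r i) (hZ _) δ
          (fun x => -(coeff (mu x) (Gh (r (p x)) δ)).snd))
      rw [coeff_map, AlgHom.toRingHom_eq_coe, RingHom.coe_coe] at e2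
      rw [e2, coeff0_Gh]
      exact hδ i
    refine ⟨Θ, fun t => h1 (Sum.inl t), ?_⟩
    rintro (i | x | w)
    · exact hθl i
    · simp [hθl]
    · exact h2 w

theorem newh_const (h' : J → MvPolynomial U' ℤ) (hc : ∀ x, constantCoeff (h' x) = 0)
    (i : I) : constantCoeff (newh p mu b h' i) = 0 := by
  rw [newh, map_add, map_sum, constantCoeff_X, zero_add]
  refine Finset.sum_eq_zero fun x _ => ?_
  split_ifs
  · rw [map_add, map_mul, map_mul, constantCoeff_X, constantCoeff_rename (φ := h' x), hc]
    simp
  · simp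

theorem newh_deg (D : I → ℕ) (hD : ∀ i, 1 ≤ D i)
    (hp : ∀ x, (mu x).degree < D (p x)) (hb : ∀ x, b x ∈ (mu x).support)
    (h' : J → MvPolynomial U' ℤ) (hh : ∀ x, (h' x).totalDegree ≤ D (p x) - (mu x).degree)
    (i : I) : (newh p mu b h' i).totalDegree ≤ D i := by
  rw [newh]
  refine (totalDegree_add _ _).trans (max_le ?_ ?_)
  · rw [totalDegree_X]; exact hD i
  · refine totalDegree_finsetSum_le fun x _ => ?_
    split_ifs with hx
    · subst hx
      have h1 : ((mu x - Finsupp.single (b x) 1).degree) + 1 = (mu x).degree := by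
        have : mu x - Finsupp.single (b x) 1 + Finsupp.single (b x) 1 = mu x := by
          rw [tsub_add_cancel_of_le]
          rw [Finsupp.single_le_iff]
          exact Nat.one_le_iff_ne_zero.mpr (Finsupp.mem_support_iff.mp (hb x))
        conv_rhs => rw [← this]
        simp
      have h2 : ∀ ν : I →₀ ℕ, (rename Sum.inl (monomial ν 1) :
          MvPolynomial (I ⊕ J ⊕ U') ℤ).totalDegree ≤ ν.degree := fun ν =>
        (totalDegree_rename_le _ _).trans (totalDegree_monomial_le _ _)
      have h3 := h2 (mu x - Finsupp.single (b x) 1)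
      have h4 := h2 (mu x)
      have h5 := totalDegree_rename_le (fun v => (Sum.inr (Sum.inr v) : I ⊕ J ⊕ U')) (h' x)
      have h6 := hh x
      have h7 := hp x
      refine (totalDegree_add _ _).trans (max_le ?_ ?_)
      · refine (totalDegree_mul _ _).trans ?_
        rw [totalDegree_X]
        omega
      · refine (totalDegree_mul _ _).trans ?_
        omega
    · simp

theorem newh_line (hp2 : ∀ x, 2 ≤ (mu x).degree) (h' : J → MvPolynomial U' ℤ)
    (hc : ∀ x, constantCoeff (h' x) = 0) (i : I) :
    ∃ w : I ⊕ J ⊕ U' → Polynomial ℤ, aeval w (newh p mu b h' i) = Polynomial.X := by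
  refine ⟨Sum.elim (Pi.single i Polynomial.X) (fun _ => 0), ?_⟩
  rw [newh, map_add, map_sum, aeval_X, Finset.sum_eq_zero]
  · simp
  · intro x _
    split_ifs
    · rw [map_add, map_mul, map_mul, aeval_rename (p := h' x), aeval_X]
      have : ((Sum.elim (Pi.single i Polynomial.X) (fun _ => 0) : I ⊕ J ⊕ U' → Polynomial ℤ) ∘
        fun v => Sum.inr (Sum.inr v)) = fun _ => 0 := by
        ext; simp
      rw [this, aeval_zero', hc]
      simp
    · simp

end step

/-- the inductive statement -/
def KeyP (n : ℕ) : Prop :=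
  ∀ (I : Type) [Fintype I] [DecidableEq I] (D : I → ℕ), (∀ i, 1 ≤ D i) → (∀ i, D i ≤ n) →
    ∃ (U : Type) (_ : Fintype U) (h : I → MvPolynomial U ℤ),
      (∀ i, constantCoeff (h i) = 0) ∧ (∀ i, (h i).totalDegree ≤ D i) ∧
      (∀ i, ∃ w : U → Polynomial ℤ, aeval w (h i) = Polynomial.X) ∧
      ∀ (F : Type u) [Field F] (T : Type) [Fintype T] (r : I → MvPolynomial (T ⊕ U) F),
        (∀ i, DegLT (D i) (r i)) →
        (∀ i, aeval (Sum.elim (fun _ => 0) X) (r i) = (0 : MvPolynomial U F)) →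
        Concl F T U I h r

theorem key (n : ℕ) : KeyP.{u} n := by
  induction n with
  | zero =>
    intro I _ _ D h1 h2
    have : IsEmpty I := ⟨fun i => by have := h1 i; have := h2 i; omega⟩
    exact ⟨Empty, inferInstance, isEmptyElim, isEmptyElim, isEmptyElim, isEmptyElim,
      fun F _ T _ r _ _ => concl_empty F T Empty I _ r⟩
  | succ n ih =>
    intro I _ _ D h1 h2
    let J := {x : I × (I →₀ ℕ) // 2 ≤ x.2.degree ∧ x.2.degree < D x.1}
    have : Finite J := by
      have hf : Set.Finite {x : I × (I →₀ ℕ) | 2 ≤ x.2.degree ∧ x.2.degree < D x.1} := by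
        refine Set.Finite.subset
          (Set.finite_univ.prod (Finsupp.finite_of_degree_le (σ := I) (n + 1))) ?_
        intro x hx
        have := h2 x.1
        refine ⟨trivial, ?_⟩
        have h3 := hx.2
        change x.2.degree ≤ n + 1
        omega
      exact hf
    have := Fintype.ofFinite J
    classical
    let p : J → I := fun x => x.1.1
    let mu : J → I →₀ ℕ := fun x => x.1.2
    have hb : ∀ x : J, ∃ b, b ∈ (mu x).support := by
      intro x
      have : mu x ≠ 0 := by
        intro h0
        have := x.2.1
        change 2 ≤ (mu x).degree at this
        rw [h0] at this
        simp at this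
      exact Finsupp.support_nonempty_iff.mpr this
    choose b hb using hb
    have hp2 : ∀ x, 2 ≤ (mu x).degree := fun x => x.2.1
    have hp : ∀ x, (mu x).degree < D (p x) := fun x => x.2.2
    obtain ⟨U', _, h', hc, hd, -, H⟩ := ih J (fun x => D (p x) - (mu x).degree)
      (fun x => by have := hp x; omega)
      (fun x => by have := hp2 x; have := h2 (p x); omega)
    refine ⟨I ⊕ J ⊕ U', inferInstance, newh p mu b h', newh_const p mu b h' hc,
      newh_deg p mu b D h1 hp hb h' hd, newh_line p mu b hp2 h' hc, ?_⟩
    intro F _ T _ r hr hZ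
    refine step p mu b D h1 hp2 hp ?_ ?_ hb h' r hr hZ ?_
    · intro x y e1 e2
      exact Subtype.ext (Prod.ext e1 e2)
    · intro i μ e1 e2
      exact ⟨⟨(i, μ), e1, e2⟩, rfl, rfl⟩
    · exact H F (T ⊕ J) _ (fun x => newr_deg p mu b D r hr x (hp x))
        (fun x => newr_Z p mu b r hZ x)

end DC



open MvPolynomial

namespace DC

section deg
variable {F : Type*} [CommRing F] {T U : Type*} [Fintype U]

theorem DegLT.mono {k l : ℕ} (h : k ≤ l) {G : MvPolynomial (T ⊕ U) F}
    (hG : DegLT k G) : DegLT l G := fun m hm => (hG m hm).trans_le h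

theorem DegLT.zero {k : ℕ} : DegLT k (0 : MvPolynomial (T ⊕ U) F) := by
  intro m hm; simp at hm

theorem DegLT.neg {k : ℕ} {G : MvPolynomial (T ⊕ U) F}
    (hG : DegLT k G) : DegLT k (-G) := by
  intro m hm
  rw [coeff_neg, neg_ne_zero] at hm
  exact hG m hm

theorem DegLT.add {k : ℕ} {G H : MvPolynomial (T ⊕ U) F}
    (hG : DegLT k G) (hH : DegLT k H) : DegLT k (G + H) := by
  intro m hm
  rw [coeff_add] at hm
  by_cases h : coeff m G = 0
  · rw [h, zero_add] at hm
    exact hH m hm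
  · exact hG m h

theorem DegLT.mul {k l : ℕ} {G H : MvPolynomial (T ⊕ U) F}
    (hG : DegLT k G) (hH : DegLT (l + 1) H) : DegLT (k + l) (G * H) := by
  classical
  intro m hm
  rw [coeff_mul] at hm
  obtain ⟨⟨a, b⟩, hab, h1⟩ := Finset.exists_ne_zero_of_sum_ne_zero hm
  have ha := hG a (left_ne_zero_of_mul h1)
  have hb := hH b (right_ne_zero_of_mul h1)
  rw [Finset.HasAntidiagonal.mem_antidiagonal] at hab
  simp only at hab
  subst hab
  simp only [Finsupp.add_apply, Finset.sum_add_distrib]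
  omega

theorem DegLT.C (a : F) : DegLT 1 (C a : MvPolynomial (T ⊕ U) F) := by
  classical
  intro m hm
  rw [coeff_C] at hm
  split_ifs at hm with h
  · subst h; simp
  · simp at hm

theorem DegLT.one : DegLT 1 (1 : MvPolynomial (T ⊕ U) F) := by
  simpa using DegLT.C (T := T) (U := U) (1 : F)

theorem DegLT.Xl (t : T) : DegLT 1 (X (Sum.inl t) : MvPolynomial (T ⊕ U) F) := by
  classical
  intro m hm
  rw [coeff_X] at hm
  split_ifs at hm with h
  · subst h; simp
  · simp at hm

theorem DegLT.sum {ι : Type*} {k : ℕ} (s : Finset ι) {G : ι → MvPolynomial (T ⊕ U) F}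
    (hG : ∀ i ∈ s, DegLT k (G i)) : DegLT k (∑ i ∈ s, G i) := by
  classical
  induction s using Finset.induction_on with
  | empty => simpa using DegLT.zero
  | insert a s ha ih =>
    rw [Finset.sum_insert ha]
    exact (hG a (by simp)).add (ih fun i hi => hG i (by simp [hi]))

theorem DegLT.rename {e : MvPolynomial U F} {k : ℕ} (he : e.totalDegree ≤ k) :
    DegLT (k + 1) (MvPolynomial.rename Sum.inr e : MvPolynomial (T ⊕ U) F) := by
  intro m hm
  obtain ⟨d, rfl, hd⟩ := coeff_rename_ne_zero _ _ _ hm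
  have h1 := le_totalDegree (mem_support_iff.mpr hd)
  have h2 : ∑ u, (Finsupp.mapDomain Sum.inr d : T ⊕ U →₀ ℕ) (Sum.inr u) = ∑ u, d u := by
    refine Finset.sum_congr rfl fun u _ => ?_
    rw [Finsupp.mapDomain_apply Sum.inr_injective]
  rw [h2]
  have h3 : (d.sum fun _ e => e) = ∑ u, d u := Finsupp.sum_fintype _ _ (by simp)
  omega

theorem DegLT.taylor {ι : Type*} {f f' : ι → MvPolynomial (T ⊕ U) F}
    (hf : ∀ i, DegLT 2 (f i)) (hf' : ∀ i, DegLT 2 (f' i)) (hff : ∀ i, DegLT 1 (f i - f' i))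
    (g : MvPolynomial ι F) {n : ℕ} (hg : g.totalDegree ≤ n) :
    DegLT n (aeval f g - aeval f' g) := by
  classical
  have comb : ∀ {a b : ℕ} {p p' q q' : MvPolynomial (T ⊕ U) F},
      DegLT (a + 1) p ∧ DegLT (a + 1) p' ∧ DegLT a (p - p') →
      DegLT (b + 1) q ∧ DegLT (b + 1) q' ∧ DegLT b (q - q') →
      DegLT (a + b + 1) (p * q) ∧ DegLT (a + b + 1) (p' * q') ∧
        DegLT (a + b) (p * q - p' * q') := by
    rintro a b p p' q q' ⟨h1, h2, h3⟩ ⟨k1, k2, k3⟩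
    refine ⟨(h1.mul k1).mono (by omega), (h2.mul k2).mono (by omega), ?_⟩
    have e : p * q - p' * q' = (p - p') * q + (q - q') * p' := by ring
    rw [e]
    exact (h3.mul k1).add ((k3.mul h2).mono (by omega))
  have hm : ∀ m : ι →₀ ℕ, DegLT (m.degree + 1) (aeval f (monomial m (1 : F))) ∧
      DegLT (m.degree + 1) (aeval f' (monomial m (1 : F))) ∧
      DegLT m.degree (aeval f (monomial m (1 : F)) - aeval f' (monomial m (1 : F))) := by
    intro m
    induction m using Finsupp.induction_linear with
    | zero =>
      have : monomial (0 : ι →₀ ℕ) (1 : F) = 1 := rfl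
      simp only [this, map_one, sub_self, map_zero, zero_add]
      exact ⟨DegLT.one, DegLT.one, DegLT.zero⟩
    | add m₁ m₂ h1 h2 =>
      have : monomial (m₁ + m₂) (1 : F) = monomial m₁ 1 * monomial m₂ 1 := by
        rw [monomial_mul, one_mul]
      rw [this]
      simp only [map_mul, map_add]
      exact comb h1 h2
    | single i k =>
      have : monomial (Finsupp.single i k) (1 : F) = X i ^ k := by
        rw [X_pow_eq_monomial]
      rw [this]
      simp only [map_pow, aeval_X, Finsupp.degree_single]
      induction k with
      | zero =>
        simp only [pow_zero, sub_self, zero_add]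
        exact ⟨DegLT.one, DegLT.one, DegLT.zero⟩
      | succ k ih =>
        simp only [pow_succ]
        exact comb (ih (by rw [X_pow_eq_monomial])) ⟨hf i, hf' i, hff i⟩
  have e : ∀ f : ι → MvPolynomial (T ⊕ U) F, aeval f g =
      ∑ m ∈ g.support, MvPolynomial.C (coeff m g) * aeval f (monomial m (1 : F)) := by
    intro f
    conv_lhs => rw [g.as_sum]
    rw [map_sum]
    refine Finset.sum_congr rfl fun m _ => ?_
    rw [aeval_monomial, aeval_monomial]
    simp [algebraMap_eq]
  rw [e f, e f', ← Finset.sum_sub_distrib]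
  refine DegLT.sum _ fun m hms => ?_
  rw [← mul_sub, mul_comm]
  have h1 := ((hm m).2.2).mul (l := 0) (DegLT.C (T := T) (U := U) (coeff m g))
  have h2 := le_totalDegree hms
  have h3 : (m.sum fun _ e => e) = m.degree := rfl
  exact h1.mono (by omega)

end deg

theorem aevalZ {U B : Type*} [CommRing B] (s : U → B) (h : MvPolynomial U ℤ) :
    aeval s h = eval₂ (Int.castRingHom B) s h := rfl

theorem thmA {F : Type u} [Field F] [CharZero F] {U : Type} [Fintype U] {k n : ℕ} (hn : 1 ≤ n)
    (h : MvPolynomial U ℤ) (hc : constantCoeff h = 0)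
    (H : ∀ (T : Type) [Fintype T] (r : Unit → MvPolynomial (T ⊕ U) F),
        (∀ i, DegLT n (r i)) →
        (∀ i, aeval (Sum.elim (fun _ => 0) X) (r i) = (0 : MvPolynomial U F)) →
        Concl F T U Unit (fun _ => h) r)
    (g : MvPolynomial (Fin k) F) (hg : g.totalDegree ≤ n) (e : Fin k → MvPolynomial U F)
    (he : ∀ i, (e i).totalDegree ≤ 1) (heq : aeval e g = 1 + map (Int.castRingHom F) h) :
    ∃ (N : ℕ) (x : Fin k → FractionRing (MvPolynomial (Fin N) F))
      (W : FractionRing (MvPolynomial (Fin N) F)),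
      AlgebraicIndependent F x ∧ aeval x g = W ^ 2 := by
  let e' : Fin k → MvPolynomial ((Fin k ⊕ Unit) ⊕ U) F := fun i => rename Sum.inr (e i)
  let y : Fin k → MvPolynomial ((Fin k ⊕ Unit) ⊕ U) F := fun i => X (Sum.inl (Sum.inl i))
  let w : MvPolynomial ((Fin k ⊕ Unit) ⊕ U) F := X (Sum.inl (Sum.inr ()))
  let rr : MvPolynomial ((Fin k ⊕ Unit) ⊕ U) F :=
    aeval (fun i => y i + e' i) g - aeval e' g + (1 + -((1 + w) * (1 + w)))
  have he'g : ∀ {B : Type u} [CommRing B] [Algebra F B] (s : (Fin k ⊕ Unit) ⊕ U → B),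
      aeval s (aeval e' g) = 1 + aeval (fun u => s (Sum.inr u)) h := by
    intro B _ _ s
    have h1 : aeval e' g = rename Sum.inr (aeval e g) := by
      rw [← AlgHom.comp_apply, comp_aeval]
    rw [h1, heq, aeval_rename, map_add, map_one]
    congr 1
    rw [aeval_def, eval₂_map, aeval_def]
    congr 1
    exact RingHom.ext_int _ _
  have hrr : ∀ {B : Type u} [CommRing B] [Algebra F B] (s : (Fin k ⊕ Unit) ⊕ U → B),
      aeval s rr = aeval (fun i => s (Sum.inl (Sum.inl i)) + aeval (fun u => s (Sum.inr u)) (e i)) g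
        - aeval (fun u => s (Sum.inr u)) h - (1 + s (Sum.inl (Sum.inr ()))) ^ 2 := by
    intro B _ _ s
    have h1 : aeval s (aeval (fun i => y i + e' i) g) =
        aeval (fun i => s (Sum.inl (Sum.inl i)) + aeval (fun u => s (Sum.inr u)) (e i)) g := by
      rw [← AlgHom.comp_apply, comp_aeval]
      congr 1
      congr 1
      funext i
      simp only [y, e', map_add, aeval_X, aeval_rename]
      rfl
    simp only [rr, map_add, map_sub, map_neg, map_mul, map_one]
    rw [h1, he'g]
    simp only [w, aeval_X]
    ring
  obtain ⟨N, R, _, _, aug, j, hj, haug, τ, v, haτ, hav, heqn, hlift⟩ := H (Fin k ⊕ Unit)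
    (fun _ => rr) (by
      intro _
      refine DegLT.add ?_ ?_
      · refine DegLT.taylor ?_ ?_ ?_ g hg
        · intro i
          exact ((DegLT.Xl _).mono (by omega)).add (DegLT.rename (he i))
        · intro i
          exact DegLT.rename (he i)
        · intro i
          simp only [add_sub_cancel_right]
          exact DegLT.Xl _
      · have h1 : DegLT 1 (1 + w) := DegLT.one.add (DegLT.Xl _)
        exact (DegLT.one.add (h1.mul (l := 0) h1).neg).mono hn) (by
      intro _
      rw [hrr]
      simp only [Sum.elim_inl, Sum.elim_inr, zero_add, add_zero, one_pow]
      have h1 : ∀ q : MvPolynomial U F, aeval (fun u => X u) q = q := fun q => by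
        exact aeval_X_left_apply q
      simp only [h1]
      rw [heq]
      have h2 : eval₂ (Int.castRingHom (MvPolynomial U F)) X h = map (Int.castRingHom F) h := by
        rw [← eval₂_eta (map (Int.castRingHom F) h), eval₂_map]
        congr 1
      rw [aevalZ]
      rw [h2]
      ring)
  have heqn := heqn ()
  rw [hrr] at heqn
  simp only [Sum.elim_inl, Sum.elim_inr] at heqn
  have hx : AlgebraicIndependent F (fun i => τ (Sum.inl i) + aeval v (e i)) := by
    refine algInd _ (fun i => constantCoeff (e i)) ?_
    intro v0
    let Q : DualNumber F := aeval (fun i => ep (v0 i) + aeval (fun _ : U => (0 : DualNumber F)) (e i)) g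
    have hQ : Q.fst = 1 := by
      change TrivSqZeroExt.fstHom F F F Q = 1
      have h1 : TrivSqZeroExt.fstHom F F F Q = aeval (fun _ : U => (0 : F)) (aeval e g) := by
        simp only [Q]
        rw [← AlgHom.comp_apply, comp_aeval, ← AlgHom.comp_apply, comp_aeval]
        congr 1
        congr 1
        funext i
        rw [map_add, ← AlgHom.comp_apply, comp_aeval]
        simp [ep]
      rw [h1, heq, map_add, map_one]
      simp [aeval_zero', constantCoeff_map, hc]
    obtain ⟨Θ, h1, h2⟩ := hlift (Sum.elim v0 (fun _ => Q.snd / 2)) (by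
      intro _
      rw [hrr]
      simp only [Sum.elim_inl, Sum.elim_inr]
      change Q - _ - _ = 0
      have e0 : eval₂ (Int.castRingHom (DualNumber F)) (fun _ : U => (0 : DualNumber F)) h = 0 := by
        rw [← aevalZ, aeval_zero', hc, map_zero]
      rw [aevalZ, e0]
      ext
      · simp [ep, hQ]
      · simp [ep, pow_two])
    have key : ∀ i, tr F (Θ (τ (Sum.inl i) + aeval v (e i))) =
        ep (v0 i) + TrivSqZeroExt.inl (constantCoeff (e i)) := by
      intro i
      rw [map_add, map_add, h1, ← AlgHom.comp_apply, ← AlgHom.comp_apply, comp_aeval]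
      have : (fun i => ((tr F).comp Θ) (v i)) = fun _ => 0 := by
        funext i; exact h2 i
      rw [this, aeval_zero']
      rfl
    refine ⟨Θ, fun i => PowerSeries.mk fun p =>
      PowerSeries.coeff (p + 1) (Θ (τ (Sum.inl i) + aeval v (e i))), ?_, ?_⟩
    · intro i
      have h3 := PowerSeries.eq_X_mul_shift_add_const (Θ (τ (Sum.inl i) + aeval v (e i)))
      have h4 : PowerSeries.constantCoeff (Θ (τ (Sum.inl i) + aeval v (e i))) =
          constantCoeff (e i) := by
        rw [← tr_fst, key]; simp [ep]
      rw [h4] at h3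
      exact h3.trans (add_comm _ _)
    · intro i
      have h4 : PowerSeries.coeff 1 (Θ (τ (Sum.inl i) + aeval v (e i))) = v0 i := by
        rw [← tr_snd, key]; simp [ep]
      rw [← PowerSeries.coeff_zero_eq_constantCoeff_apply, PowerSeries.coeff_mk]
      exact h4
  refine ⟨N, fun i => j (τ (Sum.inl i) + aeval v (e i)), j (1 + τ (Sum.inr ())),
    hx.map' hj, ?_⟩
  rw [← map_pow]
  have h5 : aeval (fun i => τ (Sum.inl i) + aeval v (e i)) g = (1 + τ (Sum.inr ())) ^ 2 := by
    linear_combination heqn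
  rw [← h5, ← AlgHom.comp_apply, comp_aeval]

end DC



open MvPolynomial

namespace DC

theorem nonsq {F : Type u} [Field F] {U : Type} {k : ℕ}
    (h : MvPolynomial U ℤ) (w : U → Polynomial ℤ) (hw : aeval w h = Polynomial.X)
    (g : MvPolynomial (Fin k) F) (e : Fin k → MvPolynomial U F)
    (heq : aeval e g = 1 + map (Int.castRingHom F) h) :
    ¬ IsSquare (algebraMap (MvPolynomial (Fin k) F)
              (FractionRing (MvPolynomial (Fin k) F)) g) := by
  rintro ⟨s, hs⟩
  obtain ⟨q, rfl⟩ : ∃ q, algebraMap (MvPolynomial (Fin k) F)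
      (FractionRing (MvPolynomial (Fin k) F)) q = s := by
    refine IsIntegrallyClosed.exists_algebraMap_eq_of_isIntegral_pow (n := 2) (by norm_num) ?_
    rw [pow_two, ← hs]
    exact isIntegral_algebraMap
  rw [← map_mul] at hs
  have hq := IsFractionRing.injective (MvPolynomial (Fin k) F)
      (FractionRing (MvPolynomial (Fin k) F)) hs
  have h1 : (1 + Polynomial.X : Polynomial F) =
      aeval (fun u => (w u).map (Int.castRingHom F)) (aeval e g) := by
    rw [heq, map_add, map_one]
    congr 1
    have := congrArg (Polynomial.mapRingHom (Int.castRingHom F)) hw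
    rw [map_aeval] at this
    rw [aeval_def, eval₂_map]
    simp only [Polynomial.coe_mapRingHom, Polynomial.map_X] at this
    rw [← this, coe_eval₂Hom]
    congr 1
    exact RingHom.ext_int _ _
  rw [hq, map_mul, map_mul] at h1
  have h2 := congrArg Polynomial.natDegree h1
  rw [← pow_two, Polynomial.natDegree_pow] at h2
  have h3 : (1 + Polynomial.X : Polynomial F).natDegree = 1 := by
    rw [add_comm]
    exact Polynomial.natDegree_X_add_C 1
  omega

theorem embed {F : Type u} [Field F] {k N : ℕ} (g : MvPolynomial (Fin k) F)
    (hg : ¬ IsSquare (algebraMap (MvPolynomial (Fin k) F)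
              (FractionRing (MvPolynomial (Fin k) F)) g))
    (x : Fin k → FractionRing (MvPolynomial (Fin N) F))
    (W : FractionRing (MvPolynomial (Fin N) F))
    (hx : AlgebraicIndependent F x) (hW : aeval x g = W ^ 2) :
    ∃ φ : (Polynomial (FractionRing (MvPolynomial (Fin k) F)) ⧸
              Ideal.span {Polynomial.X ^ 2 - Polynomial.C
                (algebraMap (MvPolynomial (Fin k) F)
                  (FractionRing (MvPolynomial (Fin k) F)) g)}) →ₐ[F]
              FractionRing (MvPolynomial (Fin N) F), Function.Injective φ := by
  set c := algebraMap (MvPolynomial (Fin k) F) (FractionRing (MvPolynomial (Fin k) F)) g with hc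
  let ψ : FractionRing (MvPolynomial (Fin k) F) →ₐ[F] FractionRing (MvPolynomial (Fin N) F) :=
    IsFractionRing.liftAlgHom (g := aeval x) hx
  have hψ : ψ c = W ^ 2 := by
    rw [← hW]
    exact IsFractionRing.lift_algebraMap (g := (aeval x : _ →ₐ[F] _).toRingHom) hx g
  let χ : Polynomial (FractionRing (MvPolynomial (Fin k) F)) →ₐ[F]
      FractionRing (MvPolynomial (Fin N) F) :=
    { Polynomial.eval₂RingHom (ψ : _ →+* FractionRing (MvPolynomial (Fin N) F)) W with
      commutes' := fun a => by
        simp [Polynomial.algebraMap_apply] }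
  have hχe : ∀ q, χ q = Polynomial.eval₂ (ψ : _ →+* FractionRing (MvPolynomial (Fin N) F)) W q :=
    fun _ => rfl
  have hχ : χ (Polynomial.X ^ 2 - Polynomial.C c) = 0 := by
    rw [hχe]
    simp [hψ]
  have hirr : Irreducible (Polynomial.X ^ 2 - Polynomial.C c) := by
    rw [Polynomial.irreducible_iff_roots_eq_zero_of_degree_le_three]
    · by_contra hne
      obtain ⟨s, hs⟩ := Multiset.exists_mem_of_ne_zero hne
      have := Polynomial.isRoot_of_mem_roots hs
      simp only [Polynomial.IsRoot, Polynomial.eval_sub, Polynomial.eval_pow, Polynomial.eval_X,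
        Polynomial.eval_C] at this
      exact hg ⟨s, by rw [← pow_two]; linear_combination -this⟩
    · rw [Polynomial.natDegree_X_pow_sub_C]
    · rw [Polynomial.natDegree_X_pow_sub_C]; norm_num
  have hker : ∀ a ∈ Ideal.span {Polynomial.X ^ 2 - Polynomial.C c}, χ a = 0 := by
    intro a ha
    obtain ⟨b, rfl⟩ := Ideal.mem_span_singleton.mp ha
    rw [map_mul, hχ, zero_mul]
  refine ⟨Ideal.Quotient.liftₐ _ χ hker, ?_⟩
  rw [injective_iff_map_eq_zero]
  intro a ha
  obtain ⟨a, rfl⟩ := Ideal.Quotient.mk_surjective a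
  have ha : χ a = 0 := ha
  rw [Ideal.Quotient.eq_zero_iff_mem, Ideal.mem_span_singleton]
  by_contra hnd
  obtain ⟨p, q, hpq⟩ := (EuclideanDomain.dvd_or_coprime _ a hirr).resolve_left hnd
  have := congrArg χ hpq
  rw [map_add, map_mul, map_mul, hχ, ha, map_one] at this
  simp at this

end DC



open MvPolynomial

namespace DC

/-- homogenization -/
theorem homog {U : Type} (p : MvPolynomial U ℤ) (n : ℕ) (hp : p.totalDegree ≤ n) :
    ∃ H : MvPolynomial (Option U) ℤ, H.IsHomogeneous n ∧
      ∀ {A : Type u} [CommRing A],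
        aeval (fun a => Option.elim a 1 X : Option U → MvPolynomial U A)
          (map (Int.castRingHom A) H) = map (Int.castRingHom A) p := by
  classical
  refine ⟨∑ m ∈ p.support, rename some (monomial m (coeff m p)) * X none ^ (n - m.degree), ?_, ?_⟩
  · refine IsHomogeneous.sum _ _ _ fun m hm => ?_
    have h1 := le_totalDegree hm
    have h2 : (m.sum fun _ e => e) = m.degree := rfl
    have h3 := ((isHomogeneous_monomial (coeff m p) (rfl : m.degree = m.degree)).rename_isHomogeneous
      (f := (some : U → Option U))).mul ((isHomogeneous_X ℤ (none : Option U)).pow (n - m.degree))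
    have h4 : m.degree + 1 * (n - m.degree) = n := by omega
    rwa [h4] at h3
  · intro A _
    conv_rhs => rw [p.as_sum]
    rw [map_sum, map_sum, map_sum]
    refine Finset.sum_congr rfl fun m _ => ?_
    rw [map_mul, map_mul, map_pow, map_pow, map_X, aeval_X, map_rename, aeval_rename]
    simp only [Option.elim_none, one_pow, mul_one]
    exact aeval_X_left_apply _

section B
variable {U V : Type} [Fintype U] [Fintype V] (n : ℕ)
  (κ : Option U → V)

/-- monomials of degree `n` -/
abbrev Mo (V : Type) [Fintype V] (n : ℕ) := {ν : V →₀ ℕ // ∑ i, ν i = n}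

instance Mo.fin (V : Type) [Fintype V] (n : ℕ) : Finite (Mo V n) := by
  have : Set.Finite {ν : V →₀ ℕ | ∑ i, ν i = n} := by
    refine Set.Finite.subset (Finsupp.finite_of_degree_le (σ := V) n) ?_
    intro ν hν
    change ν.degree ≤ n
    rw [Finsupp.degree_eq_sum]
    exact le_of_eq hν
  exact this

noncomputable instance Mo.fint (V : Type) [Fintype V] (n : ℕ) : Fintype (Mo V n) :=
  Fintype.ofFinite _

/-- pushing forward a monomial -/
noncomputable def hat (μ : Mo (Option U) n) : Mo V n :=
  ⟨Finsupp.mapDomain κ μ.1, by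
    rw [← Finsupp.degree_eq_sum, Finsupp.degree_mapDomain, Finsupp.degree_eq_sum, μ.2]⟩

theorem thmB (K : Type u) [Field K] [CharZero K] (hκ : Function.Injective κ)
    (y : Mo (Option U) n → V) (hy : Function.Injective y) (hκy : ∀ a μ, κ a ≠ y μ) (hn : 1 ≤ n)
    (h : MvPolynomial U ℤ) (hh : h.totalDegree ≤ n) :
    ∃ G : MvPolynomial V (MvPolynomial (Mo V n) K), G.IsHomogeneous n ∧
      AlgebraicIndependent K (fun ν : Mo V n => coeff ν.1 G) ∧
      ∃ e : V → MvPolynomial U (MvPolynomial (Mo V n) K), (∀ i, (e i).totalDegree ≤ 1) ∧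
        e (κ none) = 1 ∧
        aeval e G = 1 + map (Int.castRingHom (MvPolynomial (Mo V n) K)) h := by
  classical
  set A := MvPolynomial (Mo V n) K with hA
  obtain ⟨H, hH, hHe⟩ := homog.{u} (1 + h) n ((totalDegree_add _ _).trans (by simpa using hh))
  have hb : ∀ μ : Mo (Option U) n, ∃ b, b ∈ μ.1.support := by
    intro μ
    refine Finsupp.support_nonempty_iff.mpr ?_
    intro h0
    have := μ.2
    rw [h0] at this
    simp at this
    omega
  choose b hb using hb
  have hbl : ∀ μ : Mo (Option U) n, Finsupp.single (b μ) 1 ≤ μ.1 := by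
    intro μ
    rw [Finsupp.single_le_iff]
    exact Nat.one_le_iff_ne_zero.mpr (Finsupp.mem_support_iff.mp (hb μ))
  have hbd : ∀ μ : Mo (Option U) n, 1 + (μ.1 - Finsupp.single (b μ) 1).degree = n := by
    intro μ
    have : (μ.1 - Finsupp.single (b μ) 1 + Finsupp.single (b μ) 1).degree = n := by
      rw [tsub_add_cancel_of_le (hbl μ), Finsupp.degree_eq_sum, μ.2]
    rw [map_add, Finsupp.degree_single] at this
    omega
  -- the fixed part
  let G0 : MvPolynomial V ℤ := rename κ H +
    ∑ μ : Mo (Option U) n, X (y μ) * rename κ (monomial (μ.1 - Finsupp.single (b μ) 1) 1)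
  have hG0 : G0.IsHomogeneous n := by
    refine hH.rename_isHomogeneous.add (IsHomogeneous.sum _ _ _ fun μ _ => ?_)
    have h3 := (isHomogeneous_X ℤ (y μ)).mul ((isHomogeneous_monomial (1 : ℤ)
      (rfl : (μ.1 - Finsupp.single (b μ) 1).degree = _)).rename_isHomogeneous (f := κ))
    rwa [hbd] at h3
  let z : Mo V n → A := X
  let l : V → MvPolynomial V A := fun k =>
    X k + Function.extend y (fun μ => C (z (hat n κ μ)) * X (κ (b μ))) 0 k
  have hl : ∀ k, (l k).IsHomogeneous 1 := by
    intro k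
    refine (isHomogeneous_X A k).add ?_
    by_cases hk : ∃ μ, y μ = k
    · obtain ⟨μ, rfl⟩ := hk
      rw [hy.extend_apply]
      have := (isHomogeneous_C V (z (hat n κ μ))).mul (isHomogeneous_X A (κ (b μ)))
      rwa [zero_add] at this
    · rw [Function.extend_apply' _ _ _ hk]
      exact isHomogeneous_zero _ _ _
  let G : MvPolynomial V A := map (Int.castRingHom A) G0 +
    ∑ ν : Mo V n, C (z ν) * aeval l (monomial ν.1 (1 : A))
  have hG : G.IsHomogeneous n := by
    refine (hG0.map _).add (IsHomogeneous.sum _ _ _ fun ν _ => ?_)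
    have h1 : (monomial ν.1 (1 : A)).IsHomogeneous n := isHomogeneous_monomial _ (by
      rw [Finsupp.degree_eq_sum, ν.2])
    have := (isHomogeneous_C V (z ν)).mul (h1.aeval l hl)
    rwa [zero_add, one_mul] at this
  refine ⟨G, hG, ?_, ?_⟩
  · refine algInd _ (fun ν => Int.castRingHom K (coeff ν.1 G0)) ?_
    intro v
    let Θ : A →ₐ[K] PowerSeries K := aeval (fun ν => PowerSeries.C (v ν) * PowerSeries.X)
    refine ⟨Θ, fun ν => ∑ ν' : Mo V n, PowerSeries.C (v ν') *
      Θ (coeff ν.1 (aeval l (monomial ν'.1 (1 : A)))), ?_, ?_⟩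
    · intro ν
      simp only [G]
      rw [coeff_add, map_add, coeff_sum, map_sum, coeff_map, Finset.mul_sum]
      congr 1
      · simp
      · refine Finset.sum_congr rfl fun ν' _ => ?_
        rw [coeff_C_mul, map_mul]
        have : Θ (z ν') = PowerSeries.C (v ν') * PowerSeries.X := aeval_X _ _
        rw [this]
        ring
    · intro ν
      let c : A →+* K := (PowerSeries.constantCoeff (R := K)).comp (Θ : A →+* PowerSeries K)
      have hcz : ∀ ν, c (z ν) = 0 := by
        intro ν
        have h0 : Θ (z ν) = PowerSeries.C (v ν) * PowerSeries.X := aeval_X _ _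
        change PowerSeries.constantCoeff (Θ (z ν)) = 0
        rw [h0]
        simp
      have hcl : ∀ k, map c (l k) = X k := by
        intro k
        simp only [l]
        rw [map_add, map_X]
        by_cases hk : ∃ μ, y μ = k
        · obtain ⟨μ, rfl⟩ := hk
          rw [hy.extend_apply, map_mul, map_C, hcz]
          simp
        · rw [Function.extend_apply' _ _ _ hk]
          simp
      have hcm : ∀ ν' : Mo V n, map c (aeval l (monomial ν'.1 (1 : A))) = monomial ν'.1 1 := by
        intro ν'
        rw [aeval_monomial, map_one, one_mul, Finsupp.prod, map_prod]
        simp only [map_pow, hcl]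
        rw [monomial_eq, C_1, one_mul, Finsupp.prod]
      rw [map_sum, Finset.sum_eq_single ν]
      · rw [map_mul, PowerSeries.constantCoeff_C]
        change v ν * c (coeff ν.1 (aeval l (monomial ν.1 (1 : A)))) = v ν
        rw [← coeff_map, hcm, coeff_monomial, if_pos rfl, mul_one]
      · intro ν' _ hne
        rw [map_mul, PowerSeries.constantCoeff_C]
        change v ν' * c (coeff ν.1 (aeval l (monomial ν'.1 (1 : A)))) = 0
        rw [← coeff_map, hcm, coeff_monomial, if_neg, mul_zero]
        intro h0
        exact hne (Subtype.ext h0)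
      · simp
  · let ut : Option U → MvPolynomial U A := fun a => Option.elim a 1 X
    have hut : ∀ a, (ut a).totalDegree ≤ 1 := by
      intro a
      rcases a with _ | a
      · simp [ut]
      · simp [ut]
    let e : V → MvPolynomial U A := Function.extend κ ut
      (Function.extend y (fun μ => -(C (z (hat n κ μ)) * ut (b μ))) 0)
    have heκ : ∀ a, e (κ a) = ut a := fun a => hκ.extend_apply _ _ a
    have hey : ∀ μ, e (y μ) = -(C (z (hat n κ μ)) * ut (b μ)) := by
      intro μ
      simp only [e]
      rw [Function.extend_apply', hy.extend_apply]
      rintro ⟨a, ha⟩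
      exact hκy _ _ ha
    refine ⟨e, ?_, ?_, ?_⟩
    · intro k
      by_cases hk : ∃ a, κ a = k
      · obtain ⟨a, rfl⟩ := hk
        rw [heκ]; exact hut a
      · by_cases hk' : ∃ μ, y μ = k
        · obtain ⟨μ, rfl⟩ := hk'
          rw [hey, totalDegree_neg]
          refine (totalDegree_mul _ _).trans ?_
          rw [totalDegree_C, zero_add]
          exact hut _
        · simp only [e]
          rw [Function.extend_apply' _ _ _ hk, Function.extend_apply' _ _ _ hk']
          simp
    · rw [heκ]; rfl
    · have hel : ∀ k, aeval e (l k) = Function.extend κ ut 0 k := by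
        intro k
        simp only [l]
        rw [map_add, aeval_X]
        by_cases hk : ∃ a, κ a = k
        · obtain ⟨a, rfl⟩ := hk
          rw [heκ, hκ.extend_apply, Function.extend_apply']
          · simp
          · rintro ⟨μ, hμ⟩; exact hκy _ _ hμ.symm
        · rw [Function.extend_apply' (f := κ) _ _ _ hk]
          by_cases hk' : ∃ μ, y μ = k
          · obtain ⟨μ, rfl⟩ := hk'
            rw [hey, hy.extend_apply, map_mul, aeval_X, heκ, aeval_C, algebraMap_eq]
            simp
          · simp only [e]
            rw [Function.extend_apply' _ _ _ hk, Function.extend_apply' _ _ _ hk',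
              Function.extend_apply' _ _ _ hk']
            simp
      have hren : ∀ q : MvPolynomial (Option U) A, aeval e (rename κ q) = aeval ut q := by
        intro q
        rw [aeval_rename]
        congr 1
        congr 1
        funext a
        exact heκ a
      have h1 : aeval e (map (Int.castRingHom A) (rename κ H)) =
          1 + map (Int.castRingHom A) h := by
        rw [map_rename, hren, hHe, map_add, map_one]
      have h2 : ∀ μ : Mo (Option U) n, aeval e (map (Int.castRingHom A) (X (y μ) *
          rename κ (monomial (μ.1 - Finsupp.single (b μ) 1) 1))) =
          - (C (z (hat n κ μ)) * aeval ut (monomial μ.1 (1 : A))) := by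
        intro μ
        rw [map_mul, map_mul, map_X, aeval_X, hey, map_rename, hren, map_monomial]
        have e1 : monomial μ.1 (1 : A) = monomial (μ.1 - Finsupp.single (b μ) 1) 1 * X (b μ) := by
          rw [X, monomial_mul, tsub_add_cancel_of_le (hbl μ), one_mul]
        rw [e1, map_mul, aeval_X, map_one]
        ring
      have h3 : aeval e (∑ ν : Mo V n, C (z ν) * aeval l (monomial ν.1 (1 : A))) =
          ∑ μ : Mo (Option U) n, C (z (hat n κ μ)) * aeval ut (monomial μ.1 (1 : A)) := by
        have h4 : ∀ ν : Mo V n, aeval e (aeval l (monomial ν.1 (1 : A))) =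
            aeval (Function.extend κ ut 0) (monomial ν.1 (1 : A)) := by
          intro ν
          rw [← AlgHom.comp_apply, comp_aeval]
          simp only [hel]
        rw [map_sum]
        symm
        refine Finset.sum_of_injOn (hat n κ) ?_ ?_ ?_ ?_
        · intro μ _ μ' _ hμ
          have := congrArg Subtype.val hμ
          exact Subtype.ext (Finsupp.mapDomain_injective hκ this)
        · intro μ _; simp
        · intro ν _ hν
          rw [map_mul, h4]
          have : ∃ k ∉ Set.range κ, ν.1 k ≠ 0 := by
            by_contra hcon
            push Not at hcon
            obtain ⟨μ, hμ⟩ := (Finsupp.mem_range_mapDomain_iff κ hκ ν.1).mpr hcon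
            apply hν
            refine ⟨⟨μ, ?_⟩, by simp, Subtype.ext hμ⟩
            rw [← Finsupp.degree_eq_sum, ← Finsupp.degree_mapDomain κ, hμ,
              Finsupp.degree_eq_sum, ν.2]
          obtain ⟨k, hk, hk0⟩ := this
          rw [aeval_monomial, Finsupp.prod,
            Finset.prod_eq_zero (Finsupp.mem_support_iff.mpr hk0), mul_zero, mul_zero]
          rw [Function.extend_apply' _ _ _ hk]
          simp [hk0]
        · intro μ _
          rw [map_mul, aeval_C, algebraMap_eq, h4]
          have e1 : monomial (hat n κ μ).1 (1 : A) = rename κ (monomial μ.1 (1 : A)) := by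
            rw [rename_monomial]; rfl
          rw [e1, aeval_rename]
          have e2 : (Function.extend κ ut 0) ∘ κ = ut := by
            funext a; exact hκ.extend_apply _ _ a
          rw [e2]
      simp only [G, G0]
      rw [map_add, h3, map_add, map_add, h1, map_sum, map_sum]
      simp only [h2]
      rw [Finset.sum_neg_distrib]
      ring

end B

end DC



open MvPolynomial

namespace DC

theorem fin_of_trdeg {K K1 Ks : Type u} [Field K] [Field K1] [Field Ks] [Algebra K K1]
    [Algebra K Ks] [Algebra K1 Ks] [IsScalarTower K K1 Ks] {ι : Type} [Finite ι]
    [Algebra (MvPolynomial ι K) Ks] [IsFractionRing (MvPolynomial ι K) Ks]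
    [IsScalarTower K (MvPolynomial ι K) Ks]
    (b : ι → K1) (hb : AlgebraicIndependent K b) : FiniteDimensional K1 Ks := by
  have h1 : Algebra.EssFiniteType (MvPolynomial ι K) Ks :=
    Algebra.EssFiniteType.of_isLocalization _ (nonZeroDivisors (MvPolynomial ι K))
  have h2 : Algebra.EssFiniteType K Ks := Algebra.EssFiniteType.comp K (MvPolynomial ι K) Ks
  have h3 : Algebra.EssFiniteType K1 Ks := Algebra.EssFiniteType.of_comp K K1 Ks
  have h4 : Algebra.trdeg K Ks = Cardinal.lift.{u} (Cardinal.mk ι) := by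
    have := _root_.trdeg_add_eq K (MvPolynomial ι K) (A := Ks)
    have h5 : Algebra.IsAlgebraic (MvPolynomial ι K) Ks :=
      IsLocalization.isAlgebraic _ (nonZeroDivisors (MvPolynomial ι K))
    rw [trdeg_eq_zero_iff.2 h5, add_zero, MvPolynomial.trdeg_of_isDomain] at this
    rw [← this]
  have h6 : Cardinal.lift.{u} (Cardinal.mk ι) ≤ Algebra.trdeg K K1 := by
    simpa using hb.lift_cardinalMk_le_trdeg
  have h7 := _root_.trdeg_add_eq K K1 (A := Ks)
  have h8 : Algebra.trdeg K1 Ks = 0 := by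
    rw [h4] at h7
    have hlt : Algebra.trdeg K K1 < Cardinal.aleph0 := by
      refine lt_of_le_of_lt (le_trans (self_le_add_right _ _) h7.le) (by simp)
    have hlt2 : Algebra.trdeg K1 Ks < Cardinal.aleph0 := by
      refine lt_of_le_of_lt (le_trans (self_le_add_left _ _) h7.le) (by simp)
    rw [← h7] at h6
    obtain ⟨a, ha⟩ := Cardinal.lt_aleph0.1 hlt
    obtain ⟨c, hc⟩ := Cardinal.lt_aleph0.1 hlt2
    rw [ha, hc] at h6
    rw [hc]
    norm_cast at h6 ⊢
    omega
  have h9 : Algebra.IsAlgebraic K1 Ks := trdeg_eq_zero_iff.1 h8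
  exact Algebra.finite_of_essFiniteType_of_isAlgebraic

theorem exists_hom {K K1 Ks : Type u} [Field K] [Field K1] [Field Ks] [Algebra K K1]
    [Algebra K Ks] {ι : Type} (b : ι → K1) (hb : AlgebraicIndependent K b)
    (ht : IntermediateField.adjoin K (Set.range b) = ⊤) (c : ι → Ks)
    (hc : AlgebraicIndependent K c) : ∃ f : K1 →ₐ[K] Ks, ∀ i, f (b i) = c i := by
  let i0 := IsFractionRing.liftAlgHom (K := FractionRing (MvPolynomial ι K))
    (algebraicIndependent_iff_injective_aeval.1 hc)
  let i1 : K1 →ₐ[K] IntermediateField.adjoin K (Set.range b) :=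
    ((IntermediateField.equivOfEq ht).trans IntermediateField.topEquiv).symm.toAlgHom
  have hi1 : ∀ x, ((i1 x : IntermediateField.adjoin K (Set.range b)) : K1) = x := fun x => rfl
  refine ⟨i0.comp (hb.reprField.comp i1), fun i => ?_⟩
  have : hb.reprField (i1 (b i)) = algebraMap (MvPolynomial ι K) _ (X i) := by
    have : i1 (b i) = hb.aevalEquivField (algebraMap (MvPolynomial ι K) _ (X i)) := by
      apply Subtype.ext
      rw [hb.aevalEquivField_algebraMap_apply_coe, hi1, aeval_X]
    rw [this]
    exact hb.aevalEquivField.symm_apply_apply _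
  simp only [AlgHom.comp_apply, this, i0]
  simp

theorem adjoin_top {K K1 : Type u} [Field K] [Field K1] [Algebra K K1] {r n : ℕ}
    (g : MvPolynomial (Fin (r + 1)) K1) (hg : g.IsHomogeneous n)
    (ht : IntermediateField.adjoin K (Set.range fun m => coeff m g) = ⊤) :
    IntermediateField.adjoin K
      (Set.range (fun μ : Mo (Fin (r + 1)) n => g.coeff μ.1)) = ⊤ := by
  rw [eq_top_iff, ← ht, IntermediateField.adjoin_le_iff]
  rintro _ ⟨m, rfl⟩
  by_cases h : ∑ i, m i = n
  · exact IntermediateField.subset_adjoin _ _ ⟨⟨m, h⟩, rfl⟩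
  · have : coeff m g = 0 := hg.coeff_eq_zero (by rwa [Finsupp.degree_eq_sum])
    simp only [this]
    exact zero_mem _

theorem dehom_totalDegree {F : Type u} [Field F] {r n : ℕ} (g : MvPolynomial (Fin (r + 1)) F)
    (hg : g.IsHomogeneous n) (v : Fin (r + 1) → MvPolynomial (Fin r) F)
    (hv : ∀ i, (v i).totalDegree ≤ 1) : (aeval v g).totalDegree ≤ n := by
  rw [aeval_def, eval₂_eq]
  refine totalDegree_finsetSum_le fun m hm => ?_
  refine (totalDegree_mul _ _).trans ?_
  have h1 : ((algebraMap F (MvPolynomial (Fin r) F)) (coeff m g)).totalDegree = 0 := by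
    simp [algebraMap_eq]
  rw [h1, zero_add]
  refine (totalDegree_finsetProd _ _).trans ?_
  have h2 : m.degree = n := by
    by_contra h
    exact (mem_support_iff.1 hm) (hg.coeff_eq_zero h)
  rw [← h2, Finsupp.degree]
  refine Finset.sum_le_sum fun i _ => (totalDegree_pow _ _).trans ?_
  calc m i * (v i).totalDegree ≤ m i * 1 := Nat.mul_le_mul_left _ (hv i)
    _ = m i := mul_one _

end DC

open DC

/-- **Main theorem: unirationality of double covers of `ℙ^r` of fixed degree and large
dimension.** Let `K` be a field of characteristic zero and `d > 2`. There exists a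
constant `ρ(d)` such that for every `r ≥ ρ(d)` the following holds: if `g` is a
homogeneous polynomial of degree `2d` in `X_0, …, X_r` whose coefficients lie in an
extension field `K1` of `K`, are algebraically independent over `K`, and generate `K1`
over `K` (so `K1 = K(θ(B))` with `B = {g = 0}` a generic hypersurface of degree `2d`),
then there is a finite field extension `K^#` of `K1` such that
`ĝ := g(1, x_1, …, x_r)` is not a square in `K^#(x_1, …, x_r)` and the quadratic
extension `K^#(x_1, …, x_r)[w]/(w² - ĝ)` — the function field of the double cover `W` of
`ℙ^r` branched over `B` — admits a `K^#`-algebra embedding into a rational function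
field `K^#(t_1, …, t_N)`; that is, `W` is unirational over the finite extension `K^#` of
`K(θ(B))`. -/
theorem stmt_3 (K : Type u) [Field K] [CharZero K] (d : ℕ) (hd : 2 < d) :
    ∃ ρ : ℕ, ∀ r : ℕ, ρ ≤ r →
      ∀ (K1 : Type u) [Field K1] [Algebra K K1],
        ∀ g : MvPolynomial (Fin (r + 1)) K1,
        g.IsHomogeneous (2 * d) →
        AlgebraicIndependent K
          (fun μ : {μ : Fin (r + 1) →₀ ℕ // (∑ i, μ i) = 2 * d} => g.coeff μ.1) →
        IntermediateField.adjoin K (Set.range g.coeff) = ⊤ →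
        ∃ (Ks : Type u) (_ : Field Ks) (_ : Algebra K1 Ks),
          FiniteDimensional K1 Ks ∧
          ¬ IsSquare (algebraMap (MvPolynomial (Fin r) Ks)
              (FractionRing (MvPolynomial (Fin r) Ks))
              (MvPolynomial.aeval (fun i : Fin (r + 1) =>
                Fin.cases (motive := fun _ => MvPolynomial (Fin r) Ks) 1
                  (fun i' => MvPolynomial.X i') i)
                (MvPolynomial.map (algebraMap K1 Ks) g))) ∧
          ∃ (N : ℕ)
            (φ : (Polynomial (FractionRing (MvPolynomial (Fin r) Ks)) ⧸
              Ideal.span {Polynomial.X ^ 2 - Polynomial.C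
                (algebraMap (MvPolynomial (Fin r) Ks)
                  (FractionRing (MvPolynomial (Fin r) Ks))
                  (MvPolynomial.aeval (fun i : Fin (r + 1) =>
                    Fin.cases (motive := fun _ => MvPolynomial (Fin r) Ks) 1
                      (fun i' => MvPolynomial.X i') i)
                    (MvPolynomial.map (algebraMap K1 Ks) g)))}) →ₐ[Ks]
              FractionRing (MvPolynomial (Fin N) Ks)),
            Function.Injective φ := by
  obtain ⟨U, _, h, hc, hdeg, hw, H⟩ := key.{u} (2 * d) Unit (fun _ => 2 * d)
    (fun _ => by omega) (fun _ => le_rfl)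
  refine ⟨Fintype.card (U ⊕ Mo (Option U) (2 * d)), fun r hr K1 _ _ g hg hb ht => ?_⟩
  obtain ⟨ε⟩ : Nonempty ((U ⊕ Mo (Option U) (2 * d)) ↪ Fin r) :=
    Function.Embedding.nonempty_of_card_le (by simpa using hr)
  obtain ⟨G, hG, hΦ, e, he, he0, heG⟩ := thmB (U := U) (V := Fin (r + 1)) (2 * d)
    (fun o => o.elim 0 (fun u => (ε (Sum.inl u)).succ)) K
    (by
      rintro (_ | a) (_ | b) hab
      · rfl
      · exact absurd hab.symm (Fin.succ_ne_zero _)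
      · exact absurd hab (Fin.succ_ne_zero _)
      · have := ε.injective (Fin.succ_injective _ hab)
        simpa using this)
    (fun μ => (ε (Sum.inr μ)).succ)
    (by
      intro a b hab
      have := ε.injective (Fin.succ_injective _ hab)
      simpa using this)
    (by
      rintro (_ | a) μ hab
      · exact absurd hab.symm (Fin.succ_ne_zero _)
      · have := ε.injective (Fin.succ_injective _ hab)
        simp at this)
    (by omega) (h ()) (hdeg ())
  let A := MvPolynomial (Mo (Fin (r + 1)) (2 * d)) K
  let Ks := FractionRing A
  let α : A →+* Ks := algebraMap A Ks
  have hΦ' : AlgebraicIndependent K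
      (fun ν : Mo (Fin (r + 1)) (2 * d) => α (coeff ν.1 G)) :=
    hΦ.map' (f := IsScalarTower.toAlgHom K A Ks) (IsFractionRing.injective A Ks)
  obtain ⟨f, hf⟩ := exists_hom _ hb (adjoin_top g hg ht) _ hΦ'
  letI : Algebra K1 Ks := f.toRingHom.toAlgebra
  haveI : IsScalarTower K K1 Ks := IsScalarTower.of_algebraMap_eq fun x => (f.commutes x).symm
  haveI : CharZero Ks := charZero_of_injective_algebraMap (algebraMap K Ks).injective
  have hmap : MvPolynomial.map (algebraMap K1 Ks) g = MvPolynomial.map α G := by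
    ext m
    rw [coeff_map, coeff_map]
    by_cases hm : ∑ i, m i = 2 * d
    · exact hf ⟨m, hm⟩
    · rw [hg.coeff_eq_zero (by rwa [Finsupp.degree_eq_sum]),
        hG.coeff_eq_zero (by rwa [Finsupp.degree_eq_sum]), map_zero, map_zero]
  have hfd : FiniteDimensional K1 Ks := fin_of_trdeg _ hb
  refine ⟨Ks, inferInstance, inferInstance, hfd, ?_⟩
  rw [hmap]
  set ĝ := MvPolynomial.aeval (fun i : Fin (r + 1) =>
                Fin.cases (motive := fun _ => MvPolynomial (Fin r) Ks) 1
                  (fun i' => MvPolynomial.X i') i) (MvPolynomial.map α G) with hĝ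
  have hdegĝ : ĝ.totalDegree ≤ 2 * d := by
    refine dehom_totalDegree _ (hG.map α) _ fun i => ?_
    refine Fin.cases ?_ (fun j => ?_) i
    · simp
    · simp
  let E : Fin r → MvPolynomial U Ks := fun i => MvPolynomial.map α (e i.succ)
  have hE : ∀ i, (E i).totalDegree ≤ 1 := fun i => 
    (Finset.sup_mono (support_map_subset _ _)).trans (he _)
  have heq : aeval E ĝ = 1 + MvPolynomial.map (Int.castRingHom Ks) (h ()) := by
    have h1 : MvPolynomial.map α (aeval e G) =
        1 + MvPolynomial.map (Int.castRingHom Ks) (h ()) := by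
      rw [heG, map_add, map_one, MvPolynomial.map_map]
      congr 3
      exact Subsingleton.elim _ _
    rw [← h1, hĝ]
    have h2 : ((aeval E).toRingHom.comp ((aeval (fun i : Fin (r + 1) =>
                Fin.cases (motive := fun _ => MvPolynomial (Fin r) Ks) 1
                  (fun i' => MvPolynomial.X i') i)).toRingHom.comp (MvPolynomial.map α)) :
          MvPolynomial (Fin (r + 1)) A →+* MvPolynomial U Ks) =
        (MvPolynomial.map α).comp (aeval e).toRingHom := by
      apply MvPolynomial.ringHom_ext
      · intro a
        simp [algebraMap_eq]
      · intro i
        refine Fin.cases ?_ (fun j => ?_) i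
        · have : e 0 = 1 := he0
          simp [this]
        · simp [E]
    exact congrArg (fun z : MvPolynomial (Fin (r + 1)) A →+* MvPolynomial U Ks => z G) h2
  obtain ⟨w, hw⟩ := hw ()
  have hns := nonsq (h ()) w hw ĝ E heq
  refine ⟨hns, ?_⟩
  obtain ⟨N, x, W, hx, hW⟩ := thmA (n := 2 * d) (by omega) (h ()) (hc ())
    (fun T _ r h1 h2 => H Ks T r h1 h2) ĝ hdegĝ E hE heq
  exact ⟨N, embed ĝ hns x W hx hW⟩
end

section
/- Let K be a field of characteristic zero, let d ≥ 3 and q ≥ 1 be integers, and let r be an integer with 0 < q < r and (r−q)(q+1) ≥ C(2d+q, q). Let g be a homogeneous polynomial of degree 2d in X_0,…,X_r whose C(r+2d,2d) coefficients are algebraically independent over K; let K_1 be the field generated over K by these coefficients and let Ω be an algebraically closed field containing K_1. Then there exists an Ω-linear subspace W ⊆ Ω^{r+1} of dimension q+1 on which g vanishes identically, such that: (i) W has a basis whose coordinates lie in a finite field extension K^# of K_1; and (ii) denoting by K(l(L_0)) the subfield of Ω generated over K by the ratios of the Plücker coordinates of W, the transcendence degree over K(l(L_0)) of the field generated by K(l(L_0))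 and the coefficients of g equals C(r+2d,2d) − C(q+2d,2d); that is, the hypersurface B = {g = 0} is generic over K subject to containing the linear space L_0 = P(W). -/
universe u

/-- `FieldTrdegEq F Ω s n` says that the subfield `F(s)` of `Ω` generated over `F` by
the set `s` has transcendence degree `n` over `F`: there is a transcendence basis of
`F(s)/F` consisting of `n` elements, i.e. `n` elements of `F(s)`, algebraically
independent over `F`, over (the field generated by) which every element of `s` is
algebraic. -/
def FieldTrdegEq (F Ω : Type*) [Field F] [Field Ω] [Algebra F Ω] (s : Set Ω) (n : ℕ) :
    Prop :=
  ∃ v : Fin n → Ω, AlgebraicIndependent F v ∧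
    (∀ i, v i ∈ IntermediateField.adjoin F s) ∧
    ∀ x ∈ s, IsAlgebraic (↥(IntermediateField.adjoin F (Set.range v))) x


open MvPolynomial

/-- Exponents of degree `e` in the variables `σ`. -/
abbrev Deg (σ : Type*) (e : ℕ) := {μ : σ →₀ ℕ // μ.degree = e}

noncomputable instance Deg.instFintype (σ : Type*) [Fintype σ] (e : ℕ) : Fintype (Deg σ e) := by
  classical
  exact Fintype.ofEquiv (Sym σ e) ((Sym.equivNatSum σ e).trans (Equiv.subtypeEquivRight (by
    intro x; rw [Finsupp.degree_apply]; rfl)))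

lemma Deg.card_eq (σ : Type*) [Fintype σ] (e : ℕ) :
    Fintype.card (Deg σ e) = (Fintype.card σ + e - 1).choose e := by
  classical
  rw [← Sym.card_sym_eq_choose (α := σ)]
  exact Fintype.card_congr ((Sym.equivNatSum σ e).trans (Equiv.subtypeEquivRight (by
    intro x; rw [Finsupp.degree_apply]; rfl))).symm

/-- A family algebraically independent over `K` and contained in the field generated by `κ`
elements has at most `κ` members. -/
lemma card_le_of_mem_adjoin {K Ω : Type*} [Field K] [Field Ω] [Algebra K Ω]
    {ι κ : Type*} [Fintype ι] [Fintype κ] {x : ι → Ω} (hx : AlgebraicIndependent K x)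
    (w : κ → Ω) (h : ∀ i, x i ∈ IntermediateField.adjoin K (Set.range w)) :
    Fintype.card ι ≤ Fintype.card κ := by
  classical
  let M := AlgebraicIndependent.matroid K Ω
  have h1 : M.Indep (Set.range x) := AlgebraicIndependent.coe_range hx
  have h2 : Set.range x ⊆ M.closure (Set.range w) := by
    rw [AlgebraicIndependent.matroid_closure_eq]
    rintro _ ⟨i, rfl⟩
    show IsAlgebraic (Algebra.adjoin K (Set.range w)) (x i)
    rw [← IntermediateField.isAlgebraic_adjoin_iff]
    exact isAlgebraic_algebraMap (⟨x i, h i⟩ : IntermediateField.adjoin K (Set.range w))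
  have h3 : (Set.range x).encard ≤ (Set.range w).encard := by
    rw [← h1.eRk_eq_encard]
    exact ((M.eRk_mono h2).trans (M.eRk_closure_eq _).le).trans (M.eRk_le_encard _)
  have h4 : (Set.range x).encard = Fintype.card ι := by
    rw [← Set.image_univ, hx.injective.encard_image]; simp
  have h5 : (Set.range w).encard ≤ Fintype.card κ := by
    rw [← Set.image_univ]; exact (Set.encard_image_le _ _).trans (by simp)
  rw [h4] at h3
  exact_mod_cast h3.trans h5

/-- A matrix with linearly independent rows has an invertible maximal minor. -/
lemma exists_submatrix_det_ne_zero {F : Type*} [Field F] {ι κ : Type*} [Fintype ι] [DecidableEq ι]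
    [Fintype κ] (A : Matrix ι κ F) (hA : LinearIndependent F A.row) :
    ∃ f : ι → κ, Function.Injective f ∧ (A.submatrix id f).det ≠ 0 := by
  classical
  obtain ⟨τ, a, ha, hsp, hli⟩ := exists_linearIndependent' F A.col
  have : Fintype τ := Fintype.ofInjective a ha
  have h1 : A.rank = Fintype.card ι := by
    rw [Matrix.rank_eq_finrank_span_row, finrank_span_eq_card hA]
  have h2 : Fintype.card τ = Fintype.card ι := by
    rw [← h1, Matrix.rank_eq_finrank_span_cols, ← hsp, finrank_span_eq_card hli]
  let ε : ι ≃ τ := (Fintype.equivOfCardEq h2).symm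
  refine ⟨a ∘ ε, ha.comp ε.injective, ?_⟩
  have h3 : LinearIndependent F (A.submatrix id (a ∘ ε)).col := hli.comp ε ε.injective
  rw [Matrix.linearIndependent_cols_iff_isUnit, Matrix.isUnit_iff_isUnit_det] at h3
  exact h3.ne_zero

/-- Lowest-degree criterion for algebraic independence. -/
lemma algebraicIndependent_of_linear_part {A ι : Type*} [CommRing A] [IsDomain A] [Fintype ι]
    [DecidableEq ι] (P : ι → MvPolynomial ι A) (M : Matrix ι ι A) (hM : M.det ≠ 0)
    (hP : ∀ i, P i - ∑ j, C (M i j) * X j ∈ idealOfVars ι A ^ 2) :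
    AlgebraicIndependent A P := by
  classical
  set I := idealOfVars ι A with hI
  set l : ι → MvPolynomial ι A := fun i => ∑ j, C (M i j) * X j with hl
  have hlI : ∀ i, l i ∈ I := fun i => Ideal.sum_mem _ fun j _ =>
    Ideal.mul_mem_left _ _ (Ideal.subset_span ⟨j, rfl⟩)
  have hPI : ∀ i, P i ∈ I := fun i => by
    have := Ideal.add_mem _ (Ideal.pow_le_self two_ne_zero (hP i)) (hlI i)
    simpa [hl] using this
  -- monomials
  have key : ∀ β : ι →₀ ℕ, (β.prod fun i k => P i ^ k) ∈ I ^ β.degree ∧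
      (β.prod fun i k => P i ^ k) - (β.prod fun i k => l i ^ k) ∈ I ^ (β.degree + 1) := by
    intro β
    induction β using Finsupp.induction_linear with
    | zero => simp
    | add f g hf hg =>
      rw [Finsupp.prod_add_index' (by simp) (by intros; rw [pow_add]),
        Finsupp.prod_add_index' (by simp) (by intros; rw [pow_add]), map_add]
      refine ⟨by rw [pow_add]; exact Ideal.mul_mem_mul hf.1 hg.1, ?_⟩
      set a := f.prod fun i k => P i ^ k
      set b := g.prod fun i k => P i ^ k
      set a' := f.prod fun i k => l i ^ k
      set b' := g.prod fun i k => l i ^ k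
      have hb' : b' ∈ I ^ g.degree := by
        have := Ideal.sub_mem _ hg.1 (Ideal.pow_le_pow_right (Nat.le_succ _) hg.2)
        simpa using this
      have e : a * b - a' * b' = a * (b - b') + (a - a') * b' := by ring
      rw [e]
      refine Ideal.add_mem _ ?_ ?_
      · rw [add_assoc, pow_add]; exact Ideal.mul_mem_mul hf.1 hg.2
      · rw [add_right_comm, pow_add]; exact Ideal.mul_mem_mul hf.2 hb'
    | single i k =>
      rw [Finsupp.prod_single_index (by simp), Finsupp.prod_single_index (by simp),
        Finsupp.degree_single]
      refine ⟨Ideal.pow_mem_pow (hPI i) k, ?_⟩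
      induction k with
      | zero => simp
      | succ k ih =>
        have e : P i ^ (k+1) - l i ^ (k+1) = P i ^ k * (P i - l i) + (P i ^ k - l i ^ k) * l i := by
          ring
        rw [e]
        refine Ideal.add_mem _ ?_ ?_
        · rw [add_assoc, pow_add]; exact Ideal.mul_mem_mul (Ideal.pow_mem_pow (hPI i) k) (hP i)
        · rw [pow_succ]; exact Ideal.mul_mem_mul ih (hlI i)
  -- injectivity of the linear substitution
  have hlinj : ∀ Q : MvPolynomial ι A, aeval l Q = 0 → Q = 0 := by
    intro Q hQ
    let F := FractionRing A
    have hinj : Function.Injective (MvPolynomial.map (σ := ι) (algebraMap A F)) :=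
      MvPolynomial.map_injective _ (IsFractionRing.injective A F)
    apply hinj
    rw [map_zero]
    let N : Matrix ι ι F := M.map (algebraMap A F)
    have hN : N.det ≠ 0 := by
      have : N.det = algebraMap A F M.det := by
        rw [RingHom.map_det]; rfl
      rw [this]
      exact (map_ne_zero_iff _ (IsFractionRing.injective A F)).2 hM
    have h1 : aeval (fun i => ∑ j, C (N i j) * X j) (MvPolynomial.map (algebraMap A F) Q)
        = (0 : MvPolynomial ι F) := by
      have := congrArg (MvPolynomial.map (algebraMap A F)) hQ
      rw [map_zero] at this
      rw [← this]
      refine Eq.trans ?_ (map_bind₁ (algebraMap A F) l Q).symm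
      show bind₁ _ _ = _
      congr 2
      ext i : 1
      simp [hl, N]
    have h2 := congrArg (aeval (fun i => ∑ j, C (N⁻¹ i j) * X j : ι → MvPolynomial ι F)) h1
    rw [map_zero, ← AlgHom.comp_apply, comp_aeval] at h2
    rw [← h2]
    have : (fun i => (aeval (fun i => ∑ j, C (N⁻¹ i j) * X j : ι → MvPolynomial ι F))
        (∑ j, C (N i j) * X j)) = X := by
      ext1 i
      simp only [map_sum, map_mul, aeval_X, MvPolynomial.algHom_C, algebraMap_eq]
      simp only [Finset.mul_sum, ← mul_assoc, ← C_mul]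
      rw [Finset.sum_comm]
      simp only [← Finset.sum_mul, ← map_sum]
      have : ∀ y, ∑ x, N i x * N⁻¹ x y = (1 : Matrix ι ι F) i y := by
        intro y
        rw [← Matrix.mul_nonsing_inv N (isUnit_iff_ne_zero.2 hN), Matrix.mul_apply]
      simp [this, Matrix.one_apply]
    rw [this, aeval_X_left, AlgHom.id_apply]
  -- main argument
  rw [algebraicIndependent_iff]
  intro Q hQ
  by_contra hne
  have hex : ∃ k, ∃ β ∈ Q.support, β.degree = k := by
    obtain ⟨β, hβ⟩ := support_nonempty.2 hne
    exact ⟨_, β, hβ, rfl⟩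
  set k := Nat.find hex
  obtain ⟨β, hβ, hβk⟩ := Nat.find_spec hex
  have hmin : ∀ γ ∈ Q.support, k ≤ γ.degree := fun γ hγ => Nat.find_min' hex ⟨γ, hγ, rfl⟩
  set Qk := homogeneousComponent k Q
  have hQk : Qk ≠ 0 := by
    intro h
    have := congrArg (coeff β) h
    rw [coeff_homogeneousComponent, if_pos hβk, coeff_zero] at this
    exact (mem_support_iff.1 hβ) this
  apply hQk
  apply hlinj
  have hmem : aeval l Qk ∈ I ^ (k+1) := by
    have h0 : aeval P Q - aeval l Qk ∈ I ^ (k+1) := by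
      have e1 : aeval P Q = ∑ γ ∈ Q.support, C (coeff γ Q) * γ.prod fun i n => P i ^ n := by
        conv_lhs => rw [Q.as_sum]
        rw [map_sum]
        simp only [aeval_monomial, algebraMap_eq]
      have e2 : aeval l Qk = ∑ γ ∈ Q.support,
          if γ.degree = k then C (coeff γ Q) * γ.prod fun i n => l i ^ n else 0 := by
        simp only [Qk]
        rw [homogeneousComponent_apply, map_sum, Finset.sum_filter]
        simp only [aeval_monomial, algebraMap_eq]
      rw [e1, e2, ← Finset.sum_sub_distrib]
      refine Ideal.sum_mem _ fun γ hγ => ?_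
      split_ifs with h
      · rw [← mul_sub, ← h]
        exact Ideal.mul_mem_left _ _ (key γ).2
      · rw [sub_zero]
        refine Ideal.mul_mem_left _ _ (Ideal.pow_le_pow_right ?_ (key γ).1)
        have := hmin γ hγ
        omega
    rw [hQ, zero_sub] at h0
    simpa using h0
  have hhom : (aeval l Qk).IsHomogeneous k := by
    have := (homogeneousComponent_isHomogeneous k Q).aeval l (n := 1) (fun i =>
      IsHomogeneous.sum _ _ _ fun j _ => isHomogeneous_C_mul_X _ _)
    simpa using this
  rw [mem_pow_idealOfVars_iff'] at hmem
  ext γ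
  rw [coeff_zero]
  by_cases h : γ.degree < k + 1
  · exact hmem γ h
  · by_contra hc
    have := hhom hc
    have h' : γ.degree = k := by rw [← this, Finsupp.degree_eq_weight_one]; rfl
    omega

/-- Solving a generically finite polynomial system at a generic point. -/
lemma exists_generic_solution {A Ω ι : Type*} [CommRing A] [IsDomain A] [Field Ω] [IsAlgClosed Ω]
    [Algebra A Ω] [Fintype ι] (P : ι → MvPolynomial ι A) (hP : AlgebraicIndependent A P)
    (y : ι → Ω) (hy : AlgebraicIndependent A y) :
    ∃ a : ι → Ω, (∀ i, aeval a (P i) = y i) ∧ AlgebraicIndependent A a ∧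
      ∀ (L : Subfield Ω), (∀ c, algebraMap A Ω c ∈ L) → (∀ i, y i ∈ L) →
        ∀ i, IsAlgebraic L (a i) := by
  classical
  have hbasis : IsTranscendenceBasis A P := by
    refine hP.isTranscendenceBasis_of_lift_trdeg_le_of_finite ?_
    rw [MvPolynomial.trdeg_of_isDomain]
    simp
  have halg := hbasis.isAlgebraic
  have hinjy : Function.Injective (aeval y : MvPolynomial ι A →ₐ[A] Ω) := hy
  let B := Algebra.adjoin A (Set.range P)
  let ε : MvPolynomial ι A ≃ₐ[A] B := hP.aevalEquiv
  let _ : Algebra B Ω := ((aeval y).comp ε.symm.toAlgHom).toRingHom.toAlgebra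
  have hBinj : Function.Injective (algebraMap B Ω) := hinjy.comp ε.symm.injective
  have _ : FaithfulSMul B Ω := (faithfulSMul_iff_algebraMap_injective _ _).2 hBinj
  have _ : Module.IsTorsionFree B Ω := Module.isTorsionFree_iff_algebraMap_injective.2 hBinj
  let Φ : MvPolynomial ι A →ₐ[B] Ω := IsAlgClosed.lift
  have hΦB : ∀ b : B, Φ (b : MvPolynomial ι A) = aeval y (ε.symm b) := fun b => Φ.commutes b
  have hΦP : ∀ Q : MvPolynomial ι A, Φ (aeval P Q) = aeval y Q := by
    intro Q
    have := hΦB (ε Q)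
    rw [AlgEquiv.symm_apply_apply] at this
    rw [← this]
    congr 1
  have hΦC : ∀ c : A, Φ (C c) = algebraMap A Ω c := by
    intro c
    have := hΦP (C c)
    simpa [algebraMap_eq] using this
  let a : ι → Ω := fun i => Φ (X i)
  have hΦ : ∀ Q : MvPolynomial ι A, Φ Q = aeval a Q := by
    intro Q
    have : (Φ : MvPolynomial ι A →+* Ω) = (aeval a : MvPolynomial ι A →ₐ[A] Ω).toRingHom := by
      ext i
      · simp [hΦC]
      · simp [a]
    exact congrArg (fun f => f Q) this
  refine ⟨a, fun i => ?_, ?_, ?_⟩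
  · rw [← hΦ]
    have := hΦP (X i)
    simpa using this
  · show Function.Injective (aeval a : MvPolynomial ι A →ₐ[A] Ω)
    have : Function.Injective Φ := by
      have := hBinj
      rw [injective_iff_map_eq_zero]
      intro Q hQ
      by_contra hne
      obtain ⟨b, hb0, hb⟩ := (halg.isAlgebraic Q).exists_nonzero_dvd (mem_nonZeroDivisors_of_ne_zero hne)
      obtain ⟨R, hR⟩ := hb
      apply hb0
      apply hBinj
      rw [map_zero]
      have h := Φ.commutes b
      rw [hR, map_mul, hQ, zero_mul] at h
      exact h.symm
    intro p q h
    rw [← hΦ, ← hΦ] at h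
    exact this h
  · intro L hA hyL i
    have h1 : IsAlgebraic B (X i : MvPolynomial ι A) := halg.isAlgebraic _
    have hmem : ∀ b : B, algebraMap B Ω b ∈ L := by
      intro b
      show aeval y (ε.symm b) ∈ L
      generalize ε.symm b = Q
      induction Q using MvPolynomial.induction_on with
      | C c => simpa using hA c
      | add p q hp hq => rw [map_add]; exact L.add_mem hp hq
      | mul_X p i hp => rw [map_mul, aeval_X]; exact L.mul_mem hp (hyL i)
    let f : B →+* L := (algebraMap B Ω).codRestrict L hmem
    exact h1.ringHom_of_comp_eq f Φ (fun p q h => hBinj (congrArg Subtype.val h))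
      (by ext b; exact (Φ.commutes b).symm)

lemma hl_choose_aux (D k m : ℕ) (hk : 1 ≤ k) (hD : 2 ≤ D) :
    m * (D + 1) + (k + D).choose D ≤ (k + m + D).choose D := by
  induction m with
  | zero => simp
  | succ m ih =>
    obtain ⟨E, rfl⟩ : ∃ E, D = E + 1 := ⟨D - 1, by omega⟩
    have e : (k + (m + 1) + (E + 1)).choose (E + 1) =
        (k + m + (E + 1)).choose E + (k + m + (E + 1)).choose (E + 1) := by
      rw [show k + (m + 1) + (E + 1) = (k + m + (E + 1)) + 1 by ring, Nat.choose_succ_succ]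
    have h1 : (E + 2).choose E ≤ (k + m + (E + 1)).choose E := Nat.choose_le_choose _ (by omega)
    have h2 : E + 2 ≤ (E + 2).choose E := by
      have h3 : (E + 2).choose E = (E + 2).choose 2 := by
        rw [← Nat.choose_symm_of_eq_add]; ring
      rw [h3, Nat.choose_two_right, Nat.le_div_iff_mul_le (by norm_num)]
      have : 2 ≤ E + 2 - 1 := by omega
      exact Nat.mul_le_mul_left _ this
    rw [e]
    nlinarith

lemma hl_ineq (n k s D : ℕ) (hk : 1 ≤ k) (hkn : k ≤ n) (hD : 2 ≤ D)
    (h : (n + D).choose (D + 1) ≤ s * n) :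
    (n - k) * k + (k + D).choose (D + 1) ≤ s * k := by
  obtain ⟨m, rfl⟩ := Nat.exists_eq_add_of_le hkn
  have h1 := hl_choose_aux D k m hk hD
  have e1 : (k + D).choose (D + 1) * (D + 1) = (k + D).choose D * k := by
    rw [Nat.choose_succ_right_eq]; congr 1; omega
  have e2 : (k + m + D).choose (D + 1) * (D + 1) = (k + m + D).choose D * (k + m) := by
    rw [Nat.choose_succ_right_eq]; congr 1; omega
  rw [Nat.add_sub_cancel_left]
  have hpos : 0 < (D + 1) * (k + m) := by positivity
  refine Nat.le_of_mul_le_mul_right ?_ hpos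
  have h2 := Nat.mul_le_mul_right ((k + m) * k) h1
  have h3 := Nat.mul_le_mul_right ((D + 1) * k) h
  calc (m * k + (k + D).choose (D + 1)) * ((D + 1) * (k + m))
      = m * k * ((D + 1) * (k + m)) + ((k + D).choose (D + 1) * (D + 1)) * (k + m) := by ring
    _ = (m * (D + 1) + (k + D).choose D) * ((k + m) * k) := by rw [e1]; ring
    _ ≤ (k + m + D).choose D * ((k + m) * k) := h2
    _ = ((k + m + D).choose (D + 1) * (D + 1)) * k := by rw [e2]; ring
    _ = (k + m + D).choose (D + 1) * ((D + 1) * k) := by ring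
    _ ≤ s * (k + m) * ((D + 1) * k) := h3
    _ = _ := by ring

lemma mem_of_mulVec_mem {K Ω κ : Type*} [Field K] [Field Ω] [Algebra K Ω] [Fintype κ]
    [DecidableEq κ]
    (L : IntermediateField K Ω) (N : Matrix κ κ Ω) (hN : N.det ≠ 0) (hNL : ∀ i j, N i j ∈ L)
    (x : κ → Ω) (hz : ∀ i, (N.mulVec x) i ∈ L) (i : κ) : x i ∈ L := by
  let N' : Matrix κ κ L := Matrix.of fun i j => ⟨N i j, hNL i j⟩
  let z' : κ → L := fun i => ⟨_, hz i⟩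
  have hNN : N'.map (algebraMap L Ω) = N := by ext i j; rfl
  have hdet : IsUnit N'.det := by
    rw [isUnit_iff_ne_zero]
    intro h
    apply hN
    rw [← hNN]
    have := RingHom.map_det (algebraMap L Ω) N'
    rw [h, map_zero] at this
    exact this.symm
  let x' : κ → L := N'⁻¹.mulVec z'
  have h1 : N'.mulVec x' = z' := by
    simp only [x', Matrix.mulVec_mulVec, Matrix.mul_nonsing_inv _ hdet, Matrix.one_mulVec]
  have h2 : N.mulVec (fun i => (x' i : Ω)) = N.mulVec x := by
    ext i
    have := congrArg (fun v => ((v i : L) : Ω)) h1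
    simp only [Matrix.mulVec, dotProduct, N', Matrix.of_apply, z'] at this
    push_cast at this
    exact this
  have h3 := Matrix.eq_zero_of_mulVec_eq_zero hN (v := (fun i => (x' i : Ω)) - x)
    (by rw [Matrix.mulVec_sub, h2, sub_self])
  have h4 := congrFun h3 i
  simp only [Pi.sub_apply, Pi.zero_apply, sub_eq_zero] at h4
  rw [← h4]
  exact (x' i).2

lemma hl_expand {Ω σ κ : Type*} [Field Ω] [Fintype σ] [Fintype κ] (D : ℕ)
    (b : κ → σ) (hb : Function.Injective b)
    (c : σ → κ → Ω) (φ : (σ →₀ ℕ) → Ω)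
    (hc : ∀ i, ∀ α : σ →₀ ℕ, α.degree = D →
      φ (α + Finsupp.single i 1) = ∑ t, c i t * φ (α + Finsupp.single (b t) 1))
    (V : AddSubgroup Ω) (hV : ∀ i ∉ Set.range b, ∀ t, ∀ v ∈ V, c i t * v ∈ V)
    (hφ : ∀ ν : κ →₀ ℕ, ν.degree = D + 1 → φ (ν.mapDomain b) ∈ V) :
    ∀ ν : σ →₀ ℕ, ν.degree = D + 1 → φ ν ∈ V := by
  classical
  suffices H : ∀ m : ℕ, ∀ ν : σ →₀ ℕ, ν.degree = D + 1 →
      (∑ i with i ∉ Set.range b, ν i) = m → φ ν ∈ V from fun ν hν => H _ ν hν rfl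
  intro m
  induction m with
  | zero =>
    intro ν hν hm
    rw [Finset.sum_eq_zero_iff] at hm
    have hsupp : (ν.support : Set σ) ⊆ Set.range b := by
      intro i hi
      by_contra h
      have := hm i (by simpa using h)
      simp at hi
      exact hi this
    have e : (ν.comapDomain b hb.injOn).mapDomain b = ν :=
      Finsupp.mapDomain_comapDomain b hb ν hsupp
    rw [← e]
    apply hφ
    rw [← hν]
    conv_rhs => rw [← e]
    exact (Finsupp.degree_mapDomain b _).symm
  | succ m ih =>
    intro ν hν hm
    obtain ⟨i, hi, hi0⟩ : ∃ i ∈ Finset.univ.filter (fun i => i ∉ Set.range b), ν i ≠ 0 := by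
      apply Finset.exists_ne_zero_of_sum_ne_zero
      omega
    have hib : i ∉ Set.range b := by simpa using hi
    have hle : Finsupp.single i 1 ≤ ν := by
      rw [Finsupp.single_le_iff]; omega
    obtain ⟨α, rfl⟩ := exists_add_of_le hle
    rw [add_comm (Finsupp.single i 1)] at *
    have hα : α.degree = D := by
      rw [map_add, Finsupp.degree_single] at hν; omega
    rw [hc i α hα]
    refine AddSubgroup.sum_mem _ fun t _ => hV i hib t _ (ih _ ?_ ?_)
    · rw [map_add, Finsupp.degree_single, hα]
    · simp only [Finsupp.add_apply, Finset.sum_add_distrib] at hm ⊢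
      have h1 : ∑ x with x ∉ Set.range b, (Finsupp.single i 1 : σ →₀ ℕ) x = 1 := by
        rw [Finset.sum_eq_single_of_mem i hi]
        · simp
        · intro x _ hx
          simp [hx.symm]
      have h2 : ∑ x with x ∉ Set.range b, (Finsupp.single (b t) 1 : σ →₀ ℕ) x = 0 := by
        apply Finset.sum_eq_zero
        intro x hx
        rw [Finsupp.single_apply, if_neg]
        rintro rfl
        exact (Finset.mem_filter.1 hx).2 ⟨t, rfl⟩
      omega

lemma hl_aux {K Ω σ τ κ : Type*} [Field K] [Field Ω] [Algebra K Ω] [Fintype σ] [Fintype τ]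
    [Fintype κ] (D : ℕ) (hD : 2 ≤ D)
    (hcard : (Fintype.card σ + D).choose (D + 1) ≤ Fintype.card τ * Fintype.card σ)
    (h : τ × Deg σ D → Ω) (hh : AlgebraicIndependent K h)
    (φ : (σ →₀ ℕ) → Ω)
    (hφ : ∀ i j, ∑ α : Deg σ D, φ (α.1 + Finsupp.single i 1) * h (j, α) = 0)
    (b : κ → σ) (hb : Function.Injective b) (c : σ → κ → Ω)
    (hc : ∀ i, ∀ α : σ →₀ ℕ, α.degree = D →
      φ (α + Finsupp.single i 1) = ∑ t, c i t * φ (α + Finsupp.single (b t) 1))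
    (hli : LinearIndependent Ω (fun t => fun α : Deg σ D => φ (α.1 + Finsupp.single (b t) 1)))
    (ν₀ : Deg κ (D + 1)) (hν₀ : φ (ν₀.1.mapDomain b) = 1) : False := by
  classical
  let A : Matrix κ (Deg σ D) Ω := Matrix.of fun t α => φ (α.1 + Finsupp.single (b t) 1)
  obtain ⟨f, hf, hdet⟩ := exists_submatrix_det_ne_zero A hli
  let W := ({i : σ // i ∉ Set.range b} × κ) ⊕ {ν : Deg κ (D + 1) // ν ≠ ν₀} ⊕
    (τ × {α : Deg σ D // α ∉ Set.range f})
  let w : W → Ω := Sum.elim (fun p => c p.1 p.2) (Sum.elim (fun ν => φ (ν.1.1.mapDomain b))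
    (fun p => h (p.1, p.2.1)))
  let L := IntermediateField.adjoin K (Set.range w)
  have hwL : ∀ x, w x ∈ L := fun x => IntermediateField.subset_adjoin _ _ ⟨x, rfl⟩
  have hφL : ∀ ν : σ →₀ ℕ, ν.degree = D + 1 → φ ν ∈ L := by
    refine hl_expand D b hb c φ hc L.toSubfield.toSubring.toAddSubgroup ?_ ?_
    · intro i hi t v hv
      exact L.mul_mem (hwL (Sum.inl (⟨i, hi⟩, t))) hv
    · intro ν hν
      by_cases e : (⟨ν, hν⟩ : Deg κ (D + 1)) = ν₀
      · have : φ (ν.mapDomain b) = 1 := by rw [← hν₀, ← e]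
        rw [this]
        exact L.one_mem
      · exact hwL (Sum.inr (Sum.inl ⟨⟨ν, hν⟩, e⟩))
  have hφL' : ∀ (α : Deg σ D) i, φ (α.1 + Finsupp.single i 1) ∈ L := fun α i => hφL _ (by
    rw [map_add, Finsupp.degree_single, α.2])
  have hhL : ∀ p, h p ∈ L := by
    rintro ⟨j, α⟩
    by_cases hα : α ∈ Set.range f
    · obtain ⟨t, rfl⟩ := hα
      refine mem_of_mulVec_mem L (A.submatrix id f) hdet (fun _ _ => hφL' _ _)
        (fun t => h (j, f t)) ?_ t
      intro t'
      have e1 := hφ (b t') j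
      rw [← Finset.sum_filter_add_sum_filter_not _ (fun α => α ∈ Set.range f)] at e1
      have e2 : ∑ α with α ∈ Set.range f, φ (α.1 + Finsupp.single (b t') 1) * h (j, α) =
          (A.submatrix id f).mulVec (fun t => h (j, f t)) t' := by
        have : Finset.univ.filter (fun α => α ∈ Set.range f) = Finset.univ.image f := by
          ext; simp
        rw [this, Finset.sum_image hf.injOn]
        rfl
      rw [← e2, eq_neg_of_add_eq_zero_left e1]
      refine L.neg_mem (L.sum_mem fun α hα => L.mul_mem (hφL' _ _) ?_)
      exact hwL (Sum.inr (Sum.inr (j, ⟨α, by simpa using hα⟩)))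
    · exact hwL (Sum.inr (Sum.inr (j, ⟨α, hα⟩)))
  have hle := card_le_of_mem_adjoin hh w hhL
  have c1 : Fintype.card {i : σ // i ∉ Set.range b} = Fintype.card σ - Fintype.card κ := by
    rw [Fintype.card_subtype_compl]
    congr 1
    exact (Fintype.card_congr (Equiv.ofInjective b hb)).symm
  have c2 : Fintype.card {α : Deg σ D // α ∉ Set.range f} =
      Fintype.card (Deg σ D) - Fintype.card κ := by
    rw [Fintype.card_subtype_compl]
    congr 1
    exact (Fintype.card_congr (Equiv.ofInjective f hf)).symm
  have c3 : Fintype.card {ν : Deg κ (D + 1) // ν ≠ ν₀} = (Fintype.card κ + D).choose (D+1) - 1 := by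
    rw [Fintype.card_subtype_compl, Deg.card_eq, Fintype.card_subtype_eq]
    rfl
  have hk1 : 1 ≤ Fintype.card κ := by
    rw [Nat.one_le_iff_ne_zero, Ne, Fintype.card_eq_zero_iff]
    intro he
    have h0 : ν₀.1 = 0 := Subsingleton.elim _ _
    have := ν₀.2
    rw [h0] at this
    simp at this
  have hkn : Fintype.card κ ≤ Fintype.card σ := Fintype.card_le_of_injective b hb
  have hkM : Fintype.card κ ≤ Fintype.card (Deg σ D) := Fintype.card_le_of_injective f hf
  have hI := hl_ineq _ _ _ D hk1 hkn hD hcard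
  have hpos : 0 < (Fintype.card κ + D).choose (D+1) := Nat.choose_pos (by omega)
  simp only [W, Fintype.card_sum, Fintype.card_prod, c1, c2, c3] at hle
  obtain ⟨e, he⟩ := Nat.exists_eq_add_of_le hkM
  rw [he, Nat.add_sub_cancel_left, Nat.mul_add] at hle
  omega

/-- Surjectivity part of the Hochster-Laksov theorem on generic forms. -/
lemma hochster_laksov {K Ω σ τ : Type*} [Field K] [Field Ω] [Algebra K Ω] [Fintype σ] [Fintype τ]
    (D : ℕ) (hD : 2 ≤ D)
    (hcard : (Fintype.card σ + D).choose (D + 1) ≤ Fintype.card τ * Fintype.card σ)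
    (h : τ × Deg σ D → Ω) (hh : AlgebraicIndependent K h)
    (φ : (σ →₀ ℕ) → Ω)
    (hφ : ∀ i j, ∑ α : Deg σ D, φ (α.1 + Finsupp.single i 1) * h (j, α) = 0)
    (ν : σ →₀ ℕ) (hν : ν.degree = D + 1) : φ ν = 0 := by
  classical
  by_contra hne
  let R : σ → Deg σ D → Ω := fun i α => φ (α.1 + Finsupp.single i 1)
  obtain ⟨κ, b, hb, hsp, hli⟩ := exists_linearIndependent' Ω R
  have : Fintype κ := Fintype.ofInjective b hb
  have hc : ∀ i, ∃ c : κ → Ω, ∑ t, c t • (R ∘ b) t = R i := by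
    intro i
    rw [← Submodule.mem_span_range_iff_exists_fun, hsp]
    exact Submodule.subset_span ⟨i, rfl⟩
  choose c hc using hc
  have hc' : ∀ i, ∀ α : σ →₀ ℕ, α.degree = D →
      φ (α + Finsupp.single i 1) = ∑ t, c i t * φ (α + Finsupp.single (b t) 1) := by
    intro i α hα
    have := congrFun (hc i) ⟨α, hα⟩
    simp [R] at this
    exact this.symm
  obtain ⟨ν₀, hν₀, hu⟩ : ∃ ν₀ : κ →₀ ℕ, ν₀.degree = D + 1 ∧ φ (ν₀.mapDomain b) ≠ 0 := by
    by_contra! H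
    have := hl_expand D b hb c φ hc' ⊥ (by
      intro i _ t v hv
      rw [AddSubgroup.mem_bot] at hv ⊢
      rw [hv, mul_zero]) (fun ν hν => by rw [AddSubgroup.mem_bot]; exact H ν hν) ν hν
    exact hne (AddSubgroup.mem_bot.1 this)
  set u := φ (ν₀.mapDomain b)
  refine hl_aux D hD hcard h hh (fun ν => u⁻¹ * φ ν) ?_ b hb c ?_ ?_ ⟨ν₀, hν₀⟩
    (inv_mul_cancel₀ hu)
  · intro i j
    simp only [mul_assoc, ← Finset.mul_sum, hφ, mul_zero]
  · intro i α hα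
    rw [hc' i α hα, Finset.mul_sum]
    refine Finset.sum_congr rfl fun t _ => by ring
  · exact hli.units_smul (fun _ => Units.mk0 u⁻¹ (inv_ne_zero hu))

/-- Exponents of degree `e` in `σ ⊕ τ` involving some variable from `τ`. -/
abbrev NP (σ τ : Type*) (e : ℕ) :=
  {μ : (σ ⊕ τ) →₀ ℕ // μ.degree = e ∧ ∃ j, μ (Sum.inr j) ≠ 0}

noncomputable instance NP.instFintype (σ τ : Type*) [Fintype σ] [Fintype τ] (e : ℕ) :
    Fintype (NP σ τ e) :=
  Fintype.ofInjective (fun μ => (⟨μ.1, μ.2.1⟩ : Deg (σ ⊕ τ) e)) (by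
    intro x y h
    exact Subtype.ext (Subtype.mk.inj h))

/-- The linear substitution attached to a chart of the Grassmannian. -/
noncomputable def chartLin {σ τ S : Type*} [Fintype σ] [CommRing S] (a : σ → τ → S) :
    σ ⊕ τ → MvPolynomial σ S :=
  Sum.elim X (fun j => ∑ i, C (a i j) * X i)

/-- The restriction to the linear space of the part of the form not in the `σ` variables only. -/
noncomputable def npPart {σ τ S : Type*} [Fintype σ] [Fintype τ] [CommRing S] {e : ℕ}
    (c : NP σ τ e → S) (a : σ → τ → S) : MvPolynomial σ S :=
  ∑ μ : NP σ τ e, C (c μ) * μ.1.prod (fun k n => chartLin a k ^ n)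

lemma map_chartLin {σ τ S S' : Type*} [Fintype σ] [CommRing S] [CommRing S'] (f : S →+* S')
    (a : σ → τ → S) (k : σ ⊕ τ) :
    MvPolynomial.map f (chartLin a k) = chartLin (fun i j => f (a i j)) k := by
  rcases k with i | j <;> simp [chartLin]

lemma map_npPart {σ τ S S' : Type*} [Fintype σ] [Fintype τ] [CommRing S] [CommRing S'] {e : ℕ}
    (f : S →+* S') (c : NP σ τ e → S) (a : σ → τ → S) :
    MvPolynomial.map f (npPart c a) = npPart (fun μ => f (c μ)) (fun i j => f (a i j)) := by
  unfold npPart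
  rw [map_sum]
  refine Finset.sum_congr rfl fun μ _ => ?_
  rw [map_mul, map_C, map_finsuppProd]
  simp only [map_pow, map_chartLin]

/-- The exponent `X^α * X_j`. -/
noncomputable def npEmb {σ τ : Type*} {D : ℕ} (p : τ × Deg σ D) : NP σ τ (D + 1) :=
  ⟨p.2.1.mapDomain Sum.inl + Finsupp.single (Sum.inr p.1) 1, by
    rw [map_add, Finsupp.degree_mapDomain, Finsupp.degree_single, p.2.2], p.1, by simp⟩

lemma mapDomain_inl_inr {σ τ : Type*} (α : σ →₀ ℕ) (j : τ) :
    (α.mapDomain Sum.inl : (σ ⊕ τ) →₀ ℕ) (Sum.inr j) = 0 :=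
  Finsupp.mapDomain_of_notMem_range _ _ (by simp)

lemma npEmb_injective {σ τ : Type*} {D : ℕ} :
    Function.Injective (npEmb : τ × Deg σ D → NP σ τ (D + 1)) := by
  classical
  rintro ⟨j, α⟩ ⟨j', α'⟩ h
  have h0 := congrArg Subtype.val h
  simp only [npEmb] at h0
  have hj : j = j' := by
    have := congrArg (fun f => f (Sum.inr j)) h0
    simp only [Finsupp.add_apply, mapDomain_inl_inr, Finsupp.single_apply] at this
    by_contra hne
    simp [Ne.symm hne] at this
  subst hj
  have h1 := Finsupp.mapDomain_injective Sum.inl_injective (add_right_cancel h0)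
  rw [Subtype.ext h1]

lemma exists_mapDomain_inl {σ τ : Type*} (μ : (σ ⊕ τ) →₀ ℕ) (h : ∀ j, μ (Sum.inr j) = 0) :
    ∃ α : σ →₀ ℕ, α.mapDomain Sum.inl = μ := by
  refine ⟨μ.comapDomain Sum.inl Sum.inl_injective.injOn,
    Finsupp.mapDomain_comapDomain _ Sum.inl_injective _ ?_⟩
  rintro (i | j) hk
  · exact ⟨i, rfl⟩
  · simp [h] at hk

lemma prod_chartLin_add {σ τ S : Type*} [Fintype σ] [CommRing S] (a : σ → τ → S)
    (μ ν : (σ ⊕ τ) →₀ ℕ) :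
    ((μ + ν).prod fun k n => chartLin a k ^ n) =
      (μ.prod fun k n => chartLin a k ^ n) * (ν.prod fun k n => chartLin a k ^ n) := by
  classical
  exact Finsupp.prod_add_index' (by simp) (by intros; rw [pow_add])

lemma prod_chartLin_inl {σ τ S : Type*} [Fintype σ] [CommRing S] (a : σ → τ → S)
    (α : σ →₀ ℕ) :
    ((α.mapDomain Sum.inl : (σ ⊕ τ) →₀ ℕ).prod fun k n => chartLin a k ^ n) = monomial α 1 := by
  rw [Finsupp.prod_mapDomain_index (by simp) (by intros; rw [pow_add])]
  rw [monomial_eq]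
  simp [chartLin]

lemma npPart_linear {σ τ S : Type*} [Fintype σ] [Fintype τ] [CommRing S] {D : ℕ}
    (I : Ideal S) (c : NP σ τ (D + 1) → S) (a : σ → τ → S) (ha : ∀ i j, a i j ∈ I) :
    npPart c a - ∑ p : τ × Deg σ D, C (c (npEmb p)) *
      (monomial p.2.1 1 * ∑ i, C (a i p.1) * X i) ∈ (I ^ 2).map C := by
  classical
  have hlin : ∀ j, chartLin a (Sum.inr j) ∈ I.map (C : S →+* MvPolynomial σ S) := fun j =>
    Ideal.sum_mem _ fun i _ => Ideal.mul_mem_right _ _ (Ideal.mem_map_of_mem _ (ha i j))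
  unfold npPart
  rw [← Finset.sum_filter_add_sum_filter_not _ (fun μ => μ ∈ Set.range npEmb)]
  have e1 : ∑ μ : NP σ τ (D + 1) with μ ∈ Set.range npEmb,
      C (c μ) * μ.1.prod (fun k n => chartLin a k ^ n) =
      ∑ p : τ × Deg σ D, C (c (npEmb p)) * (monomial p.2.1 1 * ∑ i, C (a i p.1) * X i) := by
    have : Finset.univ.filter (fun μ => μ ∈ Set.range (npEmb : τ × Deg σ D → NP σ τ (D + 1))) =
      Finset.univ.image npEmb := by ext; simp
    rw [this, Finset.sum_image npEmb_injective.injOn]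
    refine Finset.sum_congr rfl fun p _ => ?_
    congr 1
    simp only [npEmb]
    rw [prod_chartLin_add, prod_chartLin_inl, Finsupp.prod_single_index (by simp)]
    simp [chartLin]
  rw [e1, add_sub_cancel_left]
  refine Ideal.sum_mem _ fun μ hμ => Ideal.mul_mem_left _ _ ?_
  have hμ' : μ ∉ Set.range npEmb := by simpa using hμ
  obtain ⟨μ, hdeg, j, hj⟩ := μ
  simp only
  obtain ⟨μ', rfl⟩ := exists_add_of_le (show Finsupp.single (Sum.inr j) 1 ≤ μ by
    rw [Finsupp.single_le_iff]; omega)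
  have hdeg' : μ'.degree = D := by
    rw [map_add, Finsupp.degree_single] at hdeg; omega
  obtain ⟨j', hj'⟩ : ∃ j', μ' (Sum.inr j') ≠ 0 := by
    by_contra! H
    obtain ⟨α, rfl⟩ := exists_mapDomain_inl μ' H
    apply hμ'
    refine ⟨(j, ⟨α, by rw [← hdeg', Finsupp.degree_mapDomain]⟩), ?_⟩
    apply Subtype.ext
    simp only [npEmb]
    rw [add_comm]
  obtain ⟨μ'', rfl⟩ := exists_add_of_le (show Finsupp.single (Sum.inr j') 1 ≤ μ' by
    rw [Finsupp.single_le_iff]; omega)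
  rw [prod_chartLin_add, prod_chartLin_add, ← mul_assoc, Ideal.map_pow, pow_two]
  refine Ideal.mul_mem_right _ _ (Ideal.mul_mem_mul ?_ ?_)
  · rw [Finsupp.prod_single_index (by simp), pow_one]; exact hlin _
  · rw [Finsupp.prod_single_index (by simp), pow_one]; exact hlin _

/-- The matrix of linear parts. -/
noncomputable def linMat {σ τ S : Type*} [Fintype σ] [CommRing S] {D : ℕ}
    (c : NP σ τ (D + 1) → S) : Matrix (Deg σ (D + 1)) (σ × τ) S :=
  open Classical in
  Matrix.of fun ν p => ∑ α : Deg σ D,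
    if α.1 + Finsupp.single p.1 1 = ν.1 then c (npEmb (p.2, α)) else 0

lemma coeff_npPart_linear {σ τ S : Type*} [Fintype σ] [Fintype τ] [CommRing S] {D : ℕ}
    (I : Ideal S) (c : NP σ τ (D + 1) → S) (a : σ → τ → S) (ha : ∀ i j, a i j ∈ I)
    (ν : Deg σ (D + 1)) :
    coeff ν.1 (npPart c a) - ∑ p : σ × τ, linMat c ν p * a p.1 p.2 ∈ I ^ 2 := by
  classical
  have h := (mem_map_C_iff.1 (npPart_linear I c a ha)) ν.1
  rw [coeff_sub] at h
  convert h using 2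
  rw [coeff_sum, Fintype.sum_prod_type, Fintype.sum_prod_type, Finset.sum_comm]
  refine Finset.sum_congr rfl fun j _ => ?_
  simp only [linMat, Matrix.of_apply, Finset.sum_mul, Finset.mul_sum, coeff_sum, coeff_C_mul]
  rw [Finset.sum_comm]
  refine Finset.sum_congr rfl fun α _ => Finset.sum_congr rfl fun i _ => ?_
  have : (monomial α.1 (1 : S)) * (C (a i j) * X i) = monomial (α.1 + Finsupp.single i 1) (a i j) := by
    rw [X, C_mul_monomial, monomial_mul]; simp
  rw [this, coeff_monomial]
  split_ifs <;> simp

lemma linMat_rows {K Ω σ τ : Type*} [Field K] [Field Ω] [Algebra K Ω] [Fintype σ] [Fintype τ]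
    (D : ℕ) (hD : 2 ≤ D)
    (hcard : (Fintype.card σ + D).choose (D + 1) ≤ Fintype.card τ * Fintype.card σ)
    (c : NP σ τ (D + 1) → Ω) (hc : AlgebraicIndependent K c) :
    LinearIndependent Ω (linMat c).row := by
  classical
  rw [Fintype.linearIndependent_iff]
  intro φ hφ ν
  let φ' : (σ →₀ ℕ) → Ω := fun μ => if h : μ.degree = D + 1 then φ ⟨μ, h⟩ else 0
  have := hochster_laksov D hD hcard (fun p => c (npEmb p)) (hc.comp _ npEmb_injective) φ' ?_ ν.1 ν.2
  · simpa [φ', ν.2] using this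
  · intro i j
    have h1 := congrFun hφ (i, j)
    simp only [Finset.sum_apply, Pi.smul_apply, Matrix.row, linMat, Matrix.of_apply, smul_eq_mul,
      Pi.zero_apply, Finset.mul_sum] at h1
    rw [Finset.sum_comm] at h1
    rw [← h1]
    refine Finset.sum_congr rfl fun α _ => ?_
    have hd : (α.1 + Finsupp.single i 1).degree = D + 1 := by
      rw [map_add, Finsupp.degree_single, α.2]
    rw [Finset.sum_eq_single (⟨_, hd⟩ : Deg σ (D + 1))]
    · simp only [φ', dif_pos hd, if_true]
    · intro μ _ hμ
      rw [if_neg, mul_zero]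
      intro h
      exact hμ (Subtype.ext h.symm)
    · simp

theorem core {K Ω σ τ : Type*} [Field K] [Field Ω] [IsAlgClosed Ω] [Algebra K Ω] [Fintype σ]
    [Fintype τ] (D : ℕ) (hD : 2 ≤ D)
    (hcard : (Fintype.card σ + D).choose (D + 1) ≤ Fintype.card τ * Fintype.card σ)
    (y : Deg σ (D + 1) → Ω) (c : NP σ τ (D + 1) → Ω)
    (hyc : AlgebraicIndependent K (Sum.elim y c)) :
    ∃ a : σ → τ → Ω, (∀ ν, coeff ν.1 (npPart c a) = - y ν) ∧
      (∃ E : IntermediateField K Ω, (∀ i j, a i j ∈ E) ∧ AlgebraicIndependent E c) ∧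
      ∀ L : IntermediateField K Ω, (∀ μ, c μ ∈ L) → (∀ ν, y ν ∈ L) →
        ∀ i j, IsAlgebraic L (a i j) := by
  classical
  have hsum := AlgebraicIndependent.sumElim_iff.1 hyc
  have hc := hsum.1
  have hy := hsum.2
  set A := Algebra.adjoin K (Set.range c) with hA
  let c' : NP σ τ (D + 1) → A := fun μ => ⟨c μ, Algebra.subset_adjoin ⟨μ, rfl⟩⟩
  obtain ⟨f, hf, hdet⟩ := exists_submatrix_det_ne_zero (linMat c) (linMat_rows D hD hcard c hc)
  have hmap : ((linMat c').submatrix id f).map (algebraMap A Ω) = (linMat c).submatrix id f := by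
    ext ν ν'
    simp only [linMat, Matrix.map_apply, Matrix.submatrix_apply, Matrix.of_apply, map_sum]
    refine Finset.sum_congr rfl fun α _ => ?_
    split_ifs
    · rfl
    · simp
  have hdet' : ((linMat c').submatrix id f).det ≠ 0 := by
    intro h
    apply hdet
    have := RingHom.map_det (algebraMap A Ω) ((linMat c').submatrix id f)
    rw [h, map_zero] at this
    rw [← hmap]
    exact this.symm
  let a0 : σ → τ → MvPolynomial (Deg σ (D + 1)) A := fun i j =>
    ∑ ν, if f ν = (i, j) then X ν else 0
  have ha0 : ∀ i j, a0 i j ∈ idealOfVars (Deg σ (D + 1)) A := by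
    intro i j
    refine Ideal.sum_mem _ fun ν _ => ?_
    split_ifs
    · exact Ideal.subset_span ⟨ν, rfl⟩
    · exact Ideal.zero_mem _
  let P : Deg σ (D + 1) → MvPolynomial (Deg σ (D + 1)) A := fun ν =>
    - coeff ν.1 (npPart (fun μ => C (c' μ)) a0)
  have hP : AlgebraicIndependent A P := by
    refine algebraicIndependent_of_linear_part P (-((linMat c').submatrix id f)) ?_ ?_
    · rw [Matrix.det_neg]
      exact mul_ne_zero (pow_ne_zero _ (neg_ne_zero.2 one_ne_zero)) hdet'
    · intro ν
      have h := neg_mem (coeff_npPart_linear _ (fun μ => C (c' μ)) a0 ha0 ν)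
      convert h using 1
      simp only [P, neg_sub, Matrix.neg_apply, map_neg, neg_mul, Finset.sum_neg_distrib,
        sub_neg_eq_add]
      rw [sub_eq_add_neg]
      refine (add_comm _ _).trans ?_
      congr 1
      have e : ∀ p : σ × τ, linMat (fun μ => (C (c' μ) : MvPolynomial (Deg σ (D + 1)) A)) ν p =
          C (linMat c' ν p) := by
        intro p
        simp only [linMat, Matrix.of_apply, map_sum]
        refine Finset.sum_congr rfl fun α _ => ?_
        split_ifs <;> simp
      simp only [e, a0, Finset.mul_sum]
      rw [Finset.sum_comm]
      refine Finset.sum_congr rfl fun ν' _ => ?_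
      rw [Finset.sum_eq_single (f ν')]
      · simp
      · intro p _ hp
        rw [if_neg (by rintro h; exact hp h.symm), mul_zero]
      · simp
  obtain ⟨a, haP, haind, haalg⟩ := exists_generic_solution P hP y hy
  refine ⟨fun i j => aeval a (a0 i j), ?_, ?_, ?_⟩
  · intro ν
    have h1 := haP ν
    have h2 := congrArg (coeff ν.1) (map_npPart ((aeval a : MvPolynomial (Deg σ (D + 1)) A →ₐ[A] Ω) :
      MvPolynomial (Deg σ (D + 1)) A →+* Ω) (fun μ => C (c' μ)) a0)
    rw [coeff_map] at h2
    simp only [P, map_neg] at h1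
    rw [← h1, neg_neg]
    refine Eq.trans ?_ h2.symm
    congr 2
    ext μ
    show c μ = aeval a (C (c' μ))
    rw [aeval_C]
    rfl
  · refine ⟨IntermediateField.adjoin K (Set.range a), ?_, ?_⟩
    · intro i j
      simp only [a0, map_sum]
      refine IntermediateField.sum_mem _ fun ν _ => ?_
      split_ifs
      · rw [aeval_X]; exact IntermediateField.subset_adjoin _ _ ⟨ν, rfl⟩
      · rw [map_zero]; exact IntermediateField.zero_mem _
    · rw [IntermediateField.algebraicIndependent_adjoin_iff]
      have h1 : AlgebraicIndependent K (Sum.elim a c) := AlgebraicIndependent.sumElim_iff.2 ⟨hc, haind⟩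
      have h2 : AlgebraicIndependent K (Sum.elim c a) := by
        have := h1.comp _ (Equiv.sumComm (NP σ τ (D+1)) (Deg σ (D + 1))).injective
        convert this using 1
        ext (i | i) <;> rfl
      exact (AlgebraicIndependent.sumElim_iff.1 h2).2
  · intro L hcL hyL i j
    have hAL : ∀ x : A, algebraMap A Ω x ∈ L.toSubfield := by
      intro x
      have : A ≤ L.toSubalgebra := Algebra.adjoin_le (by rintro _ ⟨μ, rfl⟩; exact hcL μ)
      exact this x.2
    have h1 : ∀ ν, IsAlgebraic L (a ν) := fun ν => haalg L.toSubfield hAL hyL ν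
    simp only [a0, map_sum]
    have : (∑ ν, (aeval a) (if f ν = (i, j) then (X ν : MvPolynomial (Deg σ (D + 1)) A) else 0)) ∈
        algebraicClosure L Ω := by
      refine IntermediateField.sum_mem _ fun ν _ => ?_
      split_ifs
      · rw [aeval_X]; exact mem_algebraicClosure_iff.2 (h1 ν)
      · rw [map_zero]; exact IntermediateField.zero_mem _
    exact mem_algebraicClosure_iff.1 this

lemma pureNP_bijective (σ τ : Type*) (e : ℕ) :
    Function.Bijective (Sum.elim
      (fun ν : Deg σ e => (⟨ν.1.mapDomain Sum.inl, by
        rw [Finsupp.degree_mapDomain, ν.2]⟩ : Deg (σ ⊕ τ) e))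
      (fun μ : NP σ τ e => (⟨μ.1, μ.2.1⟩ : Deg (σ ⊕ τ) e))) := by
  constructor
  · rintro (x | x) (y | y) h
    · have := Finsupp.mapDomain_injective Sum.inl_injective (Subtype.mk.inj h)
      rw [Subtype.ext this]
    · have h1 := Subtype.mk.inj h
      obtain ⟨j, hj⟩ := y.2.2
      rw [← h1, mapDomain_inl_inr] at hj
      exact absurd rfl hj
    · have h1 := Subtype.mk.inj h
      obtain ⟨j, hj⟩ := x.2.2
      rw [h1, mapDomain_inl_inr] at hj
      exact absurd rfl hj
    · have := Subtype.mk.inj h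
      rw [Subtype.ext this]
  · rintro ⟨μ, hμ⟩
    by_cases h : ∃ j, μ (Sum.inr j) ≠ 0
    · exact ⟨Sum.inr ⟨μ, hμ, h⟩, rfl⟩
    · push Not at h
      obtain ⟨α, rfl⟩ := exists_mapDomain_inl μ h
      refine ⟨Sum.inl ⟨α, ?_⟩, rfl⟩
      rwa [Finsupp.degree_mapDomain] at hμ

/-- An exponent of degree `e` is either pure or not. -/
noncomputable def pureNP (σ τ : Type*) (e : ℕ) : Deg σ e ⊕ NP σ τ e ≃ Deg (σ ⊕ τ) e :=
  Equiv.ofBijective _ (pureNP_bijective σ τ e)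

lemma bind_chartLin {σ τ S : Type*} [Fintype σ] [Fintype τ] [CommRing S] {e : ℕ}
    (G : MvPolynomial (σ ⊕ τ) S) (hG : G.IsHomogeneous e) (a : σ → τ → S) :
    bind₁ (chartLin a) G =
      ∑ ν : Deg σ e, monomial ν.1 (coeff (ν.1.mapDomain Sum.inl) G) +
        npPart (fun μ : NP σ τ e => coeff μ.1 G) a := by
  classical
  have h1 : bind₁ (chartLin a) G = ∑ μ : Deg (σ ⊕ τ) e,
      C (coeff μ.1 G) * μ.1.prod (fun k n => chartLin a k ^ n) := by
    have h0 : bind₁ (chartLin a) G = ∑ μ ∈ G.support,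
      C (coeff μ G) * μ.prod (fun k n => chartLin a k ^ n) := rfl
    rw [h0]
    refine Eq.trans ?_ (Finset.sum_map Finset.univ
      (Function.Embedding.subtype (fun μ : (σ ⊕ τ) →₀ ℕ => μ.degree = e))
      (fun μ => C (coeff μ G) * μ.prod (fun k n => chartLin a k ^ n)))
    refine Finset.sum_subset ?_ ?_
    · intro μ hμ
      have : μ.degree = e := by
        by_contra hne
        exact (mem_support_iff.1 hμ) (hG.coeff_eq_zero hne)
      simp [this]
    · intro μ _ hμ
      rw [notMem_support_iff.1 hμ, C_0, zero_mul]
  rw [h1, ← (pureNP σ τ e).sum_comp, Fintype.sum_sum_type]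
  congr 1
  refine Finset.sum_congr rfl fun ν _ => ?_
  change C (coeff (ν.1.mapDomain Sum.inl) G) *
    (ν.1.mapDomain Sum.inl : (σ ⊕ τ) →₀ ℕ).prod (fun k n => chartLin a k ^ n) = _
  rw [prod_chartLin_inl, C_mul_monomial, mul_one]

lemma bind_chartLin_eq_zero {σ τ S : Type*} [Fintype σ] [Fintype τ] [CommRing S] {e : ℕ}
    (G : MvPolynomial (σ ⊕ τ) S) (hG : G.IsHomogeneous e) (a : σ → τ → S)
    (h : ∀ ν : Deg σ e, coeff ν.1 (npPart (fun μ : NP σ τ e => coeff μ.1 G) a) =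
      - coeff (ν.1.mapDomain Sum.inl) G) :
    bind₁ (chartLin a) G = 0 := by
  classical
  have hlin : ∀ k, (chartLin a k).IsHomogeneous 1 := by
    rintro (i | j)
    · exact isHomogeneous_X _ _
    · refine IsHomogeneous.sum _ _ _ fun i _ => ?_
      simpa using (isHomogeneous_C σ (a i j)).mul (isHomogeneous_X S i)
  have hh : (bind₁ (chartLin a) G).IsHomogeneous (1 * e) := hG.aeval _ hlin
  rw [one_mul] at hh
  ext ν
  rw [coeff_zero]
  by_cases hν : ν.degree = e
  · rw [bind_chartLin G hG, coeff_add, h ⟨ν, hν⟩, coeff_sum]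
    rw [Finset.sum_eq_single (⟨ν, hν⟩ : Deg σ e)]
    · simp
    · intro ν' _ hne
      rw [coeff_monomial, if_neg]
      intro h'
      exact hne (Subtype.ext h')
    · simp
  · exact hh.coeff_eq_zero hν

lemma coeff_npPart_mem {σ τ Ω : Type*} [Fintype σ] [Fintype τ] [Field Ω] {e : ℕ}
    (F : Subfield Ω) (c : NP σ τ e → Ω) (a : σ → τ → Ω) (hc : ∀ μ, c μ ∈ F)
    (ha : ∀ i j, a i j ∈ F) (ν : σ →₀ ℕ) : coeff ν (npPart c a) ∈ F := by
  have := map_npPart F.subtype (fun μ => (⟨c μ, hc μ⟩ : F)) (fun i j => (⟨a i j, ha i j⟩ : F))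
  have h2 := congrArg (coeff ν) this
  rw [coeff_map] at h2
  exact h2 ▸ (coeff ν (npPart (fun μ => (⟨c μ, hc μ⟩ : F)) (fun i j => (⟨a i j, ha i j⟩ : F)))).2

lemma det_mem_subfield {Ω n : Type*} [Field Ω] [Fintype n] [DecidableEq n] (F : Subfield Ω)
    (M : Matrix n n Ω) (h : ∀ i j, M i j ∈ F) : M.det ∈ F := by
  rw [Matrix.det_apply']
  exact sum_mem fun σ _ => mul_mem (intCast_mem _ _) (prod_mem fun i _ => h _ _)

/-- The basis of the chart subspace. -/
noncomputable def chartBasis {σ τ κ Ω : Type*} [DecidableEq σ] [Field Ω]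
    (ε : σ ⊕ τ ≃ κ) (a : σ → τ → Ω) : σ → κ → Ω :=
  fun i k => Sum.elim (fun i' => if i = i' then 1 else 0) (fun j => a i j) (ε.symm k)

lemma chartBasis_inl {σ τ κ Ω : Type*} [DecidableEq σ] [Field Ω]
    (ε : σ ⊕ τ ≃ κ) (a : σ → τ → Ω) (i i' : σ) :
    chartBasis ε a i (ε (Sum.inl i')) = if i = i' then 1 else 0 := by
  simp [chartBasis]

lemma chartBasis_inr {σ τ κ Ω : Type*} [DecidableEq σ] [Field Ω]
    (ε : σ ⊕ τ ≃ κ) (a : σ → τ → Ω) (i : σ) (j : τ) :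
    chartBasis ε a i (ε (Sum.inr j)) = a i j := by
  simp [chartBasis]

lemma chartBasis_mem {σ τ κ Ω : Type*} [DecidableEq σ] [Field Ω]
    (ε : σ ⊕ τ ≃ κ) (a : σ → τ → Ω) (F : Subfield Ω) (h : ∀ i j, a i j ∈ F) (i : σ) (k : κ) :
    chartBasis ε a i k ∈ F := by
  obtain ⟨k, rfl⟩ := ε.surjective k
  rcases k with i' | j
  · rw [chartBasis_inl]
    split_ifs
    · exact one_mem _
    · exact zero_mem _
  · rw [chartBasis_inr]
    exact h i j

lemma chartBasis_linearIndependent {σ τ κ Ω : Type*} [Fintype σ] [DecidableEq σ] [Field Ω]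
    (ε : σ ⊕ τ ≃ κ) (a : σ → τ → Ω) : LinearIndependent Ω (chartBasis ε a) := by
  rw [Fintype.linearIndependent_iff]
  intro t ht i
  have := congrFun ht (ε (Sum.inl i))
  simpa [chartBasis_inl] using this

lemma chartBasis_eval {σ τ κ Ω : Type*} [Fintype σ] [DecidableEq σ] [Field Ω]
    (ε : σ ⊕ τ ≃ κ) (a : σ → τ → Ω) (g : MvPolynomial κ Ω)
    (h : bind₁ (chartLin a) (rename ε.symm g) = 0)
    (v : κ → Ω) (hv : v ∈ Submodule.span Ω (Set.range (chartBasis ε a))) : eval v g = 0 := by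
  rw [Submodule.mem_span_range_iff_exists_fun] at hv
  obtain ⟨t, rfl⟩ := hv
  have h1 := congrArg (eval t) h
  rw [map_zero] at h1
  rw [← h1, bind₁_rename, ← coe_aeval_eq_eval, ← coe_aeval_eq_eval]
  simp only [RingHom.coe_coe]
  rw [aeval_bind₁]
  congr 2
  ext k
  obtain ⟨k, rfl⟩ := ε.surjective k
  rcases k with i' | j
  · simp [chartBasis_inl, chartLin]
  · simp [chartBasis_inr, chartLin, mul_comm]

lemma chartBasis_det_one {σ τ κ Ω : Type*} [Fintype σ] [DecidableEq σ] [Field Ω]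
    (ε : σ ⊕ τ ≃ κ) (a : σ → τ → Ω) :
    Matrix.det (Matrix.of fun i b => chartBasis ε a i (ε (Sum.inl b))) = 1 := by
  have : (Matrix.of fun i b => chartBasis ε a i (ε (Sum.inl b))) = (1 : Matrix σ σ Ω) := by
    ext i b
    simp [chartBasis_inl, Matrix.one_apply]
  rw [this, Matrix.det_one]

lemma chartBasis_det_entry {σ τ κ Ω : Type*} [Fintype σ] [DecidableEq σ] [Field Ω]
    (ε : σ ⊕ τ ≃ κ) (a : σ → τ → Ω) (i : σ) (j : τ) :
    Matrix.det (Matrix.of fun x b => chartBasis ε a x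
      ((Function.update (fun b => ε (Sum.inl b)) i (ε (Sum.inr j)) : σ → κ) b)) = a i j := by
  have : (Matrix.of fun x b => chartBasis ε a x
      ((Function.update (fun b => ε (Sum.inl b)) i (ε (Sum.inr j)) : σ → κ) b)) =
      (1 : Matrix σ σ Ω).updateCol i (fun x => a x j) := by
    ext x b
    by_cases hb : b = i
    · subst hb
      simp [chartBasis_inr]
    · simp [hb, chartBasis_inl, Matrix.one_apply]
  rw [this, ← Matrix.cramer_apply, Matrix.cramer_one]
  rfl

/-- **Existence of a linear space over which the generic hypersurface stays generic.**
Let `K` be a field of characteristic zero, `d ≥ 3`, `1 ≤ q`, `0 < q < r` and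
`(r - q)(q + 1) ≥ C(2d + q, q)`. Let `g` be a homogeneous polynomial of degree `2d` in
`X_0, …, X_r` with coefficients in an algebraically closed field `Ω ⊇ K`, the
`C(r + 2d, 2d)` coefficients being algebraically independent over `K`, and let
`K1 = K(θ(B))` be the subfield of `Ω` they generate (`B = {g = 0}` is a generic
hypersurface of degree `2d`). Then there is a `(q+1)`-dimensional subspace `W ⊆ Ω^{r+1}`
(given by a basis `e`) on which `g` vanishes identically, such that:
(i) `W` has a basis whose coordinates lie in a finite extension `K^#` of `K1` inside
`Ω`; and (ii) letting `K(l(L₀))` be the subfield of `Ω` generated over `K` by the ratios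
of the Plücker coordinates of `W` (the `(q+1) × (q+1)` minors of the basis matrix), the
field generated over `K(l(L₀))` by the coefficients of `g` has transcendence degree
`C(r + 2d, 2d) - C(q + 2d, 2d)` over `K(l(L₀))`; that is, `B` is generic over `K`
subject to containing the linear space `L₀ = ℙ(W)`. -/
theorem stmt_4 (K : Type u) [Field K] [CharZero K] (d q r : ℕ)
    (hd : 3 ≤ d) (hq : 1 ≤ q) (hqr : q < r)
    (hineq : Nat.choose (2 * d + q) q ≤ (r - q) * (q + 1))
    (Ω : Type u) [Field Ω] [IsAlgClosed Ω] [Algebra K Ω]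
    (g : MvPolynomial (Fin (r + 1)) Ω) (hg : g.IsHomogeneous (2 * d))
    (hindep : AlgebraicIndependent K
      (fun μ : {μ : Fin (r + 1) →₀ ℕ // (∑ i, μ i) = 2 * d} => g.coeff μ.1)) :
    ∃ e : Fin (q + 1) → (Fin (r + 1) → Ω),
      LinearIndependent Ω e ∧
      (∀ v ∈ Submodule.span Ω (Set.range e), MvPolynomial.eval v g = 0) ∧
      (∃ Ks : IntermediateField
          (↥(IntermediateField.adjoin K (Set.range g.coeff))) Ω,
        FiniteDimensional (↥(IntermediateField.adjoin K (Set.range g.coeff))) ↥Ks ∧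
        ∀ i j, e i j ∈ Ks) ∧
      FieldTrdegEq
        (↥(IntermediateField.adjoin K
          {x : Ω | ∃ c c' : Fin (q + 1) → Fin (r + 1),
            Matrix.det (Matrix.of fun a b => e a (c' b)) ≠ 0 ∧
            x = Matrix.det (Matrix.of fun a b => e a (c b)) /
                Matrix.det (Matrix.of fun a b => e a (c' b))})) Ω
        (Set.range g.coeff)
        (Nat.choose (r + 2 * d) (2 * d) - Nat.choose (q + 2 * d) (2 * d)) := by
  classical
  obtain ⟨D, hD, hDd⟩ : ∃ D, 2 ≤ D ∧ 2 * d = D + 1 := ⟨2 * d - 1, by omega, by omega⟩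
  rw [hDd] at hineq hg hindep ⊢
  have hr : (q + 1) + (r - q) = r + 1 := by omega
  let ε : Fin (q + 1) ⊕ Fin (r - q) ≃ Fin (r + 1) := finSumFinEquiv.trans (finCongr hr)
  set G : MvPolynomial (Fin (q + 1) ⊕ Fin (r - q)) Ω := rename ε.symm g with hG
  have hGhom : G.IsHomogeneous (D + 1) := hg.rename_isHomogeneous
  have hGcoeff : ∀ μ, coeff μ G = coeff (μ.mapDomain ε) g := by
    intro μ
    have h := coeff_rename_mapDomain ε.symm ε.symm.injective g (μ.mapDomain ε)
    rw [← Finsupp.mapDomain_comp, ε.symm_comp_self, Finsupp.mapDomain_id] at h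
    exact h
  have hgcoeff : ∀ μ, coeff μ g = coeff (μ.mapDomain ε.symm) G := fun μ =>
    (coeff_rename_mapDomain ε.symm ε.symm.injective g μ).symm
  let c : NP (Fin (q + 1)) (Fin (r - q)) (D + 1) → Ω := fun μ => coeff μ.1 G
  let y : Deg (Fin (q + 1)) (D + 1) → Ω := fun ν => coeff (ν.1.mapDomain Sum.inl) G
  have hyc : AlgebraicIndependent K (Sum.elim y c) := by
    let φ : Deg (Fin (q + 1)) (D + 1) ⊕ NP (Fin (q + 1)) (Fin (r - q)) (D + 1) →
        {μ : Fin (r + 1) →₀ ℕ // (∑ i, μ i) = D + 1} := fun z =>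
      ⟨(pureNP _ _ _ z).1.mapDomain ε, by
        rw [← Finsupp.degree_eq_sum, Finsupp.degree_mapDomain, (pureNP _ _ _ z).2]⟩
    have hφ : Function.Injective φ := by
      intro z w h
      have h1 := Finsupp.mapDomain_injective ε.injective (Subtype.mk.inj h)
      exact (pureNP _ _ _).injective (Subtype.ext h1)
    have h := hindep.comp φ hφ
    convert h using 1
    ext (z | z)
    · exact hGcoeff _
    · exact hGcoeff _
  have hcard : (Fintype.card (Fin (q + 1)) + D).choose (D + 1) ≤
      Fintype.card (Fin (r - q)) * Fintype.card (Fin (q + 1)) := by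
    rw [Fintype.card_fin, Fintype.card_fin]
    refine le_trans (le_of_eq ?_) hineq
    rw [show q + 1 + D = (D + 1) + q by omega, Nat.choose_symm_add]
  obtain ⟨a, ha0, ⟨E, haE, hcE⟩, haalg⟩ := core D hD hcard y c hyc
  have hbind : bind₁ (chartLin a) G = 0 := bind_chartLin_eq_zero G hGhom a ha0
  refine ⟨chartBasis ε a, chartBasis_linearIndependent ε a,
    fun v hv => chartBasis_eval ε a g hbind v hv, ?_, ?_⟩
  · -- the coordinates lie in a finite extension
    set L := IntermediateField.adjoin K (Set.range g.coeff) with hL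
    have hmem : ∀ μ, coeff μ G ∈ L := fun μ => by
      rw [hGcoeff]
      exact IntermediateField.subset_adjoin _ _ ⟨_, rfl⟩
    have halg := haalg L (fun μ => hmem _) (fun ν => hmem _)
    refine ⟨IntermediateField.adjoin L
      (Set.range fun p : Fin (q + 1) × Fin (r - q) => a p.1 p.2), ?_, ?_⟩
    · have : Finite (Set.range fun p : Fin (q + 1) × Fin (r - q) => a p.1 p.2) :=
        Set.finite_range _
      refine IntermediateField.finiteDimensional_adjoin ?_
      rintro _ ⟨p, rfl⟩
      exact (halg p.1 p.2).isIntegral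
    · intro i k
      refine chartBasis_mem ε a (IntermediateField.adjoin L
        (Set.range fun p : Fin (q + 1) × Fin (r - q) => a p.1 p.2)).toSubfield ?_ i k
      intro i j
      exact IntermediateField.subset_adjoin L _ ⟨(i, j), rfl⟩
  · set F := IntermediateField.adjoin K
          {x : Ω | ∃ c c' : Fin (q + 1) → Fin (r + 1),
            Matrix.det (Matrix.of fun x b => chartBasis ε a x (c' b)) ≠ 0 ∧
            x = Matrix.det (Matrix.of fun x b => chartBasis ε a x (c b)) /
                Matrix.det (Matrix.of fun x b => chartBasis ε a x (c' b))} with hF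
    have haF : ∀ i j, a i j ∈ F := by
      intro i j
      refine IntermediateField.subset_adjoin _ _
        ⟨Function.update (fun b => ε (Sum.inl b)) i (ε (Sum.inr j)), fun b => ε (Sum.inl b), ?_, ?_⟩
      · rw [chartBasis_det_one]
        exact one_ne_zero
      · rw [chartBasis_det_one, chartBasis_det_entry, div_one]
    have hFE : F ≤ E := by
      refine IntermediateField.adjoin_le_iff.2 ?_
      rintro _ ⟨u, u', -, rfl⟩
      exact div_mem
        (det_mem_subfield E.toSubfield _ fun i k => chartBasis_mem ε a E.toSubfield haE _ _)
        (det_mem_subfield E.toSubfield _ fun i k => chartBasis_mem ε a E.toSubfield haE _ _)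
    have hcF : AlgebraicIndependent F c :=
      AlgebraicIndependent.of_ringHom_of_comp_eq
        (IntermediateField.inclusion hFE : F →+* E) (RingHom.id Ω) (x := c) hcE
        (RingHom.injective _) rfl
    have hcardNP : Fintype.card (NP (Fin (q + 1)) (Fin (r - q)) (D + 1)) =
        Nat.choose (r + (D + 1)) (D + 1) - Nat.choose (q + (D + 1)) (D + 1) := by
      have h := Fintype.card_congr (pureNP (Fin (q + 1)) (Fin (r - q)) (D + 1))
      rw [Fintype.card_sum, Deg.card_eq, Deg.card_eq, Fintype.card_sum, Fintype.card_fin,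
        Fintype.card_fin, hr, show q + 1 + (D + 1) - 1 = q + (D + 1) by omega,
        show r + 1 + (D + 1) - 1 = r + (D + 1) by omega] at h
      omega
    let η := (Fintype.equivFinOfCardEq hcardNP).symm
    refine ⟨c ∘ η, hcF.comp _ η.injective, ?_, ?_⟩
    · intro i
      refine IntermediateField.subset_adjoin _ _ ⟨(η i).1.mapDomain ε, ?_⟩
      exact (hGcoeff _).symm
    · have hrange : ∀ μ, c μ ∈ IntermediateField.adjoin F (Set.range (c ∘ η)) := fun μ =>
        IntermediateField.subset_adjoin _ _ ⟨η.symm μ, by simp⟩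
      have haF2 : ∀ i j, a i j ∈ IntermediateField.adjoin F (Set.range (c ∘ η)) := fun i j =>
        IntermediateField.algebraMap_mem _ (⟨a i j, haF i j⟩ : F)
      have hmem : ∀ x ∈ Set.range g.coeff,
          x ∈ IntermediateField.adjoin F (Set.range (c ∘ η)) := by
        rintro _ ⟨μ, rfl⟩
        change coeff μ g ∈ _
        by_cases hμ : μ.degree = D + 1
        · rw [hgcoeff]
          have hμ' : (μ.mapDomain ε.symm).degree = D + 1 := by
            rw [Finsupp.degree_mapDomain, hμ]
          obtain ⟨z, hz⟩ := (pureNP _ _ _).surjective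
            (⟨μ.mapDomain ε.symm, hμ'⟩ : Deg (Fin (q + 1) ⊕ Fin (r - q)) (D + 1))
          have hz' := congrArg (fun w : Deg (Fin (q + 1) ⊕ Fin (r - q)) (D + 1) => w.1) hz
          simp only at hz'
          rw [← hz']
          rcases z with ν | μ'
          · have h1 : y ν = - coeff ν.1 (npPart c a) := by rw [ha0, neg_neg]
            change y ν ∈ _
            rw [h1]
            exact neg_mem (coeff_npPart_mem
              (IntermediateField.adjoin F (Set.range (c ∘ η))).toSubfield c a hrange haF2 ν.1)
          · exact hrange μ'
        · rw [hg.coeff_eq_zero hμ]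
          exact zero_mem _
      intro x hx
      exact isAlgebraic_algebraMap
        (⟨x, hmem x hx⟩ : IntermediateField.adjoin F (Set.range (c ∘ η)))
end

section
/- Let K' be a field of characteristic zero, let d ≥ 3 and let 2d−2 ≤ q < r. Let G = Σ_{|I|<2d} b_{I,J} Z^I Y^J be a homogeneous polynomial of degree 2d in Z_0,…,Z_q, Y_{q+1},…,Y_r in which every monomial involves at least one Y-variable, with all coefficients b_{I,J} algebraically independent over K'. Let η_1,…,η_{2d−2} be elements algebraically independent over the field K'(b) generated over K' by the b_{I,J}, and define G^T(Z̃_0,…,Z̃_q,Y) = G(Z̃_0, Z̃_1+η_1 Z̃_0, …, Z̃_{2d−2}+η_{2d−2} Z̃_0, Z̃_{2d−1},…,Z̃_q, Y) (the coordinate change moving the point η = (1,η_1,…,η_{2d−2},0,…,0) to (1,0,…,0)). Then G^T can be written as G^T = Σ_{s=1}^{2d} Z̃_0^{2d−s} Φ_s(Z̃_1,…,Z̃_q,Y_{q+1},…,Y_r), where each Φ_s is homogeneous of degree s and contains no monomial in Z̃_1,…,Z̃_q alone, and the coefficients of Φ_1, Φ_2, …, Φ_{2d−2}, all taken together, are algebraically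 independent over the field K'(η_1,…,η_{2d−2}). (Geometrically: the intersection F*_η of the first 2d−2 polar varieties of η with respect to B = {G = 0} with the hyperplane {Z̃_0 = 0} is a complete intersection of type (1,2,…,2d−2) in that hyperplane, generic over K'(η) subject to containing the linear space L_0* = {Z̃_0 = Y_{q+1} = … = Y_r = 0}.) -/
set_option synthInstance.maxHeartbeats 1000000
set_option maxHeartbeats 1000000

universe u

open MvPolynomial

theorem aux_indep_swap {K Ω ι κ : Type*} [Field K] [Field Ω] [Algebra K Ω]
    (L : IntermediateField K Ω) (b : ι → Ω) (y : κ → Ω)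
    (hbL : ∀ i, b i ∈ L)
    (hb : AlgebraicIndependent K b) (hy : AlgebraicIndependent L y) :
    AlgebraicIndependent (IntermediateField.adjoin K (Set.range y)) b := by
  have h1 : AlgebraicIndependent K (Sum.elim y b) := by
    refine hb.sumElim_of_tower (S := L) ?_ hy
    rintro _ ⟨i, rfl⟩
    exact ⟨⟨b i, hbL i⟩, rfl⟩
  have h2 : AlgebraicIndependent K (Sum.elim b y) := by
    have := h1.comp Sum.swap (Equiv.sumComm _ _).injective
    convert this using 1
    ext (_ | _) <;> rfl
  exact IntermediateField.algebraicIndependent_adjoin_iff.mpr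
    (AlgebraicIndependent.sumElim_iff.mp h2).2

theorem aux_indep_matrix {F Ω ι : Type*} [Field F] [Field Ω] [Algebra F Ω] [Fintype ι]
    [DecidableEq ι] (A B : Matrix ι ι F) (hAB : A * B = 1) (b c : ι → Ω)
    (hb : AlgebraicIndependent F b)
    (hc : ∀ j, c j = ∑ i, b i * algebraMap F Ω (A i j)) :
    AlgebraicIndependent F c := by
  let f : ι → MvPolynomial ι F := fun j => ∑ i, X i * C (A i j)
  let g : ι → MvPolynomial ι F := fun j => ∑ i, X i * C (B i j)
  have hBA : B * A = 1 := mul_eq_one_comm.mp hAB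
  have hgf : (aeval g).comp (aeval f) = AlgHom.id F _ := by
    apply MvPolynomial.algHom_ext
    intro j
    simp only [AlgHom.comp_apply, aeval_X, f, map_sum, map_mul, g, AlgHom.id_apply, algHom_C,
      MvPolynomial.algebraMap_eq, Finset.sum_mul]
    rw [Finset.sum_comm]
    have : ∀ k, ∑ i, X k * C (B k i) * C (A i j) = X k * C ((B * A) k j) := by
      intro k
      simp [Matrix.mul_apply, Finset.mul_sum, mul_assoc]
    simp only [this, hBA, Matrix.one_apply]
    simp
  have hf : AlgebraicIndependent F f := by
    refine Function.LeftInverse.injective (g := aeval g) fun p => ?_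
    exact DFunLike.congr_fun hgf p
  have := hb.aeval_of_algebraicIndependent hf
  convert this using 1
  ext j
  simp [f, hc]

theorem aux_sum_single (r k : ℕ) :
    ∑ i, (Finsupp.single (0 : Fin (r + 1)) k) i = k := by
  simp [Finsupp.single_apply]

/-- monomials allowed -/
abbrev AuxIdx (q r n : ℕ) : Type :=
  {μ : Fin (r + 1) →₀ ℕ // (∑ i, μ i) = n ∧ ∃ i : Fin (r + 1), q < (i : ℕ) ∧ μ i ≠ 0}

noncomputable def auxT {r : ℕ} {R : Type*} [CommRing R] (η : Fin (r + 1) → R) :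
    MvPolynomial (Fin (r + 1)) R →ₐ[R] MvPolynomial (Fin (r + 1)) R :=
  aeval (fun i : Fin (r + 1) => if i = 0 then X 0 else X i + C (η i) * X 0)

def AuxOk {R : Type*} [CommRing R] (q r n : ℕ) (p : MvPolynomial (Fin (r + 1)) R) : Prop :=
  ∀ μ ∈ p.support, (∑ i, μ i) = n ∧ ∃ i : Fin (r + 1), q < (i : ℕ) ∧ μ i ≠ 0

theorem auxOk_iff {R : Type*} [CommRing R] (q r n : ℕ) (p : MvPolynomial (Fin (r + 1)) R) :
    AuxOk q r n p ↔ p.IsHomogeneous n ∧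
      p ∈ Ideal.span (X '' {i : Fin (r + 1) | q < (i : ℕ)} : Set (MvPolynomial _ R)) := by
  rw [mem_ideal_span_X_image]
  constructor
  · intro h
    refine ⟨?_, fun μ hμ => ?_⟩
    · intro μ hμ
      rw [← (h μ (mem_support_iff.mpr hμ)).1, Finsupp.weight_apply, Finsupp.sum_fintype] <;> simp
    · obtain ⟨_, i, hi, h2⟩ := h μ hμ
      exact ⟨i, hi, h2⟩
  · rintro ⟨h1, h2⟩ μ hμ
    obtain ⟨i, hi, h3⟩ := h2 μ hμ
    refine ⟨?_, i, hi, h3⟩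
    rw [← h1 (mem_support_iff.mp hμ), Finsupp.weight_apply, Finsupp.sum_fintype] <;> simp

theorem auxT_ok {R : Type*} [CommRing R] (q r n : ℕ) (η : Fin (r + 1) → R)
    (hη : ∀ i : Fin (r + 1), q < (i : ℕ) → η i = 0)
    (p : MvPolynomial (Fin (r + 1)) R) (hp : AuxOk q r n p) : AuxOk q r n (auxT η p) := by
  rw [auxOk_iff] at hp ⊢
  constructor
  · have := hp.1.aeval (n := 1)
      (fun i : Fin (r + 1) => if i = 0 then X 0 else X i + C (η i) * X 0) (by
        intro i
        split_ifs
        · exact isHomogeneous_X _ _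
        · refine (isHomogeneous_X _ _).add ?_
          simpa using (isHomogeneous_C _ (η i)).mul (isHomogeneous_X R (0 : Fin (r + 1))))
    simpa [auxT] using this
  · have h2 := Ideal.mem_map_of_mem (auxT η) hp.2
    refine (?_ : Ideal.map (auxT η) _ ≤ _) h2
    rw [Ideal.map_span, Ideal.span_le]
    rintro _ ⟨_, ⟨i, hi, rfl⟩, rfl⟩
    have hi' : q < (i : ℕ) := hi
    have h0 : i ≠ 0 := by rintro rfl; simp at hi'
    have : auxT η (X i) = X i := by simp [auxT, h0, hη i hi']
    rw [this]
    exact Ideal.subset_span ⟨i, hi, rfl⟩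

theorem auxT_inv {R : Type*} [CommRing R] {r : ℕ} (η : Fin (r + 1) → R)
    (p : MvPolynomial (Fin (r + 1)) R) : auxT (-η) (auxT η p) = p := by
  have : (auxT (-η)).comp (auxT η) = AlgHom.id R _ := by
    apply MvPolynomial.algHom_ext
    intro i
    by_cases hi : i = 0
    · subst hi; simp [auxT]
    · simp [auxT, hi, algHom_C, MvPolynomial.algebraMap_eq]
  exact DFunLike.congr_fun this p

theorem auxT_map {F R : Type*} [CommRing F] [CommRing R] [Algebra F R] {r : ℕ}
    (η : Fin (r + 1) → F) (p : MvPolynomial (Fin (r + 1)) F) :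
    auxT (fun i => algebraMap F R (η i)) (map (algebraMap F R) p)
      = map (algebraMap F R) (auxT η p) := by
  induction p using MvPolynomial.induction_on with
  | C a => simp [algHom_C, MvPolynomial.algebraMap_eq]
  | add p q hp hq => simp [hp, hq]
  | mul_X p i hp =>
    simp only [map_mul, hp, map_X]
    congr 1
    by_cases hi : i = 0
    · subst hi; simp [auxT]
    · simp [auxT, hi]

noncomputable instance (q r n : ℕ) : Fintype (AuxIdx q r n) := by
  have : Finite (AuxIdx q r n) := by
    have h : Set.Finite {μ : Fin (r + 1) →₀ ℕ | ∀ i, μ i ≤ n} := by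
      have h1 : Set.Finite {f : Fin (r + 1) → ℕ | ∀ i, f i ≤ n} :=
        (Set.finite_Iic (fun _ : Fin (r + 1) => n)).subset fun f hf => hf
      exact h1.preimage (f := fun μ : Fin (r + 1) →₀ ℕ => (μ : Fin (r + 1) → ℕ))
        DFunLike.coe_injective.injOn
    refine (h.subset ?_ : Set.Finite {μ : Fin (r + 1) →₀ ℕ | (∑ i, μ i) = n ∧
      ∃ i : Fin (r + 1), q < (i : ℕ) ∧ μ i ≠ 0})
    rintro μ ⟨h1, -⟩ i
    rw [← h1]
    exact Finset.single_le_sum (f := fun i => μ i) (fun _ _ => Nat.zero_le _) (Finset.mem_univ i)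
  exact Fintype.ofFinite _

theorem auxOk_sum {R : Type*} [CommRing R] (q r n : ℕ) (p : MvPolynomial (Fin (r + 1)) R)
    (hp : AuxOk q r n p) :
    p = ∑ μ : AuxIdx q r n, C (p.coeff μ.1) * monomial μ.1 1 := by
  classical
  ext ν
  simp only [coeff_sum, coeff_C_mul, coeff_monomial]
  by_cases hν : ν ∈ p.support
  · rw [Finset.sum_eq_single (⟨ν, hp ν hν⟩ : AuxIdx q r n)]
    · simp
    · intro μ _ hμ
      rw [if_neg, mul_zero]
      rintro rfl
      exact hμ rfl
    · simp
  · rw [notMem_support_iff.mp hν, Finset.sum_eq_zero]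
    intro μ _
    split_ifs with h
    · rw [h, notMem_support_iff.mp hν, zero_mul]
    · simp

theorem aux_mono_ok {R : Type*} [CommRing R] {q r n : ℕ} (μ : AuxIdx q r n) :
    AuxOk q r n (monomial μ.1 (1 : R)) := by
  intro ν hν
  have : ν = μ.1 := by
    have := support_monomial_subset hν
    simpa using this
  rw [this]
  exact μ.2

theorem aux_indep_T {F Ω : Type*} [Field F] [Field Ω] [Algebra F Ω] (q r n : ℕ)
    (G : MvPolynomial (Fin (r + 1)) Ω) (hG : AuxOk q r n G)
    (hb : AlgebraicIndependent F (fun μ : AuxIdx q r n => G.coeff μ.1))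
    (η : Fin (r + 1) → F) (hη : ∀ i : Fin (r + 1), q < (i : ℕ) → η i = 0) :
    AlgebraicIndependent F (fun μ : AuxIdx q r n =>
      (auxT (fun i => algebraMap F Ω (η i)) G).coeff μ.1) := by
  classical
  let A : Matrix (AuxIdx q r n) (AuxIdx q r n) F :=
    fun μ ν => (auxT η (monomial μ.1 1)).coeff ν.1
  let B : Matrix (AuxIdx q r n) (AuxIdx q r n) F :=
    fun μ ν => (auxT (-η) (monomial μ.1 1)).coeff ν.1
  refine aux_indep_matrix A B ?_ _ _ hb ?_
  · ext μ κ
    have h1 := auxOk_sum q r n _ (auxT_ok q r n η hη _ (aux_mono_ok (R := F) μ))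
    have h2 := congrArg (fun p => (auxT (-η) p).coeff κ.1) h1
    simp only [auxT_inv, map_sum, map_mul, algHom_C, MvPolynomial.algebraMap_eq, coeff_sum,
      coeff_C_mul, coeff_monomial] at h2
    rw [Matrix.mul_apply, Matrix.one_apply, ← h2]
    simp only [Subtype.ext_iff]
  · intro ν
    conv_lhs => rw [auxOk_sum q r n G hG]
    simp only [map_sum, map_mul, algHom_C, MvPolynomial.algebraMap_eq, coeff_sum, coeff_C_mul]
    refine Finset.sum_congr rfl fun μ _ => ?_
    congr 1
    have := auxT_map (R := Ω) η (monomial μ.1 1)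
    rw [map_monomial, map_one] at this
    rw [this, coeff_map]

theorem aux_decomp {R : Type*} [CommRing R] (q r n : ℕ)
    (P : MvPolynomial (Fin (r + 1)) R) (hP : AuxOk q r n P) :
    ∃ Φ : ℕ → MvPolynomial (Fin (r + 1)) R,
      (P = ∑ s ∈ Finset.Icc 1 n, X 0 ^ (n - s) * Φ s) ∧
      (∀ s ∈ Finset.Icc 1 n, (Φ s).IsHomogeneous s) ∧
      (∀ s ∈ Finset.Icc 1 n, ∀ μ ∈ (Φ s).support,
        μ 0 = 0 ∧ ∃ i : Fin (r + 1), q < (i : ℕ) ∧ μ i ≠ 0) ∧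
      ∀ s, ∀ μ : Fin (r + 1) →₀ ℕ, μ 0 = 0 →
        (Φ s).coeff μ = P.coeff (μ + Finsupp.single 0 (n - s)) := by
  classical
  let Φ : ℕ → MvPolynomial (Fin (r + 1)) R := fun s =>
    ∑ ν ∈ P.support with ν 0 = n - s, monomial (ν.erase 0) (P.coeff ν)
  have hcoeff : ∀ s, ∀ μ : Fin (r + 1) →₀ ℕ, μ 0 = 0 →
        (Φ s).coeff μ = P.coeff (μ + Finsupp.single 0 (n - s)) := by
    intro s μ hμ
    simp only [Φ, coeff_sum, coeff_monomial]
    rw [Finset.sum_filter]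
    simp only [← ite_and]
    have : ∀ ν : Fin (r + 1) →₀ ℕ, (ν 0 = n - s ∧ ν.erase 0 = μ) ↔
        ν = μ + Finsupp.single 0 (n - s) := by
      intro ν
      constructor
      · rintro ⟨h1, rfl⟩
        rw [← h1, Finsupp.erase_add_single]
      · rintro rfl
        refine ⟨by simp [hμ], ?_⟩
        ext i
        by_cases hi : i = 0
        · subst hi; simp [hμ]
        · simp [hi]
    simp only [this]
    rw [Finset.sum_ite_eq']
    split_ifs with h
    · rfl
    · exact (notMem_support_iff.mp h).symm
  have hsupp : ∀ s, ∀ μ ∈ (Φ s).support, μ 0 = 0 := by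
    intro s μ hμ
    by_contra h0
    apply mem_support_iff.mp hμ
    simp only [Φ, coeff_sum, coeff_monomial]
    refine Finset.sum_eq_zero fun ν _ => ?_
    rw [if_neg]
    rintro rfl
    simp at h0
  have hsupp2 : ∀ s, ∀ μ ∈ (Φ s).support, μ + Finsupp.single 0 (n - s) ∈ P.support := by
    intro s μ hμ
    rw [mem_support_iff, ← hcoeff s μ (hsupp s μ hμ)]
    exact mem_support_iff.mp hμ
  refine ⟨Φ, ?_, ?_, ?_, hcoeff⟩
  · have hX : ∀ s, X 0 ^ (n - s) * Φ s = ∑ ν ∈ P.support with ν 0 = n - s,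
        monomial ν (P.coeff ν) := by
      intro s
      simp only [Φ, Finset.mul_sum]
      refine Finset.sum_congr rfl fun ν hν => ?_
      rw [X_pow_eq_monomial, monomial_mul, one_mul, ← (Finset.mem_filter.mp hν).2,
        Finsupp.single_add_erase]
    have hmem : ∀ ν ∈ P.support, n - ν 0 ∈ Finset.Icc 1 n ∧ ν 0 ≤ n := by
      intro ν hν
      obtain ⟨h1, i, hi, h2⟩ := hP ν hν
      have h0 : i ≠ 0 := by rintro rfl; simp at hi
      have h3 : ν 0 + ν i ≤ ∑ i, ν i := by
        rw [← Finset.sum_pair h0.symm (f := fun i => ν i)]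
        exact Finset.sum_le_sum_of_subset (Finset.subset_univ _)
      rw [Finset.mem_Icc]
      omega
    conv_lhs => rw [P.as_sum, ← Finset.sum_fiberwise_of_maps_to (fun ν hν => (hmem ν hν).1)]
    refine Finset.sum_congr rfl fun s hs => ?_
    rw [hX]
    refine Finset.sum_congr ?_ fun _ _ => rfl
    ext ν
    simp only [Finset.mem_filter]
    refine and_congr_right fun hν => ?_
    have := hmem ν hν
    rw [Finset.mem_Icc] at this hs
    omega
  · intro s hs μ hμ
    have h1 := (hP _ (hsupp2 s μ (mem_support_iff.mpr hμ))).1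
    rw [Finset.mem_Icc] at hs
    simp only [Finsupp.add_apply, Finset.sum_add_distrib] at h1
    have h2 : ∑ i, (Finsupp.single (0 : Fin (r + 1)) (n - s)) i = n - s := aux_sum_single _ _
    rw [Finsupp.weight_apply, Finsupp.sum_fintype _ _ (by simp)]
    simp only [Pi.one_apply, smul_eq_mul, mul_one]
    omega
  · intro s hs μ hμ
    refine ⟨hsupp s μ hμ, ?_⟩
    obtain ⟨_, i, hi, h2⟩ := hP _ (hsupp2 s μ hμ)
    have h0 : i ≠ 0 := by rintro rfl; simp at hi
    refine ⟨i, hi, ?_⟩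
    simpa [Finsupp.single_apply, h0.symm] using h2

/-- **The crucial polar-genericity lemma (Lemma 5 of the paper).** Let `K'` be a field
of characteristic zero, `d ≥ 3` and `2d - 2 ≤ q < r`. Let
`G = Σ_{|I| < 2d} b_{I,J} Z^I Y^J` be a homogeneous polynomial of degree `2d` in the
variables `Z_0, …, Z_q, Y_{q+1}, …, Y_r` (in an extension field `Ω` of `K'`; the
variable of index `i` is a `Z`-variable if `i ≤ q` and a `Y`-variable if `i > q`), every
monomial of which involves at least one `Y`-variable, with all coefficients `b_{I,J}`
(in the allowed range) algebraically independent over `K'`. Let `η_1, …, η_{2d-2}` be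
elements algebraically independent over the field `K'(b)` generated over `K'` by the
coefficients, and perform the coordinate change
`G^T(Z̃, Y) = G(Z̃_0, Z̃_1 + η_1 Z̃_0, …, Z̃_{2d-2} + η_{2d-2} Z̃_0, Z̃_{2d-1}, …, Z̃_q, Y)`
moving the point `η = (1, η_1, …, η_{2d-2}, 0, …, 0)` to `(1, 0, …, 0)`. Then
`G^T = Σ_{s=1}^{2d} Z̃_0^{2d-s} Φ_s(Z̃_1, …, Z̃_q, Y)` where each `Φ_s` is homogeneous of
degree `s` and contains no monomial in the `Z̃`-variables alone, and the coefficients of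
`Φ_1, …, Φ_{2d-2}` (in the allowed range), all taken together, are algebraically
independent over `K'(η_1, …, η_{2d-2})`. Geometrically: `F*_η`, the intersection of the
first `2d - 2` polars of `η` with respect to `B = {G = 0}` with the hyperplane
`{Z̃_0 = 0}`, is a complete intersection of type `(1, 2, …, 2d-2)` generic over `K'(η)`
subject to containing `L₀* = {Z̃_0 = Y = 0}`. -/
theorem stmt_5 (K' : Type u) [Field K'] [CharZero K'] (d q r : ℕ)
    (hd : 3 ≤ d) (hdq : 2 * d - 2 ≤ q) (hqr : q < r)
    (Ω : Type u) [Field Ω] [Algebra K' Ω]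
    (G : MvPolynomial (Fin (r + 1)) Ω) (hG : G.IsHomogeneous (2 * d))
    (hY : ∀ μ ∈ G.support, ∃ i : Fin (r + 1), q < (i : ℕ) ∧ μ i ≠ 0)
    (hb : AlgebraicIndependent K'
      (fun μ : {μ : Fin (r + 1) →₀ ℕ //
        (∑ i, μ i) = 2 * d ∧ ∃ i : Fin (r + 1), q < (i : ℕ) ∧ μ i ≠ 0} => G.coeff μ.1))
    (η : Fin (r + 1) → Ω) (hη0 : η 0 = 1)
    (hηz : ∀ i : Fin (r + 1), 2 * d - 2 < (i : ℕ) → η i = 0)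
    (hηind : AlgebraicIndependent
      (↥(IntermediateField.adjoin K' (Set.range G.coeff)))
      (fun j : Fin (2 * d - 2) => η ⟨(j : ℕ) + 1, by have := j.isLt; omega⟩)) :
    ∃ Φ : ℕ → MvPolynomial (Fin (r + 1)) Ω,
      (MvPolynomial.aeval (fun i : Fin (r + 1) =>
          if i = 0 then MvPolynomial.X 0
          else MvPolynomial.X i + MvPolynomial.C (η i) * MvPolynomial.X 0) G
        = ∑ s ∈ Finset.Icc 1 (2 * d), MvPolynomial.X 0 ^ (2 * d - s) * Φ s) ∧
      (∀ s ∈ Finset.Icc 1 (2 * d), (Φ s).IsHomogeneous s) ∧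
      (∀ s ∈ Finset.Icc 1 (2 * d), ∀ μ ∈ (Φ s).support,
        μ 0 = 0 ∧ ∃ i : Fin (r + 1), q < (i : ℕ) ∧ μ i ≠ 0) ∧
      AlgebraicIndependent
        (↥(IntermediateField.adjoin K'
          (Set.range (fun j : Fin (2 * d - 2) =>
            η ⟨(j : ℕ) + 1, by have := j.isLt; omega⟩))))
        (fun p : (Σ s : {s : ℕ // 1 ≤ s ∧ s ≤ 2 * d - 2},
            {μ : Fin (r + 1) →₀ ℕ // (∑ i, μ i) = s.1 ∧ μ 0 = 0 ∧
              ∃ i : Fin (r + 1), q < (i : ℕ) ∧ μ i ≠ 0}) =>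
          (Φ p.1.1).coeff p.2.1) := by
  classical
  have hGok : AuxOk q r (2 * d) G := by
    intro μ hμ
    refine ⟨?_, hY μ hμ⟩
    rw [← hG (mem_support_iff.mp hμ), Finsupp.weight_apply, Finsupp.sum_fintype] <;> simp
  set F := IntermediateField.adjoin K' (Set.range (fun j : Fin (2 * d - 2) =>
            η ⟨(j : ℕ) + 1, by have := j.isLt; omega⟩)) with hF
  have hbF : AlgebraicIndependent F (fun μ : AuxIdx q r (2 * d) => G.coeff μ.1) :=
    aux_indep_swap _ _ _ (fun μ => IntermediateField.subset_adjoin K' _ (Set.mem_range_self μ.1)) hb hηind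
  have hmem : ∀ i, η i ∈ F := by
    intro i
    by_cases h0 : i = 0
    · rw [h0, hη0]; exact one_mem _
    by_cases h1 : 2 * d - 2 < (i : ℕ)
    · rw [hηz i h1]; exact zero_mem _
    · have h2 : (i : ℕ) ≠ 0 := fun h => h0 (Fin.ext h)
      refine IntermediateField.subset_adjoin _ _ ⟨⟨(i : ℕ) - 1, by omega⟩, ?_⟩
      have h3 : (⟨(i : ℕ) - 1 + 1, by omega⟩ : Fin (r + 1)) = i := Fin.ext (by simp only; omega)
      exact congrArg η h3
  have hηq : ∀ i : Fin (r + 1), q < (i : ℕ) → η i = 0 := fun i hi => hηz i (by omega)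
  have hind := aux_indep_T q r (2 * d) G hGok hbF (fun i => ⟨η i, hmem i⟩)
    (fun i hi => Subtype.ext (hηq i hi))
  obtain ⟨Φ, h1, h2, h3, h4⟩ := aux_decomp q r (2 * d) _ (auxT_ok q r (2 * d) η hηq G hGok)
  refine ⟨Φ, h1, h2, h3, ?_⟩
  let e : (Σ s : {s : ℕ // 1 ≤ s ∧ s ≤ 2 * d - 2},
            {μ : Fin (r + 1) →₀ ℕ // (∑ i, μ i) = s.1 ∧ μ 0 = 0 ∧
              ∃ i : Fin (r + 1), q < (i : ℕ) ∧ μ i ≠ 0}) → AuxIdx q r (2 * d) :=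
    fun p => ⟨p.2.1 + Finsupp.single 0 (2 * d - p.1.1), by
      obtain ⟨⟨s, hs1, hs2⟩, μ, hμ, hμ0, i, hi, hμi⟩ := p
      simp only at hμ ⊢
      constructor
      · simp only [Finsupp.add_apply, Finset.sum_add_distrib, hμ, aux_sum_single]
        omega
      · exact ⟨i, hi, by simp [hμi]⟩⟩
  have he : Function.Injective e := by
    rintro ⟨⟨s, hs⟩, μ, hμ, hμ0, hμ1⟩ ⟨⟨t, ht⟩, ν, hν, hν0, hν1⟩ h
    have h' : μ + Finsupp.single 0 (2 * d - s) = ν + Finsupp.single 0 (2 * d - t) :=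
      congrArg Subtype.val h
    have h0 := DFunLike.congr_fun h' 0
    simp [hμ0, hν0] at h0
    have hst : s = t := by omega
    subst hst
    have : μ = ν := add_right_cancel h'
    subst this
    rfl
  have := hind.comp e he
  convert this using 1
  ext p
  exact h4 p.1.1 p.2.1 p.2.2.2.1
end
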